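/- arXiv:2309.16607 — 3 statements merged into one kernel-verified Lean document; each statement's English description precedes it below -/
import Mathlib

section
/- Let q be a prime power, n a positive integer, and let Δ ∈ M_n(𝔽_q) be simple, i.e. its characteristic polynomial is irreducible over 𝔽_q. Then for every partition μ of n, σ(μ,Δ) = ((q^n − 1)/(q^{μ1} − 1)) · ∏_{i≥2} q^{μ_i² − μ_i} [μ_{i−1} choose μ_i]_q (a finite product, since all but finitely many factors equal 1). -/
open Matrix Module Polynomial

attribute [local instance] Classical.propDecidable

/-- `μ` is a partition: its parts are weakly decreasing. -/
def IsPtn (μ : ℕ →₀ ℕ) : Prop := ∀ i, μ (i + 1) ≤ μ i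

/-- The size `|μ|` of a partition. -/
def ptnSize (μ : ℕ →₀ ℕ) : ℕ := μ.sum fun _ v => v

/-- `W + ΔW + ⋯ + Δ^{j-1}W`. -/
noncomputable def iterSpan {F : Type} [Field F] {n : ℕ} (Δ : Matrix (Fin n) (Fin n) F)
    (W : Submodule F (Fin n → F)) (j : ℕ) : Submodule F (Fin n → F) :=
  ⨆ i ∈ Finset.range j, W.map (Δ ^ i).mulVecLin

/-- `W` has `Δ`-profile `μ`. -/
def HasProfile {F : Type} [Field F] {n : ℕ} (Δ : Matrix (Fin n) (Fin n) F)
    (μ : ℕ →₀ ℕ) (W : Submodule F (Fin n → F)) : Prop :=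
  ∀ j : ℕ, Module.finrank F (iterSpan Δ W (j + 1)) = ∑ i ∈ Finset.range (j + 1), μ i

/-- `σ(μ, Δ)`: the number of subspaces with `Δ`-profile `μ`. -/
noncomputable def sigmaProf {F : Type} [Field F] {n : ℕ} (μ : ℕ →₀ ℕ)
    (Δ : Matrix (Fin n) (Fin n) F) : ℕ :=
  Nat.card {W : Submodule F (Fin n → F) // HasProfile Δ μ W}

/-- `X_α(Δ)`: the number of flags of `Δ`-invariant subspaces with successive
quotient dimensions given by `α`. -/
noncomputable def Xflag {F : Type} [Field F] {n ℓ : ℕ} (Δ : Matrix (Fin n) (Fin n) F)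
    (α : Fin ℓ → ℕ) : ℕ :=
  Nat.card {W : Fin (ℓ + 1) → Submodule F (Fin n → F) //
    Monotone W ∧ W 0 = ⊥ ∧ W (Fin.last ℓ) = ⊤ ∧
    (∀ i, (W i).map Δ.mulVecLin ≤ W i) ∧
    ∀ i : Fin ℓ, Module.finrank F (W i.succ) = Module.finrank F (W i.castSucc) + α i}

/-- The Gaussian binomial coefficient as a polynomial in `t`. -/
noncomputable def qbp : ℕ → ℕ → Polynomial ℤ
  | _, 0 => 1
  | 0, _ + 1 => 0
  | a + 1, b + 1 => qbp a b + Polynomial.X ^ (b + 1) * qbp a (b + 1)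

/-- The `q`-integer `[m]_t`. -/
def qNat (t : ℚ) (m : ℕ) : ℚ := ∑ i ∈ Finset.range m, t ^ i

/-- The `q`-factorial `[m]_t!`. -/
def qFact (t : ℚ) (m : ℕ) : ℚ := ∏ i ∈ Finset.range m, qNat t (i + 1)



set_option linter.unusedSectionVars false
set_option linter.unusedVariables false
section PartA
variable {F V : Type} [Field F] [Fintype F] [AddCommGroup V] [Module F V] [FiniteDimensional F V]

/-- `T` restricted to `X` has no nonzero invariant subspace. -/
def PSimple (X : Submodule F V) (T : V →ₗ[F] V) : Prop :=
  ∀ Y : Submodule F V, Y ≤ X → Y ≤ Y.comap T → Y = ⊥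

/-- Strings. -/
def IsStr (X : Submodule F V) (T : V →ₗ[F] V) (v : V) (Y : Submodule F V) : Prop :=
  Y ≤ X ⊔ Submodule.span F {v} ∧ (∃ u ∈ Y, u - v ∈ X) ∧ Y ⊓ X ≤ Y.comap T


lemma IsStr.decomp {X : Submodule F V} {T : V →ₗ[F] V} {v : V} {Y : Submodule F V}
    (h : Y ≤ X ⊔ Submodule.span F {v}) {u : V} (huX : u - v ∈ X) {y : V} (hy : y ∈ Y) :
    ∃ c : F, y - c • u ∈ X := by
  obtain ⟨x, hx, z, hz, rfl⟩ := Submodule.mem_sup.1 (h hy)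
  obtain ⟨c, rfl⟩ := Submodule.mem_span_singleton.1 hz
  refine ⟨c, ?_⟩
  have : x + c • v - c • u = x - c • (u - v) := by rw [smul_sub]; abel
  rw [this]
  exact X.sub_mem hx (X.smul_mem _ huX)


/-- Rank-one modification. -/
def modT (T : V →ₗ[F] V) (l : V →ₗ[F] F) (w : V) : V →ₗ[F] V := T + l.smulRight w

lemma modT_apply (T : V →ₗ[F] V) (l : V →ₗ[F] F) (w x : V) :
    modT T l w x = T x + l x • w := rfl

lemma IsStr.inv_iff {X : Submodule F V} {T : V →ₗ[F] V} {v : V} {l : V →ₗ[F] F}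
    (hl : X ≤ LinearMap.ker l) (hlv : l v = 1) {Y : Submodule F V} (hY : IsStr X T v Y)
    {u : V} (hu : u ∈ Y) (huX : u - v ∈ X) (w : V) :
    Y ≤ Y.comap (modT T l w) ↔ T u + w ∈ Y := by
  have lu : l u = 1 := by
    have : l (u - v) = 0 := hl huX
    rw [map_sub, sub_eq_zero] at this
    rw [this, hlv]
  constructor
  · intro h
    have := h hu
    simpa [modT_apply, lu] using this
  · intro h y hy
    obtain ⟨c, hc⟩ := IsStr.decomp (T := T) hY.1 huX hy
    have hz : y - c • u ∈ Y := Y.sub_mem hy (Y.smul_mem _ hu)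
    have h1 : T (y - c • u) ∈ Y := hY.2.2 ⟨hz, hc⟩
    have h2 : l (y - c • u) = 0 := hl hc
    have h3 : modT T l w y = T (y - c • u) + c • (T u + w) := by
      have : l y = c := by
        rw [map_sub, map_smul, lu] at h2
        simpa [sub_eq_zero] using h2
      rw [modT_apply, this, map_sub, map_smul, smul_add]; abel
    change modT T l w y ∈ Y
    rw [h3]
    exact Y.add_mem h1 (Y.smul_mem _ h)

lemma IsStr.card_eq {X : Submodule F V} {T : V →ₗ[F] V} {v : V} {l : V →ₗ[F] F}
    (hl : X ≤ LinearMap.ker l) (hlv : l v = 1) {Y : Submodule F V} (hY : IsStr X T v Y) :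
    Nat.card {w : V // Y ≤ Y.comap (modT T l w)} =
      Fintype.card F * Nat.card {x : X // v + (x : V) ∈ Y} := by
  obtain ⟨u, hu, huX⟩ := hY.2.1
  have lu : l u = 1 := by
    have : l (u - v) = 0 := hl huX
    rw [map_sub, sub_eq_zero] at this
    rw [this, hlv]
  rw [← Nat.card_eq_fintype_card, ← Nat.card_prod]
  symm
  refine Nat.card_eq_of_bijective
    (fun p : F × {x : X // v + (x : V) ∈ Y} =>
      (⟨p.1 • u + (v + (p.2.1 : V) - u) - T u, ?_⟩ : {w : V // Y ≤ Y.comap (modT T l w)})) ⟨?_, ?_⟩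
  · rw [IsStr.inv_iff hl hlv hY hu huX]
    have : T u + (p.1 • u + (v + (p.2.1 : V) - u) - T u) = p.1 • u + (v + (p.2.1 : V) - u) := by
      abel
    rw [this]
    exact Y.add_mem (Y.smul_mem _ hu) (Y.sub_mem p.2.2 hu)
  · rintro ⟨c, ⟨⟨x, hx⟩, hxY⟩⟩ ⟨c', ⟨⟨x', hx'⟩, hxY'⟩⟩ h
    have h := congrArg Subtype.val h
    simp only at h
    have h' : c • u + (v + x - u) = c' • u + (v + x' - u) := sub_left_injective h
    have hx0 : l x = 0 := hl hx
    have hx0' : l x' = 0 := hl hx'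
    have h2 := congrArg l h'
    simp only [map_add, map_sub, map_smul, lu, hlv, hx0, hx0'] at h2
    have hc : c = c' := by simpa using h2
    subst hc
    have : x = x' := by simpa using h'
    subst this
    rfl
  · rintro ⟨w, hw⟩
    rw [IsStr.inv_iff hl hlv hY hu huX] at hw
    obtain ⟨c, hc⟩ := IsStr.decomp (T := T) hY.1 huX hw
    have hm : T u + w - c • u + (u - v) ∈ X := X.add_mem hc huX
    refine ⟨(c, ⟨⟨T u + w - c • u + (u - v), hm⟩, ?_⟩), ?_⟩
    · have : v + (T u + w - c • u + (u - v)) = T u + w - c • u + u := by abel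
      simp only [this]
      exact Y.add_mem (Y.sub_mem hw (Y.smul_mem _ hu)) hu
    · apply Subtype.ext
      simp only
      abel

lemma sSup_invariant (T : V →ₗ[F] V) (S : Set (Submodule F V)) (h : ∀ Y ∈ S, Y ≤ Y.comap T) :
    sSup S ≤ (sSup S).comap T :=
  sSup_le fun Y hY => (h Y hY).trans (Submodule.comap_mono (le_sSup hY))

lemma bad_unique {X : Submodule F V} {T : V →ₗ[F] V} {v : V} {l : V →ₗ[F] F}
    (hl : X ≤ LinearMap.ker l) (hlv : l v = 1) (hs : PSimple X T) (w : V)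
    (hw : ¬ PSimple (X ⊔ Submodule.span F {v}) (modT T l w)) :
    ∃! Y, Maximal (IsStr X T v) Y ∧ Y ≤ Y.comap (modT T l w) := by
  set S : Set (Submodule F V) :=
    {Y | Y ≤ X ⊔ Submodule.span F {v} ∧ Y ≤ Y.comap (modT T l w)} with hS
  have hinv : sSup S ≤ (sSup S).comap (modT T l w) := sSup_invariant _ _ fun Y hY => hY.2
  have hle : sSup S ≤ X ⊔ Submodule.span F {v} := sSup_le fun Y hY => hY.1
  have hT : ∀ x ∈ X, modT T l w x = T x := by
    intro x hx
    have : l x = 0 := hl hx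
    simp [modT_apply, this]
  have hne : sSup S ≠ ⊥ := by
    intro h0
    apply hw
    intro Y hY1 hY2
    have : Y ≤ sSup S := le_sSup ⟨hY1, hY2⟩
    rw [h0] at this
    exact le_bot_iff.1 this
  have hnX : ¬ sSup S ≤ X := by
    intro hX
    apply hne
    apply hs _ hX
    intro y hy
    have := hinv hy
    rw [Submodule.mem_comap, hT y (hX hy)] at this
    exact this
  have hstr : IsStr X T v (sSup S) := by
    refine ⟨hle, ?_, ?_⟩
    · obtain ⟨y, hy, hyX⟩ := SetLike.not_le_iff_exists.1 hnX
      obtain ⟨c, hc⟩ := IsStr.decomp (T := T) hle (u := v) (by simp) hy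
      have hc0 : c ≠ 0 := by
        rintro rfl
        apply hyX
        simpa using hc
      refine ⟨c⁻¹ • y, Submodule.smul_mem _ _ hy, ?_⟩
      have := X.smul_mem c⁻¹ hc
      rwa [smul_sub, inv_smul_smul₀ hc0] at this
    · rintro y ⟨hy, hyX⟩
      have := hinv hy
      rw [Submodule.mem_comap, hT y hyX] at this
      exact this
  refine ⟨sSup S, ⟨⟨hstr, ?_⟩, hinv⟩, ?_⟩
  · intro Z hZ hSZ
    apply le_sSup
    refine ⟨hZ.1, ?_⟩
    obtain ⟨u, hu, huX⟩ := hstr.2.1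
    rw [IsStr.inv_iff hl hlv hZ (hSZ hu) huX]
    exact hSZ ((IsStr.inv_iff hl hlv hstr hu huX w).1 hinv)
  · rintro Z ⟨hZ, hZi⟩
    have : Z ≤ sSup S := le_sSup ⟨hZ.1.1, hZi⟩
    exact le_antisymm this (hZ.2 hstr this)

lemma str_unique {X : Submodule F V} {T : V →ₗ[F] V} {v : V} {l : V →ₗ[F] F}
    (hl : X ≤ LinearMap.ker l) (hlv : l v = 1) (x : X) :
    ∃! Y, Maximal (IsStr X T v) Y ∧ v + (x : V) ∈ Y := by
  set u : V := v + (x : V) with hu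
  have huX : u - v ∈ X := by simp [hu]
  have lu : l u = 1 := by
    have : l (x : V) = 0 := hl x.2
    simp [hu, hlv, this]
  set S : Set (Submodule F V) := {Y | IsStr X T v Y ∧ u ∈ Y} with hS
  have h1 : Submodule.span F {u} ∈ S := by
    refine ⟨⟨?_, ⟨u, Submodule.mem_span_singleton_self u, huX⟩, ?_⟩,
      Submodule.mem_span_singleton_self u⟩
    · rw [Submodule.span_singleton_le_iff_mem, hu, add_comm]
      exact Submodule.add_mem_sup x.2 (Submodule.mem_span_singleton_self v)
    · rintro y ⟨hy, hyX⟩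
      obtain ⟨c, rfl⟩ := Submodule.mem_span_singleton.1 hy
      have : l (c • u) = 0 := hl hyX
      rw [map_smul, lu, smul_eq_mul, mul_one] at this
      simp [this]
  have hus : u ∈ sSup S := le_sSup h1 (Submodule.mem_span_singleton_self u)
  -- every element of the supremum is, modulo `u`, mapped inside
  have key : sSup S ≤ (sSup S).comap (modT T l (-(T u))) := by
    apply sSup_invariant
    rintro Y ⟨hY, huY⟩
    rw [IsStr.inv_iff hl hlv hY huY huX]
    simp
  have hstr : IsStr X T v (sSup S) := by
    refine ⟨sSup_le fun Y hY => hY.1.1, ⟨u, hus, huX⟩, ?_⟩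
    rintro y ⟨hy, hyX⟩
    have h := key hy
    have h0 : l y = 0 := hl hyX
    simpa [modT_apply, h0] using h
  refine ⟨sSup S, ⟨⟨hstr, ?_⟩, hus⟩, ?_⟩
  · intro Z hZ hSZ
    exact le_sSup ⟨hZ, hSZ hus⟩
  · rintro Z ⟨hZ, hZu⟩
    have : Z ≤ sSup S := le_sSup ⟨hZ.1, hZu⟩
    exact le_antisymm this (hZ.2 hstr this)

lemma card_sigma_unique {α β : Type} [Finite α] [Finite β] (R : α → β → Prop)
    (h : ∀ a, ∃! b, R a b) : Nat.card α = Nat.card (Σ b : β, {a : α // R a b}) := by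
  symm
  refine Nat.card_eq_of_bijective (fun p => p.2.1) ⟨?_, ?_⟩
  · rintro ⟨b, a, hab⟩ ⟨b', a', hab'⟩ h'
    simp only at h'
    subst h'
    have := (h a).unique hab hab'
    subst this
    rfl
  · intro a
    obtain ⟨b, hb, _⟩ := h a
    exact ⟨⟨b, a, hb⟩, rfl⟩

lemma bad_card {X : Submodule F V} {T : V →ₗ[F] V} {v : V} {l : V →ₗ[F] F}
    (hl : X ≤ LinearMap.ker l) (hlv : l v = 1) (hs : PSimple X T) :
    Nat.card {w : V // ¬ PSimple (X ⊔ Submodule.span F {v}) (modT T l w)} =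
      Fintype.card F * Nat.card X := by
  have : Finite V := Module.finite_of_finite F
  have e1 := card_sigma_unique
    (α := {w : V // ¬ PSimple (X ⊔ Submodule.span F {v}) (modT T l w)})
    (β := {Y : Submodule F V // Maximal (IsStr X T v) Y})
    (fun w Y => Y.1 ≤ Y.1.comap (modT T l w.1)) (by
      rintro ⟨w, hw⟩
      obtain ⟨Y, ⟨h1, h2⟩, h3⟩ := bad_unique hl hlv hs w hw
      exact ⟨⟨Y, h1⟩, h2, fun Z hZ => Subtype.ext (h3 Z.1 ⟨Z.2, hZ⟩)⟩)
  have e2 := card_sigma_unique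
    (α := X)
    (β := {Y : Submodule F V // Maximal (IsStr X T v) Y})
    (fun x Y => v + (x : V) ∈ Y.1) (by
      intro x
      obtain ⟨Y, ⟨h1, h2⟩, h3⟩ := str_unique (T := T) hl hlv x
      exact ⟨⟨Y, h1⟩, h2, fun Z hZ => Subtype.ext (h3 Z.1 ⟨Z.2, hZ⟩)⟩)
  have := Fintype.ofFinite {Y : Submodule F V // Maximal (IsStr X T v) Y}
  rw [e1, e2, Nat.card_sigma, Nat.card_sigma, Finset.mul_sum]
  refine Finset.sum_congr rfl fun Y _ => ?_
  rw [← IsStr.card_eq hl hlv Y.2.1]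
  refine Nat.card_congr ⟨fun a => ⟨a.1.1, a.2⟩, fun w => ⟨⟨w.1, ?_⟩, w.2⟩, fun _ => rfl, fun _ => rfl⟩
  intro hp
  have h0 := hp Y.1 Y.2.1.1 w.2
  obtain ⟨u, hu, huX⟩ := Y.2.1.2.1
  rw [h0, Submodule.mem_bot] at hu
  subst hu
  have : l (0 - v) = 0 := hl huX
  simp [hlv] at this

end PartA
section PartB
variable {F V : Type} [Field F] [Fintype F] [AddCommGroup V] [Module F V] [FiniteDimensional F V]

/-- Number of automorphisms intertwining `T` on `X` with `D`. -/
noncomputable def ECnt (D : V →ₗ[F] V) (X : Submodule F V) (T : V →ₗ[F] V) : ℕ :=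
  Nat.card {φ : V ≃ₗ[F] V // ∀ x ∈ X, φ (T x) = D (φ x)}

/-- `D` has no nontrivial invariant subspace. -/
def Irr (D : V →ₗ[F] V) : Prop := ∀ Y : Submodule F V, Y ≤ Y.comap D → Y = ⊥ ∨ Y = ⊤

lemma krylov_indep (T : V →ₗ[F] V) (p : V) (hp : p ≠ 0) (N : ℕ)
    (h : ∀ r, 0 < r → r < N → ∀ Y : Submodule F V, Y = Submodule.span F (Set.range fun i : Fin r => (T ^ (i : ℕ)) p) →
      ¬ Y ≤ Y.comap T) :
    LinearIndependent F (fun i : Fin N => (T ^ (i : ℕ)) p) := by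
  induction N with
  | zero => exact linearIndependent_empty_type
  | succ N ih =>
    rw [linearIndependent_finSucc']
    refine ⟨ih fun r h0 hr => h r h0 (by omega), ?_⟩
    intro hmem
    rcases Nat.eq_zero_or_pos N with h0 | h0
    · subst h0
      simp at hmem
      exact hp hmem
    · refine h N h0 (by omega) _ rfl ?_
      rw [Submodule.span_le]
      rintro _ ⟨i, rfl⟩
      rw [SetLike.mem_coe, Submodule.mem_comap, ← Module.End.mul_apply, ← pow_succ']
      rcases Nat.lt_or_ge (i + 1) N with h1 | h1
      · exact Submodule.subset_span ⟨⟨i + 1, h1⟩, rfl⟩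
      · have : (i : ℕ) + 1 = N := by omega
        rw [this]
        exact hmem

lemma krylov_D {D : V →ₗ[F] V} (hD : Irr D) {k : V} (hk : k ≠ 0) :
    LinearIndependent F (fun i : Fin (finrank F V) => (D ^ (i : ℕ)) k) := by
  apply krylov_indep D k hk
  rintro r h0 hr Y rfl hY
  rcases hD _ hY with h | h
  · have : k ∈ Submodule.span F (Set.range fun i : Fin r => (D ^ (i : ℕ)) k) :=
      Submodule.subset_span ⟨⟨0, h0⟩, by simp⟩
    rw [h] at this
    exact hk (by simpa using this)
  · have h1 := finrank_range_le_card (R := F) (fun i : Fin r => (D ^ (i : ℕ)) k)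
    rw [Set.finrank, h, finrank_top, Fintype.card_fin] at h1
    omega

lemma krylov_X {T : V →ₗ[F] V} {X : Submodule F V} (hs : PSimple X T) {p : V} (hp : p ≠ 0) (N : ℕ)
    (hX : ∀ i, i + 1 < N → (T ^ i) p ∈ X) :
    LinearIndependent F (fun i : Fin N => (T ^ (i : ℕ)) p) := by
  apply krylov_indep T p hp
  rintro r h0 hr Y rfl hY
  have h := hs _ (by
    rw [Submodule.span_le]
    rintro _ ⟨i, rfl⟩
    exact hX i (by omega)) hY
  have : p ∈ Submodule.span F (Set.range fun i : Fin r => (T ^ (i : ℕ)) p) :=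
    Submodule.subset_span ⟨⟨0, h0⟩, by simp⟩
  rw [h] at this
  exact hp (by simpa using this)

lemma exists_p (T : V →ₗ[F] V) (X : Submodule F V) (hX : finrank F X + 1 = finrank F V) :
    ∃ p : V, p ≠ 0 ∧ ∀ i, i + 1 < finrank F V → (T ^ i) p ∈ X := by
  have hlt : finrank F (Fin (finrank F X) → (V ⧸ X)) < finrank F V := by
    rw [Module.finrank_pi_fintype]
    have := X.finrank_quotient_add_finrank
    have h1 : finrank F (V ⧸ X) = 1 := by omega
    simp [h1]
    omega
  have := LinearMap.ker_ne_bot_of_finrank_lt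
    (f := LinearMap.pi fun i : Fin (finrank F X) => X.mkQ ∘ₗ (T ^ (i : ℕ))) hlt
  obtain ⟨p, hp, hp0⟩ := Submodule.exists_mem_ne_zero_of_ne_bot this
  refine ⟨p, hp0, fun i hi => ?_⟩
  have h2 := congrFun (LinearMap.mem_ker.1 hp) ⟨i, by omega⟩
  simpa using h2

lemma ECnt_one {D : V →ₗ[F] V} (hD : Irr D) (X : Submodule F V) (T : V →ₗ[F] V)
    (hs : PSimple X T) (hX : finrank F X + 1 = finrank F V) :
    ECnt D X T = Fintype.card F ^ finrank F V - 1 := by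
  have hfin : Finite V := Module.finite_of_finite F
  obtain ⟨p, hp, hpX⟩ := exists_p T X hX
  have hli := krylov_X hs hp (finrank F V) hpX
  have : Nonempty (Fin (finrank F V)) := ⟨⟨0, by omega⟩⟩
  let b := basisOfLinearIndependentOfCardEqFinrank hli (by simp)
  have hb : ∀ i, b i = (T ^ (i : ℕ)) p := fun i => by simp [b]
  have hpow : ∀ φ : V ≃ₗ[F] V, (∀ x ∈ X, φ (T x) = D (φ x)) → ∀ i, i < finrank F V →
      φ ((T ^ i) p) = (D ^ i) (φ p) := by
    intro φ hφ i
    induction i with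
    | zero => intro _; simp
    | succ i ih =>
      intro hi
      rw [pow_succ', pow_succ', Module.End.mul_apply, Module.End.mul_apply,
        hφ _ (hpX i hi), ih (by omega)]
  have hcard : Nat.card {k : V // k ≠ 0} = Fintype.card F ^ finrank F V - 1 := by
    have := Fintype.ofFinite V
    rw [Nat.card_eq_fintype_card, Fintype.card_subtype_compl, ← Nat.card_eq_fintype_card,
      Module.natCard_eq_pow_finrank (K := F)]
    simp
  rw [← hcard, ECnt]
  refine Nat.card_eq_of_bijective (fun φ => ⟨φ.1 p, ?_⟩) ⟨?_, ?_⟩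
  · simpa using hp
  · rintro ⟨φ, hφ⟩ ⟨ψ, hψ⟩ h
    have h := congrArg Subtype.val h
    simp only at h
    apply Subtype.ext
    apply LinearEquiv.toLinearMap_injective
    refine b.ext fun i => ?_
    rw [hb]
    simp only [LinearEquiv.coe_coe]
    rw [hpow φ hφ _ i.2, hpow ψ hψ _ i.2, h]
  · rintro ⟨k, hk⟩
    let c := basisOfLinearIndependentOfCardEqFinrank (krylov_D hD hk) (by simp)
    have hc : ∀ i, c i = (D ^ (i : ℕ)) k := fun i => by simp [c]
    let φ := b.equiv c (Equiv.refl _)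
    have hφ : ∀ i, i < finrank F V → φ ((T ^ i) p) = (D ^ i) k := by
      intro i hi
      have := b.equiv_apply ⟨i, hi⟩ c (Equiv.refl _)
      rw [hb, Equiv.refl_apply, hc] at this
      exact this
    refine ⟨⟨φ, ?_⟩, ?_⟩
    · have hspan : Submodule.span F (Set.range fun i : Fin (finrank F X) => (T ^ (i : ℕ)) p) = X := by
        apply Submodule.eq_of_le_of_finrank_eq
        · rw [Submodule.span_le]
          rintro _ ⟨i, rfl⟩
          exact hpX i (by omega)
        · rw [finrank_span_eq_card]
          · simp
          · exact krylov_X hs hp (finrank F X) fun i hi => hpX i (by omega)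
      have hle : X ≤ LinearMap.ker ((φ : V →ₗ[F] V) ∘ₗ T - D ∘ₗ (φ : V →ₗ[F] V)) := by
        conv_lhs => rw [← hspan]
        rw [Submodule.span_le]
        rintro _ ⟨i, rfl⟩
        simp only [SetLike.mem_coe, LinearMap.mem_ker, LinearMap.sub_apply, LinearMap.comp_apply,
          LinearEquiv.coe_coe]
        rw [← Module.End.mul_apply, ← pow_succ', hφ _ (by omega), hφ _ (by omega),
          pow_succ', Module.End.mul_apply, sub_self]
      intro x hx
      have := hle hx
      simpa [sub_eq_zero] using this
    · apply Subtype.ext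
      simpa using hφ 0 (by omega)

lemma ECnt_rec {D : V →ₗ[F] V} (hD : Irr D) (X : Submodule F V) (T : V →ₗ[F] V)
    (hs : PSimple X T) (m : ℕ) (hX : finrank F X + (m + 2) = finrank F V) (c : ℕ)
    (hc : ∀ (X' : Submodule F V) (T' : V →ₗ[F] V), PSimple X' T' →
      finrank F X' + (m + 1) = finrank F V → ECnt D X' T' = c) :
    ECnt D X T = (Fintype.card F ^ finrank F V - Fintype.card F ^ (finrank F X + 1)) * c := by
  have hfin : Finite V := Module.finite_of_finite F
  have hfinE : Finite (V ≃ₗ[F] V) := DFunLike.finite _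
  have hne : X ≠ ⊤ := by
    rintro rfl
    rw [finrank_top] at hX
    omega
  obtain ⟨v, -, hv⟩ := SetLike.exists_of_lt (lt_top_iff_ne_top.2 hne)
  obtain ⟨l0, hl0, hlX0⟩ := Submodule.exists_le_ker_of_notMem hv
  obtain ⟨l, hlv, hl⟩ : ∃ l : V →ₗ[F] F, l v = 1 ∧ X ≤ LinearMap.ker l := by
    refine ⟨(l0 v)⁻¹ • l0, by simp [hl0], fun x hx => ?_⟩
    have : l0 x = 0 := hlX0 hx
    simp [this]
  set X' := X ⊔ Submodule.span F {v} with hX'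
  have hfr : finrank F X' = finrank F X + 1 := by
    have hd : X ⊓ Submodule.span F {v} = ⊥ := by
      rw [eq_bot_iff]
      rintro x ⟨hx, hxv⟩
      obtain ⟨a, rfl⟩ := Submodule.mem_span_singleton.1 hxv
      have : l (a • v) = 0 := hl hx
      rw [map_smul, hlv, smul_eq_mul, mul_one] at this
      simp [this]
    have h1 := Submodule.finrank_sup_add_finrank_inf_eq X (Submodule.span F {v})
    rw [hd, finrank_bot, finrank_span_singleton (by rintro rfl; exact hv X.zero_mem)] at h1
    omega
  have hfib := card_sigma_unique (α := {φ : V ≃ₗ[F] V // ∀ x ∈ X, φ (T x) = D (φ x)}) (β := V)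
    (fun φ w => φ.1 (T v + w) = D (φ.1 v)) (by
      rintro ⟨φ, hφ⟩
      refine ⟨φ.symm (D (φ v)) - T v, by simp, ?_⟩
      intro w hw
      simp only at hw
      rw [← hw]
      simp)
  have := Fintype.ofFinite V
  rw [ECnt, hfib, Nat.card_sigma]
  have hterm : ∀ w : V, Nat.card {φ : {φ : V ≃ₗ[F] V // ∀ x ∈ X, φ (T x) = D (φ x)} //
      φ.1 (T v + w) = D (φ.1 v)} = if PSimple X' (modT T l w) then c else 0 := by
    intro w
    have h1 : Nat.card {φ : {φ : V ≃ₗ[F] V // ∀ x ∈ X, φ (T x) = D (φ x)} //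
      φ.1 (T v + w) = D (φ.1 v)} = ECnt D X' (modT T l w) := by
      refine Nat.card_congr ⟨fun φ => ⟨φ.1.1, ?_⟩, fun φ => ⟨⟨φ.1, ?_⟩, ?_⟩, fun _ => rfl, fun _ => rfl⟩
      · intro x hx
        obtain ⟨y, hy, z, hz, rfl⟩ := Submodule.mem_sup.1 hx
        obtain ⟨a, rfl⟩ := Submodule.mem_span_singleton.1 hz
        have hly : l y = 0 := hl hy
        have e1 : modT T l w (y + a • v) = T y + a • (T v + w) := by
          simp [modT_apply, hly, hlv, smul_add, add_assoc]
        rw [e1, map_add, map_smul, φ.1.2 y hy, φ.2]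
        simp
      · intro x hx
        have hlx : l x = 0 := hl hx
        have := φ.2 x (Submodule.mem_sup_left hx)
        simpa [modT_apply, hlx] using this
      · have := φ.2 v (Submodule.mem_sup_right (Submodule.mem_span_singleton_self v))
        simpa [modT_apply, hlv] using this
    rw [h1]
    split_ifs with hps
    · exact hc _ _ hps (by omega)
    · rw [ECnt, Nat.card_eq_zero]
      left
      constructor
      rintro ⟨φ, hφ⟩
      apply hps
      intro Y hY hYi
      rcases hD (Y.map (φ : V →ₗ[F] V)) (by
        rw [Submodule.map_le_iff_le_comap]
        intro y hy
        rw [Submodule.mem_comap, Submodule.mem_comap]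
        simp only [LinearEquiv.coe_coe]
        rw [← hφ y (hY hy)]
        exact Submodule.mem_map_of_mem (hYi hy)) with h | h
      · rw [Submodule.map_eq_bot_iff] at h
        simpa using h
      · exfalso
        have h2 := LinearEquiv.finrank_map_eq φ Y
        have h3 : finrank F (Y.map (φ : V →ₗ[F] V)) = finrank F V := by rw [h, finrank_top]
        have h4 := Submodule.finrank_mono hY
        change finrank F (Y.map (φ : V →ₗ[F] V)) = _ at h2
        omega
  rw [Finset.sum_congr rfl fun w _ => hterm w, ← Finset.sum_filter, Finset.sum_const, smul_eq_mul]
  congr 1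
  have hb := bad_card hl hlv hs
  rw [Module.natCard_eq_pow_finrank (K := F) (V := X), Nat.card_eq_fintype_card (α := F), ← pow_succ',
    Nat.card_eq_fintype_card, Fintype.card_subtype] at hb
  have ht := Finset.card_filter_add_card_filter_not (s := (Finset.univ : Finset V))
    (fun w => PSimple X' (modT T l w))
  rw [hb, Finset.card_univ, ← Nat.card_eq_fintype_card (α := V), Module.natCard_eq_pow_finrank (K := F),
    Nat.card_eq_fintype_card] at ht
  omega

/-- The constant. -/
def cConst (q n : ℕ) : ℕ → ℕ
  | 0 => q ^ n - 1
  | m + 1 => (q ^ n - q ^ (n - (m + 1))) * cConst q n m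

lemma ECnt_eq {D : V →ₗ[F] V} (hD : Irr D) (m : ℕ) : ∀ (X : Submodule F V) (T : V →ₗ[F] V),
    PSimple X T → finrank F X + (m + 1) = finrank F V →
    ECnt D X T = cConst (Fintype.card F) (finrank F V) m := by
  induction m with
  | zero => exact fun X T hs hX => ECnt_one hD X T hs hX
  | succ m ih =>
    intro X T hs hX
    rw [ECnt_rec hD X T hs m hX _ ih, cConst]
    congr 3
    omega

end PartB
section PartC
variable {F V : Type} [Field F] [Fintype F] [AddCommGroup V] [Module F V] [FiniteDimensional F V]

/-- `∏_{i<b} (q^a - q^i)`. -/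
def gq (q : ℚ) (a b : ℕ) : ℚ := ∏ i ∈ Finset.range b, (q ^ a - q ^ i)

lemma gq_succ (q : ℚ) (a b : ℕ) : gq q a (b + 1) = gq q a b * (q ^ a - q ^ b) := by
  simp [gq, Finset.prod_range_succ]

lemma gq_succ_succ (q : ℚ) (a b : ℕ) :
    gq q (a + 1) (b + 1) = (q ^ (a + 1) - 1) * q ^ b * gq q a b := by
  simp only [gq]
  rw [Finset.prod_range_succ', pow_zero, mul_comm, mul_assoc]
  congr 1
  have : ∀ i ∈ Finset.range b, q ^ (a + 1) - q ^ (i + 1) = q * (q ^ a - q ^ i) := by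
    intro i _; ring
  rw [Finset.prod_congr rfl this, Finset.prod_mul_distrib]
  simp

lemma gq_add (q : ℚ) (a b c : ℕ) : gq q (a + c) (a + b) = gq q (a + c) a * (q ^ (a * b) * gq q c b) := by
  simp only [gq]
  rw [Finset.prod_range_add]
  congr 1
  have : ∀ i ∈ Finset.range b, q ^ (a + c) - q ^ (a + i) = q ^ a * (q ^ c - q ^ i) := by
    intro i _; ring
  rw [Finset.prod_congr rfl this, Finset.prod_mul_distrib]
  simp [pow_mul]

lemma gq_ne (q : ℚ) (hq : 1 < q) (a b : ℕ) (h : b ≤ a) : gq q a b ≠ 0 := by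
  rw [gq, Finset.prod_ne_zero_iff]
  intro i hi
  have : q ^ i < q ^ a := pow_lt_pow_right₀ hq (by simp at hi; omega)
  linarith

lemma qbp_gq (q : ℚ) (a : ℕ) : ∀ b, aeval q (qbp a b) * gq q b b = gq q a b := by
  induction a with
  | zero =>
    intro b
    cases b with
    | zero => simp [qbp, gq]
    | succ b => simp [qbp, gq, Finset.prod_range_succ']
  | succ a ih =>
    intro b
    cases b with
    | zero => simp [qbp, gq]
    | succ b =>
      have h1 := ih b
      have h2 := ih (b + 1)
      rw [gq_succ_succ q a b, qbp, map_add, map_mul, map_pow, aeval_X, add_mul, mul_assoc, h2,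
        gq_succ q a b, gq_succ_succ]
      linear_combination (q ^ (b + 1) - 1) * q ^ b * h1

lemma card_LI {b : ℕ} (hb : b ≤ finrank F V) :
    (Nat.card {s : Fin b → V // LinearIndependent F s} : ℚ) = gq (Fintype.card F) (finrank F V) b := by
  have : Finite V := Module.finite_of_finite F
  rw [card_linearIndependent hb, gq, Finset.prod_range, Nat.cast_prod]
  refine Finset.prod_congr rfl fun i _ => ?_
  rw [Nat.cast_sub]
  · push_cast; rfl
  · exact Nat.pow_le_pow_right Fintype.card_pos (by omega)

lemma card_grass {b : ℕ} (hb : b ≤ finrank F V) :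
    (Nat.card {Y : Submodule F V // finrank F Y = b} : ℚ) * gq (Fintype.card F) b b =
      gq (Fintype.card F) (finrank F V) b := by
  have : Finite V := Module.finite_of_finite F
  rw [← card_LI hb]
  rw [card_sigma_unique (α := {s : Fin b → V // LinearIndependent F s})
    (β := {Y : Submodule F V // finrank F Y = b})
    (fun s Y => Submodule.span F (Set.range s.1) = Y.1) (by
      rintro ⟨s, hs⟩
      refine ⟨⟨Submodule.span F (Set.range s), ?_⟩, rfl, fun Y hY => Subtype.ext hY.symm⟩
      rw [finrank_span_eq_card hs]; simp)]
  have := Fintype.ofFinite {Y : Submodule F V // finrank F Y = b}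
  rw [Nat.card_sigma, Nat.cast_sum]
  have : ∀ Y : {Y : Submodule F V // finrank F Y = b},
      (Nat.card {s : {s : Fin b → V // LinearIndependent F s} //
        Submodule.span F (Set.range s.1) = Y.1} : ℚ) = gq (Fintype.card F) b b := by
    rintro ⟨Y, hY⟩
    change (Nat.card {s : {s : Fin b → V // LinearIndependent F s} //
        Submodule.span F (Set.range s.1) = Y} : ℚ) = _
    have hmap : ∀ s : Fin b → Y, LinearIndependent F s →
        LinearIndependent F (fun i => (s i : V)) :=
      fun s hs => hs.map' Y.subtype (Submodule.ker_subtype Y)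
    have h1 := card_LI (F := F) (V := Y) (b := b) (by omega)
    rw [hY] at h1
    rw [← h1]
    congr 1
    symm
    refine Nat.card_eq_of_bijective (fun s => ⟨⟨fun i => (s.1 i : V), ?_⟩, ?_⟩) ⟨?_, ?_⟩
    · exact hmap s.1 s.2
    · apply Submodule.eq_of_le_of_finrank_eq
      · rw [Submodule.span_le]
        rintro _ ⟨i, rfl⟩
        exact (s.1 i).2
      · rw [finrank_span_eq_card (hmap s.1 s.2)]
        simp [hY]
    · rintro ⟨s, hs⟩ ⟨t, ht⟩ h
      apply Subtype.ext
      funext i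
      have h2 := congrFun (congrArg Subtype.val (congrArg Subtype.val h)) i
      exact Subtype.ext h2
    · rintro ⟨⟨s, hs⟩, h⟩
      have hm : ∀ i, s i ∈ Y := fun i => by
        rw [← h]; exact Submodule.subset_span ⟨i, rfl⟩
      exact ⟨⟨fun i => ⟨s i, hm i⟩, LinearIndependent.of_comp Y.subtype hs⟩, rfl⟩
  rw [Finset.sum_congr rfl fun Y _ => this Y, Finset.sum_const, nsmul_eq_mul, Finset.card_univ,
    Nat.card_eq_fintype_card (α := {Y : Submodule F V // finrank F Y = b})]

lemma card_grass_le (X : Submodule F V) {b : ℕ} (hb : b ≤ finrank F X) :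
    (Nat.card {Y : Submodule F V // Y ≤ X ∧ finrank F Y = b} : ℚ) * gq (Fintype.card F) b b =
      gq (Fintype.card F) (finrank F X) b := by
  rw [← card_grass hb]
  congr 2
  symm
  refine Nat.card_eq_of_bijective (fun Y => ⟨Y.1.map X.subtype, Submodule.map_subtype_le X Y.1, ?_⟩)
    ⟨?_, ?_⟩
  · exact (Submodule.finrank_map_subtype_eq X Y.1).trans Y.2
  · rintro ⟨Y, hY⟩ ⟨Z, hZ⟩ h
    simp only [Subtype.mk.injEq] at h
    exact Subtype.ext (Submodule.map_injective_of_injective X.injective_subtype h)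
  · rintro ⟨Y, hYX, hY⟩
    have h1 : (Y.comap X.subtype).map X.subtype = Y := by
      rw [Submodule.map_comap_subtype, inf_eq_right.2 hYX]
    refine ⟨⟨Y.comap X.subtype, ?_⟩, Subtype.ext h1⟩
    rw [← Submodule.finrank_map_subtype_eq, h1, hY]

/-- Density of endomorphisms with a property. -/
noncomputable def pr (P : (V →ₗ[F] V) → Prop) : ℚ :=
  (Nat.card {T : V →ₗ[F] V // P T} : ℚ) / Nat.card (V →ₗ[F] V)

lemma finEnd : Finite (V →ₗ[F] V) := by
  have : Finite V := Module.finite_of_finite F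
  exact DFunLike.finite _

lemma card_End_ne : (Nat.card (V →ₗ[F] V) : ℚ) ≠ 0 := by
  have := finEnd (F := F) (V := V)
  exact_mod_cast Nat.card_pos.ne'

lemma pr_indep (P Q : (V →ₗ[F] V) → Prop) (X C : Submodule F V) (hd : Disjoint X C)
    (hP : ∀ T T' : V →ₗ[F] V, (∀ x ∈ X, T x = T' x) → P T → P T')
    (hQ : ∀ T T' : V →ₗ[F] V, (∀ x ∈ C, T x = T' x) → Q T → Q T') :
    pr (fun T => P T ∧ Q T) = pr P * pr Q := by
  have := finEnd (F := F) (V := V)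
  obtain ⟨e, heX, heC, hee⟩ : ∃ e : V →ₗ[F] V,
      (∀ x ∈ X, e x = x) ∧ (∀ x ∈ C, e x = 0) ∧ e ∘ₗ e = e := by
    obtain ⟨C', hC'⟩ := exists_isCompl (X ⊔ C)
    have hd2 : IsCompl X (C ⊔ C') := by
      constructor
      · exact Disjoint.disjoint_sup_right_of_disjoint_sup_left hd hC'.disjoint
      · rw [codisjoint_iff, ← sup_assoc]; exact hC'.sup_eq_top
    have h1 : ∀ x ∈ X, (X.subtype ∘ₗ X.projectionOnto _ hd2) x = x := fun x hx => by
      simpa using congrArg Subtype.val (Submodule.projectionOnto_apply_left hd2 ⟨x, hx⟩)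
    refine ⟨X.subtype ∘ₗ X.projectionOnto _ hd2, h1, fun x hx => ?_, ?_⟩
    · have := (Submodule.projectionOnto_apply_eq_zero_iff hd2 (x := x)).2 (Submodule.mem_sup_left hx)
      simp [this]
    · ext x
      exact h1 _ (Subtype.prop _)
  let mix : (V →ₗ[F] V) → (V →ₗ[F] V) → (V →ₗ[F] V) := fun T S => T ∘ₗ e + (S - S ∘ₗ e)
  have hmixX : ∀ T S : V →ₗ[F] V, ∀ x ∈ X, T x = mix T S x := by
    intro T S x hx
    simp [mix, heX x hx]
  have hmixC : ∀ T S : V →ₗ[F] V, ∀ x ∈ C, S x = mix T S x := by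
    intro T S x hx
    simp [mix, heC x hx]
  have hee' : ∀ x, e (e x) = e x := fun x => LinearMap.congr_fun hee x
  have hmm : ∀ A B : V →ₗ[F] V, mix (mix A B) (mix B A) = A := by
    intro A B
    ext x
    simp [mix, hee']
  have hcard : Nat.card {T : V →ₗ[F] V // P T ∧ Q T} * Nat.card (V →ₗ[F] V) =
      Nat.card {T : V →ₗ[F] V // P T} * Nat.card {T : V →ₗ[F] V // Q T} := by
    rw [← Nat.card_prod, ← Nat.card_prod]
    refine Nat.card_congr ⟨fun p => (⟨mix p.1.1 p.2, ?_⟩, ⟨mix p.2 p.1.1, ?_⟩),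
      fun p => (⟨mix p.1.1 p.2.1, ?_, ?_⟩, mix p.2.1 p.1.1), ?_, ?_⟩
    · exact hP _ _ (hmixX _ _) p.1.2.1
    · exact hQ _ _ (hmixC _ _) p.1.2.2
    · exact hP _ _ (hmixX _ _) p.1.2
    · exact hQ _ _ (hmixC _ _) p.2.2
    · rintro ⟨⟨T, hT⟩, S⟩
      simp only [hmm]
    · rintro ⟨⟨T, hT⟩, ⟨S, hS⟩⟩
      simp only [hmm]
  have hne := card_End_ne (F := F) (V := V)
  unfold pr
  rw [div_mul_div_comm, div_eq_div_iff hne (mul_ne_zero hne hne)]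
  have hcard' : (Nat.card {T : V →ₗ[F] V // P T ∧ Q T} : ℚ) * Nat.card (V →ₗ[F] V) =
      Nat.card {T : V →ₗ[F] V // P T} * Nat.card {T : V →ₗ[F] V // Q T} := by
    exact_mod_cast hcard
  rw [← hcard']
  ring

/-- `T` maps `C` into `U`, injectively modulo `X`. -/
def QC (U X C : Submodule F V) (T : V →ₗ[F] V) : Prop :=
  (∀ x ∈ C, T x ∈ U) ∧ ∀ x ∈ C, T x ∈ X → x = 0

lemma QC.congr {U X C : Submodule F V} {T T' : V →ₗ[F] V} (h : ∀ x ∈ C, T x = T' x)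
    (hT : QC U X C T) : QC U X C T' :=
  ⟨fun x hx => h x hx ▸ hT.1 x hx, fun x hx hx' => hT.2 x hx (by rwa [h x hx])⟩

lemma QC_split {U X C : Submodule F V} {l : V →ₗ[F] F} {v : V} (hv : v ∈ C) (hlv : l v = 1)
    (T : V →ₗ[F] V) : QC U X C T ↔ QC U X (C ⊓ LinearMap.ker l) T ∧ T v ∈ U ∧
      T v ∉ X ⊔ (C ⊓ LinearMap.ker l).map T := by
  constructor
  · intro h
    refine ⟨⟨fun x hx => h.1 x hx.1, fun x hx => h.2 x hx.1⟩, h.1 v hv, fun hm => ?_⟩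
    obtain ⟨x, hx, z, hz, hxz⟩ := Submodule.mem_sup.1 hm
    obtain ⟨c, hc, rfl⟩ := Submodule.mem_map.1 hz
    have h1 : v - c = 0 := h.2 _ (C.sub_mem hv hc.1) (by
      rw [map_sub, ← hxz]; simpa using hx)
    have h2 : l c = 0 := hc.2
    rw [sub_eq_zero] at h1
    rw [← h1, hlv] at h2
    exact one_ne_zero h2
  · rintro ⟨h1, h2, h3⟩
    have hdec : ∀ y ∈ C, y - l y • v ∈ C ⊓ LinearMap.ker l := by
      intro y hy
      refine ⟨C.sub_mem hy (C.smul_mem _ hv), ?_⟩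
      simp [hlv]
    have hT : ∀ y, T y = T (y - l y • v) + l y • T v := by
      intro y; simp
    refine ⟨fun y hy => ?_, fun y hy hyX => ?_⟩
    · rw [hT]
      exact U.add_mem (h1.1 _ (hdec y hy)) (U.smul_mem _ h2)
    · by_cases hl : l y = 0
      · have := hdec y hy
        simp only [hl, zero_smul, sub_zero] at this
        exact h1.2 y this hyX
      · exfalso
        apply h3
        have e : T v = (l y)⁻¹ • T y + (l y)⁻¹ • (-T (y - l y • v)) := by
          rw [map_sub, map_smul, neg_sub, smul_sub, inv_smul_smul₀ hl]; abel
        rw [e]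
        exact Submodule.add_mem_sup (X.smul_mem _ hyX)
          (Submodule.smul_mem _ _ (Submodule.neg_mem _ (Submodule.mem_map_of_mem (hdec y hy))))

lemma card_diff {U Z : Submodule F V} (h : Z ≤ U) :
    (Nat.card {w : V // w ∈ U ∧ w ∉ Z} : ℚ) =
      (Fintype.card F : ℚ) ^ finrank F U - (Fintype.card F : ℚ) ^ finrank F Z := by
  have : Finite V := Module.finite_of_finite F
  have h1 : Nat.card U = Nat.card {w : V // w ∈ U ∧ w ∉ Z} + Nat.card Z := by
    rw [← Nat.card_sum]
    refine Nat.card_congr ⟨fun u => if hu : (u : V) ∈ Z then Sum.inr ⟨u, hu⟩ else Sum.inl ⟨u, u.2, hu⟩,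
      fun s => s.elim (fun w => ⟨w.1, w.2.1⟩) (fun z => ⟨z.1, h z.2⟩), ?_, ?_⟩
    · intro u
      by_cases hu : (u : V) ∈ Z <;> simp [hu]
    · rintro (w | z)
      · simp [w.2.2]
      · simp
  rw [Module.natCard_eq_pow_finrank (K := F) (V := U), Module.natCard_eq_pow_finrank (K := F) (V := Z),
    Nat.card_eq_fintype_card] at h1
  have h2 : ((Fintype.card F ^ finrank F U : ℕ) : ℚ) = _ := congrArg Nat.cast h1
  push_cast at h2
  linarith

lemma QC_finrank {U X C : Submodule F V} (hXU : X ≤ U) {T : V →ₗ[F] V} (h : QC U X C T) :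
    X ⊔ C.map T ≤ U ∧ finrank F ↥(X ⊔ C.map T) = finrank F X + finrank F C := by
  constructor
  · refine sup_le hXU ?_
    rw [Submodule.map_le_iff_le_comap]
    exact h.1
  · have hinf : X ⊓ C.map T = ⊥ := by
      rw [eq_bot_iff]
      rintro _ ⟨hx, ⟨c, hc, rfl⟩⟩
      have := h.2 c hc hx
      simp [this]
    have h1 := Submodule.finrank_sup_add_finrank_inf_eq X (C.map T)
    rw [hinf, finrank_bot] at h1
    have h2 : finrank F (C.map T) = finrank F C := by
      have hinj : Function.Injective (T.domRestrict C) := by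
        rw [← LinearMap.ker_eq_bot, eq_bot_iff]
        intro c hc
        have : T c = 0 := hc
        have := h.2 c c.2 (by rw [this]; exact X.zero_mem)
        exact Subtype.ext this
      rw [← LinearMap.range_domRestrict, LinearMap.finrank_range_of_inj hinj]
    omega

lemma pr_QC (U X : Submodule F V) (hXU : X ≤ U) (c : ℕ) : ∀ C : Submodule F V, finrank F C = c →
    pr (QC U X C) * (Fintype.card F : ℚ) ^ (finrank F V * c) =
      ∏ i ∈ Finset.range c,
        ((Fintype.card F : ℚ) ^ finrank F U - (Fintype.card F : ℚ) ^ (finrank F X + i)) := by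
  have := finEnd (F := F) (V := V)
  have hfV : Finite V := Module.finite_of_finite F
  have hne := card_End_ne (F := F) (V := V)
  induction c with
  | zero =>
    intro C hC
    have hC0 : C = ⊥ := Submodule.finrank_eq_zero.1 hC
    subst hC0
    have hall : ∀ T : V →ₗ[F] V, QC U X ⊥ T := by
      intro T
      constructor
      · intro x hx
        rw [Submodule.mem_bot] at hx
        simp [hx]
      · intro x hx _
        simpa using hx
    have hcard : Nat.card {T : V →ₗ[F] V // QC U X ⊥ T} = Nat.card (V →ₗ[F] V) :=
      Nat.card_congr (Equiv.subtypeUnivEquiv hall)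
    rw [pr, hcard, div_self hne]
    simp
  | succ c ih =>
    intro C hC
    have hCne : C ≠ ⊥ := by
      rintro rfl
      simp at hC
    obtain ⟨v, hv, hv0⟩ := Submodule.exists_mem_ne_zero_of_ne_bot hCne
    obtain ⟨l0, hl0, -⟩ := Submodule.exists_le_ker_of_notMem (p := (⊥ : Submodule F V)) (v := v) (by simpa using hv0)
    obtain ⟨l, hlv⟩ : ∃ l : V →ₗ[F] F, l v = 1 := ⟨(l0 v)⁻¹ • l0, by simp [hl0]⟩
    set C0 := C ⊓ LinearMap.ker l with hC0
    have hC0r : finrank F C0 = c := by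
      have hsup : C0 ⊔ Submodule.span F {v} = C := by
        apply le_antisymm
        · refine sup_le inf_le_left ?_
          rwa [Submodule.span_singleton_le_iff_mem]
        · intro y hy
          have : y = (y - l y • v) + l y • v := by abel
          rw [this]
          refine Submodule.add_mem_sup ⟨C.sub_mem hy (C.smul_mem _ hv), ?_⟩
            (Submodule.smul_mem _ _ (Submodule.mem_span_singleton_self v))
          simp [hlv]
      have hinf : C0 ⊓ Submodule.span F {v} = ⊥ := by
        rw [eq_bot_iff]
        rintro x ⟨hx, hxv⟩
        obtain ⟨a, rfl⟩ := Submodule.mem_span_singleton.1 hxv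
        have : l (a • v) = 0 := hx.2
        rw [map_smul, hlv, smul_eq_mul, mul_one] at this
        simp [this]
      have h1 := Submodule.finrank_sup_add_finrank_inf_eq C0 (Submodule.span F {v})
      rw [hsup, hinf, finrank_bot, finrank_span_singleton hv0] at h1
      omega
    have hsp := fun T => QC_split (U := U) (X := X) hv hlv T
    rw [← hC0] at hsp
    -- replacing the value at `v`
    let rep : (V →ₗ[F] V) → V → (V →ₗ[F] V) := fun T w => modT T l (w - T v)
    have repv : ∀ T w, rep T w v = w := by
      intro T w; simp [rep, modT_apply, hlv]
    have repC : ∀ T w, ∀ x ∈ C0, T x = rep T w x := by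
      intro T w x hx
      have : l x = 0 := hx.2
      simp [rep, modT_apply, this]
    have reprep : ∀ T w, rep (rep T w) (T v) = T := by
      intro T w
      ext x
      simp only [rep, modT_apply, hlv, one_smul]
      rw [add_assoc, ← smul_add]
      simp
    have hmapeq : ∀ T w, C0.map (rep T w) = C0.map T := by
      intro T w
      apply le_antisymm
      · rintro _ ⟨x, hx, rfl⟩
        rw [← repC T w x hx]
        exact Submodule.mem_map_of_mem hx
      · rintro _ ⟨x, hx, rfl⟩
        rw [repC T w x hx]
        exact Submodule.mem_map_of_mem hx
    have hext : ∀ a b : (Σ T : {T : V →ₗ[F] V // QC U X C0 T},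
        {w : V // w ∈ U ∧ w ∉ X ⊔ C0.map T.1}), a.1.1 = b.1.1 → a.2.1 = b.2.1 → a = b := by
      rintro ⟨⟨T, hT⟩, ⟨w, hw⟩⟩ ⟨⟨T', hT'⟩, ⟨w', hw'⟩⟩ h1 h2
      simp only at h1 h2
      subst h1 h2
      rfl
    have hcard : Nat.card {T : V →ₗ[F] V // QC U X C T} * Nat.card V =
        Nat.card (Σ T : {T : V →ₗ[F] V // QC U X C0 T}, {w : V // w ∈ U ∧ w ∉ X ⊔ C0.map T.1}) := by
      rw [← Nat.card_prod]
      refine Nat.card_eq_of_bijective (fun p => ⟨⟨rep p.1.1 p.2, ?_⟩, ⟨p.1.1 v, ?_⟩⟩) ⟨?_, ?_⟩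
      · exact ((hsp _).1 p.1.2).1.congr (repC _ _)
      · simp only [hmapeq]
        exact ((hsp _).1 p.1.2).2
      · rintro ⟨⟨T, hT⟩, w⟩ ⟨⟨T', hT'⟩, w'⟩ h
        have h1 : rep T w = rep T' w' := congrArg (fun s => s.1.1) h
        have h2 : T v = T' v := congrArg (fun s => s.2.1) h
        have h3 : w = w' := by rw [← repv T w, h1, repv]
        have h4 : T = T' := by rw [← reprep T w, h1, h2, reprep]
        subst h3 h4
        rfl
      · rintro ⟨⟨T, hT⟩, ⟨w, hw⟩⟩
        refine ⟨(⟨rep T w, ?_⟩, T v), ?_⟩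
        · rw [hsp]
          refine ⟨hT.congr (repC _ _), ?_⟩
          rw [repv, hmapeq]
          exact hw
        · exact hext _ _ (reprep T w) (repv T w)
    have := Fintype.ofFinite {T : V →ₗ[F] V // QC U X C0 T}
    rw [Nat.card_sigma] at hcard
    have hcq : (Nat.card {T : V →ₗ[F] V // QC U X C T} : ℚ) * (Fintype.card F : ℚ) ^ finrank F V =
        Nat.card {T : V →ₗ[F] V // QC U X C0 T} *
        ((Fintype.card F : ℚ) ^ finrank F U - (Fintype.card F : ℚ) ^ (finrank F X + c)) := by
      have h1 : ((Nat.card {T : V →ₗ[F] V // QC U X C T} * Nat.card V : ℕ) : ℚ) = _ :=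
        congrArg Nat.cast hcard
      rw [Nat.cast_mul, Module.natCard_eq_pow_finrank (K := F) (V := V), Nat.card_eq_fintype_card (α := F),
        Nat.cast_pow, Nat.cast_sum] at h1
      rw [h1]
      have h2 : ∀ T : {T : V →ₗ[F] V // QC U X C0 T},
          (Nat.card {w : V // w ∈ U ∧ w ∉ X ⊔ C0.map T.1} : ℚ) =
          (Fintype.card F : ℚ) ^ finrank F U - (Fintype.card F : ℚ) ^ (finrank F X + c) := by
        intro T
        obtain ⟨h3, h4⟩ := QC_finrank hXU T.2
        rw [card_diff h3, h4, hC0r]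
      rw [Finset.sum_congr rfl fun T _ => h2 T, Finset.sum_const, nsmul_eq_mul, Finset.card_univ,
        ← Nat.card_eq_fintype_card]
    rw [Finset.prod_range_succ, ← ih C0 hC0r, pr, pr, Nat.mul_succ, pow_add]
    field_simp
    rw [hcq]

end PartC
section PartD
variable {F V : Type} [Field F] [Fintype F] [AddCommGroup V] [Module F V] [FiniteDimensional F V]

/-- The chain of iterated partial preimages. -/
def ch (T : V →ₗ[F] V) : Submodule F V → ℕ → Submodule F V
  | X, 0 => X
  | X, j + 1 => ch T (X ⊓ X.comap T) j

lemma ch_le (T : V →ₗ[F] V) (j : ℕ) : ∀ X, ch T X j ≤ X := by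
  induction j with
  | zero => intro X; exact le_rfl
  | succ j ih => intro X; exact (ih _).trans inf_le_left

lemma ch_congr {T T' : V →ₗ[F] V} (j : ℕ) : ∀ X : Submodule F V, (∀ x ∈ X, T x = T' x) →
    ch T X j = ch T' X j := by
  induction j with
  | zero => intro X _; rfl
  | succ j ih =>
    intro X h
    have h1 : X ⊓ X.comap T = X ⊓ X.comap T' := by
      ext x
      simp only [Submodule.mem_inf, Submodule.mem_comap]
      constructor
      · rintro ⟨hx, hx'⟩; exact ⟨hx, by rwa [← h x hx]⟩
      · rintro ⟨hx, hx'⟩; exact ⟨hx, by rwa [h x hx]⟩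
    change ch T (X ⊓ X.comap T) j = ch T' (X ⊓ X.comap T') j
    rw [← h1]
    exact ih _ fun x hx => h x hx.1

lemma le_ch (T : V →ₗ[F] V) {Y : Submodule F V} (hY : Y ≤ Y.comap T) (j : ℕ) :
    ∀ X, Y ≤ X → Y ≤ ch T X j := by
  induction j with
  | zero => intro X h; exact h
  | succ j ih => intro X h; exact ih _ (le_inf h (hY.trans (Submodule.comap_mono h)))

lemma PSimple_of_ch {T : V →ₗ[F] V} {X : Submodule F V} {k : ℕ} (h : ch T X k = ⊥) :
    PSimple X T := by
  intro Y hYX hY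
  rw [eq_bot_iff, ← h]
  exact le_ch T hY k X hYX

lemma mem_ch (T : V →ₗ[F] V) (j : ℕ) : ∀ (X : Submodule F V) (x : V),
    x ∈ ch T X j ↔ ∀ i ≤ j, (T ^ i) x ∈ X := by
  induction j with
  | zero => intro X x; simp [ch]
  | succ j ih =>
    intro X x
    rw [ch, ih]
    constructor
    · intro h i hi
      rcases Nat.lt_or_ge j i with h' | h'
      · obtain rfl : i = j + 1 := by omega
        rw [pow_succ', Module.End.mul_apply]
        exact (h j le_rfl).2
      · exact (h i h').1
    · intro h i hi
      refine ⟨h i (by omega), ?_⟩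
      have := h (i + 1) (by omega)
      rwa [pow_succ', Module.End.mul_apply] at this

/-- `T` maps `X` into `U` and the chain has dimensions `d`. -/
def PF (U X : Submodule F V) (d : ℕ → ℕ) (k : ℕ) (T : V →ₗ[F] V) : Prop :=
  (∀ x ∈ X, T x ∈ U) ∧ ∀ j ≤ k, finrank F (ch T X j) = d j

lemma PF.congr {U X : Submodule F V} {d : ℕ → ℕ} {k : ℕ} {T T' : V →ₗ[F] V}
    (h : ∀ x ∈ X, T x = T' x) (hT : PF U X d k T) : PF U X d k T' :=
  ⟨fun x hx => h x hx ▸ hT.1 x hx, fun j hj => by rw [← ch_congr j X h]; exact hT.2 j hj⟩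

lemma PF_step {U X X1 C : Submodule F V} {d : ℕ → ℕ} {k : ℕ} (hXU : X ≤ U)
    (hX : finrank F X = d 0) (hsup : X1 ⊔ C = X) (hdis : Disjoint X1 C) (T : V →ₗ[F] V) :
    (PF U X d (k + 1) T ∧ X ⊓ X.comap T = X1) ↔
      (PF X X1 (fun i => d (i + 1)) k T ∧ QC U X C T) := by
  have hCX : C ≤ X := hsup ▸ le_sup_right
  have hX1X : X1 ≤ X := hsup ▸ le_sup_left
  constructor
  · rintro ⟨⟨h1, h2⟩, h3⟩
    refine ⟨⟨fun x hx => ?_, fun j hj => ?_⟩, fun x hx => h1 x (hCX hx), fun x hx hTx => ?_⟩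
    · rw [← h3] at hx; exact hx.2
    · change finrank F (ch T X1 j) = d (j + 1)
      rw [← h2 (j + 1) (by omega), ← h3]; rfl
    · have : x ∈ X1 := by rw [← h3]; exact ⟨hCX hx, hTx⟩
      exact (Submodule.disjoint_def.1 hdis) x this hx
  · rintro ⟨⟨h1, h2⟩, h3, h4⟩
    have h5 : X ⊓ X.comap T = X1 := by
      apply le_antisymm
      · rintro x ⟨hx, hTx⟩
        rw [← hsup] at hx
        obtain ⟨y, hy, c, hc, rfl⟩ := Submodule.mem_sup.1 hx
        have : T c ∈ X := by
          have := X.sub_mem hTx (h1 y hy)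
          simpa using this
        rw [h4 c hc this, add_zero]
        exact hy
      · exact le_inf hX1X h1
    refine ⟨⟨fun x hx => ?_, fun j hj => ?_⟩, h5⟩
    · rw [← hsup] at hx
      obtain ⟨y, hy, c, hc, rfl⟩ := Submodule.mem_sup.1 hx
      rw [map_add]
      exact U.add_mem (hXU (h1 y hy)) (h3 c hc)
    · cases j with
      | zero => exact hX
      | succ j =>
        rw [ch, h5]
        exact h2 j (by omega)

lemma pr_PF (k : ℕ) : ∀ (U X : Submodule F V) (d μ : ℕ → ℕ), X ≤ U → finrank F X = d 0 →
    finrank F U = d 0 + μ 0 → (∀ j, d j = d (j + 1) + μ (j + 1)) → d k = 0 →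
    pr (PF U X d k) * (Fintype.card F : ℚ) ^ (finrank F V * d 0) =
      gq (Fintype.card F) (d 0) (d 0) * ∏ j ∈ Finset.range k,
        (aeval (Fintype.card F : ℚ) (qbp (μ j) (μ (j + 1))) *
          (Fintype.card F : ℚ) ^ (μ (j + 1) ^ 2)) := by
  have hfE := finEnd (F := F) (V := V)
  have hfV : Finite V := Module.finite_of_finite F
  have hne := card_End_ne (F := F) (V := V)
  have hq1 : (1 : ℚ) < Fintype.card F := by exact_mod_cast Fintype.one_lt_card
  have hq0 : (Fintype.card F : ℚ) ≠ 0 := by positivity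
  induction k with
  | zero =>
    intro U X d μ hXU hX hU hd hk
    rw [hk] at hX
    have hX0 : X = ⊥ := Submodule.finrank_eq_zero.1 hX
    subst hX0
    have hall : ∀ T : V →ₗ[F] V, PF U ⊥ d 0 T := by
      intro T
      constructor
      · intro x hx
        rw [Submodule.mem_bot] at hx
        simp [hx]
      · intro j hj
        obtain rfl : j = 0 := by omega
        exact hX.trans hk.symm
    have hcard : Nat.card {T : V →ₗ[F] V // PF U ⊥ d 0 T} = Nat.card (V →ₗ[F] V) :=
      Nat.card_congr (Equiv.subtypeUnivEquiv hall)
    rw [pr, hcard, div_self hne, hk]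
    simp [gq]
  | succ k ih =>
    intro U X d μ hXU hX hU hd hk
    have hd0 := hd 0
    simp only [zero_add] at hd0
    have := Fintype.ofFinite {Y : Submodule F V // Y ≤ X ∧ finrank F Y = d 1}
    -- split over the first step
    have hsplit : Nat.card {T : V →ₗ[F] V // PF U X d (k + 1) T} =
        ∑ Y : {Y : Submodule F V // Y ≤ X ∧ finrank F Y = d 1},
          Nat.card {T : {T : V →ₗ[F] V // PF U X d (k + 1) T} // X ⊓ X.comap T.1 = Y.1} := by
      rw [card_sigma_unique (α := {T : V →ₗ[F] V // PF U X d (k + 1) T})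
        (β := {Y : Submodule F V // Y ≤ X ∧ finrank F Y = d 1})
        (fun T Y => X ⊓ X.comap T.1 = Y.1), Nat.card_sigma]
      rintro ⟨T, hT⟩
      exact ⟨⟨X ⊓ X.comap T, inf_le_left, hT.2 1 (by omega)⟩, rfl, fun Y hY => Subtype.ext hY.symm⟩
    set R : ℚ := gq (Fintype.card F) (d 1) (d 1) * ∏ j ∈ Finset.range k,
        (aeval (Fintype.card F : ℚ) (qbp (μ (j + 1)) (μ (j + 1 + 1))) *
          (Fintype.card F : ℚ) ^ (μ (j + 1 + 1) ^ 2)) with hR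
    have hterm : ∀ Y : {Y : Submodule F V // Y ≤ X ∧ finrank F Y = d 1},
        (Nat.card {T : {T : V →ₗ[F] V // PF U X d (k + 1) T} // X ⊓ X.comap T.1 = Y.1} : ℚ) =
        Nat.card (V →ₗ[F] V) * (R / (Fintype.card F : ℚ) ^ (finrank F V * d 1) *
          ((Fintype.card F : ℚ) ^ (d 0 * μ 1) * gq (Fintype.card F) (μ 0) (μ 1) /
            (Fintype.card F : ℚ) ^ (finrank F V * μ 1))) := by
      rintro ⟨Y, hYX, hY⟩
      obtain ⟨C, hdis, hsup⟩ : ∃ C : Submodule F V, Disjoint Y C ∧ Y ⊔ C = X := by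
        obtain ⟨C, hC⟩ := exists_isCompl Y
        refine ⟨C ⊓ X, hC.disjoint.mono_right inf_le_left, ?_⟩
        rw [← sup_inf_assoc_of_le C hYX, hC.sup_eq_top, top_inf_eq]
      have hC : finrank F C = μ 1 := by
        have := Submodule.finrank_sup_add_finrank_inf_eq Y C
        rw [hsup, hdis.eq_bot, finrank_bot] at this
        omega
      have e1 : Nat.card {T : {T : V →ₗ[F] V // PF U X d (k + 1) T} // X ⊓ X.comap T.1 = Y} =
          Nat.card {T : V →ₗ[F] V // PF X Y (fun i => d (i + 1)) k T ∧ QC U X C T} :=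
        Nat.card_congr ((Equiv.subtypeSubtypeEquivSubtypeInter _ _).trans
          (Equiv.subtypeEquivRight fun T => PF_step hXU hX hsup hdis T))
      have e2 := pr_indep (PF X Y (fun i => d (i + 1)) k) (QC U X C) Y C hdis
        (fun T T' h hT => hT.congr h) (fun T T' h hT => hT.congr h)
      have e3 := ih X Y (fun i => d (i + 1)) (fun i => μ (i + 1)) hYX hY (by simpa using hX.trans hd0)
        (fun j => hd (j + 1)) hk
      simp only [zero_add] at e3
      rw [← hR] at e3
      have e4 := pr_QC U X hXU (μ 1) C hC
      have e5 : ∏ i ∈ Finset.range (μ 1),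
          ((Fintype.card F : ℚ) ^ finrank F U - (Fintype.card F : ℚ) ^ (finrank F X + i)) =
          (Fintype.card F : ℚ) ^ (d 0 * μ 1) * gq (Fintype.card F) (μ 0) (μ 1) := by
        have : ∀ i ∈ Finset.range (μ 1),
          ((Fintype.card F : ℚ) ^ finrank F U - (Fintype.card F : ℚ) ^ (finrank F X + i)) =
            (Fintype.card F : ℚ) ^ d 0 * ((Fintype.card F : ℚ) ^ μ 0 - (Fintype.card F : ℚ) ^ i) := by
          intro i _
          rw [hU, hX]; ring
        rw [Finset.prod_congr rfl this, Finset.prod_mul_distrib, gq]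
        simp [pow_mul]
      rw [e5] at e4
      rw [← e4, ← e3, mul_div_cancel_right₀ _ (by positivity), mul_div_cancel_right₀ _ (by positivity),
        ← e2, pr, mul_div_cancel₀ _ hne]
      exact_mod_cast e1
    have hcard : (Nat.card {T : V →ₗ[F] V // PF U X d (k + 1) T} : ℚ) = _ := congrArg Nat.cast hsplit
    rw [Nat.cast_sum, Finset.sum_congr rfl fun Y _ => hterm Y, Finset.sum_const, nsmul_eq_mul,
      Finset.card_univ, ← Nat.card_eq_fintype_card] at hcard
    have hg := card_grass_le X (b := d 1) (by omega)
    have hg2 := gq_add (Fintype.card F : ℚ) (d 1) (μ 1) (μ 1)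
    have hg3 := qbp_gq (Fintype.card F : ℚ) (μ 0) (μ 1)
    rw [hX] at hg
    rw [← hd0] at hg2
    rw [pr, hcard, Finset.prod_range_succ', zero_add, hg2, ← hg, ← hg3, hR]
    have hp : (Fintype.card F : ℚ) ^ (finrank F V * d 0) =
        (Fintype.card F : ℚ) ^ (finrank F V * d 1) * (Fintype.card F : ℚ) ^ (finrank F V * μ 1) := by
      rw [← pow_add, ← mul_add, ← hd0]
    have hp2 : (Fintype.card F : ℚ) ^ (d 0 * μ 1) =
        (Fintype.card F : ℚ) ^ (d 1 * μ 1) * (Fintype.card F : ℚ) ^ (μ 1 ^ 2) := by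
      rw [← pow_add, hd0]; congr 1; ring
    rw [hp, hp2]
    field_simp

end PartD
section PartE
variable {F V : Type} [Field F] [Fintype F] [AddCommGroup V] [Module F V] [FiniteDimensional F V]

lemma card_agree (X : Submodule F V) (S : V →ₗ[F] V) :
    (Nat.card {T : V →ₗ[F] V // ∀ x ∈ X, T x = S x} : ℚ) *
      (Fintype.card F : ℚ) ^ (finrank F V * finrank F X) = Nat.card (V →ₗ[F] V) := by
  have hfV : Finite V := Module.finite_of_finite F
  let r : (V →ₗ[F] V) →ₗ[F] (X →ₗ[F] V) := LinearMap.domRestrict' X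
  have hr : Function.Surjective r := by
    intro g
    obtain ⟨g', hg'⟩ := LinearMap.exists_extend g
    exact ⟨g', hg'⟩
  have e1 : Nat.card {T : V →ₗ[F] V // ∀ x ∈ X, T x = S x} = Nat.card (LinearMap.ker r) := by
    refine Nat.card_congr ⟨fun T => ⟨T.1 - S, ?_⟩, fun T => ⟨T.1 + S, ?_⟩, ?_, ?_⟩
    · rw [LinearMap.mem_ker]
      ext x
      simpa [r, sub_eq_zero] using T.2 x x.2
    · intro x hx
      have := LinearMap.congr_fun (LinearMap.mem_ker.1 T.2) ⟨x, hx⟩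
      have h2 : T.1 x = 0 := this
      rw [LinearMap.add_apply, h2, zero_add]
    · intro T; simp
    · intro T; simp
  have e2 := LinearMap.finrank_range_add_finrank_ker r
  rw [LinearMap.range_eq_top.2 hr, finrank_top, Module.finrank_linearMap] at e2
  rw [e1, Module.natCard_eq_pow_finrank (K := F) (V := LinearMap.ker r),
    Module.natCard_eq_pow_finrank (K := F) (V := V →ₗ[F] V), ← e2, Nat.card_eq_fintype_card]
  push_cast
  rw [← pow_add, mul_comm (finrank F V), add_comm]

lemma card_GLV : (Nat.card (V ≃ₗ[F] V) : ℚ) = gq (Fintype.card F) (finrank F V) (finrank F V) := by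
  have hfV : Finite V := Module.finite_of_finite F
  let b := Module.finBasis F V
  have e : Nat.card (V ≃ₗ[F] V) = Nat.card (GL (Fin (finrank F V)) F) :=
    Nat.card_congr ((LinearMap.GeneralLinearGroup.generalLinearEquiv F V).symm.toEquiv.trans
      (Units.mapEquiv (LinearMap.toMatrixAlgEquiv b).toMulEquiv).toEquiv)
  rw [e, Matrix.card_GL_field, gq, Finset.prod_range, Nat.cast_prod]
  refine Finset.prod_congr rfl fun i _ => ?_
  rw [Nat.cast_sub]
  · push_cast; rfl
  · exact Nat.pow_le_pow_right Fintype.card_pos (by omega)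

lemma phi_conj_pow (D : V →ₗ[F] V) (φ : V ≃ₗ[F] V) (i : ℕ) (x : V) :
    φ (((φ.symm.toLinearMap ∘ₗ D ∘ₗ φ.toLinearMap) ^ i) x) = (D ^ i) (φ x) := by
  induction i with
  | zero => simp
  | succ i ih =>
    rw [pow_succ', pow_succ', Module.End.mul_apply, Module.End.mul_apply, ← ih]
    simp

lemma ch_conj (D : V →ₗ[F] V) (φ : V ≃ₗ[F] V) (X : Submodule F V) (j : ℕ) :
    finrank F (ch (φ.symm.toLinearMap ∘ₗ D ∘ₗ φ.toLinearMap) X j) =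
      finrank F (ch D (X.map φ.toLinearMap) j) := by
  rw [← LinearEquiv.finrank_map_eq φ]
  suffices h : (ch (φ.symm.toLinearMap ∘ₗ D ∘ₗ φ.toLinearMap) X j).map φ.toLinearMap =
      ch D (X.map φ.toLinearMap) j by rw [h]
  ext y
  constructor
  · rintro ⟨x, hx, rfl⟩
    have hx' := (mem_ch _ _ _ _).1 hx
    refine (mem_ch _ _ _ _).2 fun i hi => ?_
    have := Submodule.mem_map_of_mem (f := φ.toLinearMap) (hx' i hi)
    rw [LinearEquiv.coe_coe, phi_conj_pow] at this
    exact this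
  · intro hy
    refine ⟨φ.symm y, (mem_ch _ _ _ _).2 fun i hi => ?_, by simp⟩
    obtain ⟨z, hz, hzz⟩ := (mem_ch _ _ _ _).1 hy i hi
    have := phi_conj_pow D φ i (φ.symm y)
    rw [LinearEquiv.apply_symm_apply, ← hzz] at this
    have h2 := φ.injective this
    rw [h2]
    exact hz

lemma cConst_eq (q : ℕ) (hq : 1 ≤ q) (n : ℕ) (j : ℕ) : (cConst q n j : ℚ) =
    ((q : ℚ) ^ n - 1) * ∏ i ∈ Finset.range j, ((q : ℚ) ^ n - (q : ℚ) ^ (n - (i + 1))) := by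
  induction j with
  | zero =>
    rw [cConst, Nat.cast_sub (Nat.one_le_pow _ _ hq)]
    simp
  | succ j ih =>
    rw [cConst, Nat.cast_mul, ih, Nat.cast_sub (Nat.pow_le_pow_right hq (by omega)),
      Finset.prod_range_succ]
    push_cast
    ring

lemma cConst_gq (q : ℕ) (hq : 1 ≤ q) (d M : ℕ) :
    (cConst q (d + (M + 1)) M : ℚ) * ((q : ℚ) ^ (M + 1) - 1) =
      ((q : ℚ) ^ (d + (M + 1)) - 1) * ((q : ℚ) ^ (d * M) * gq q (M + 1) (M + 1)) := by
  rw [cConst_eq q hq, gq, ← Finset.prod_range_reflect _ (M + 1), Finset.prod_range_succ]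
  have : ∀ i ∈ Finset.range M, (q : ℚ) ^ (d + (M + 1)) - (q : ℚ) ^ (d + (M + 1) - (i + 1)) =
      (q : ℚ) ^ d * ((q : ℚ) ^ (M + 1) - (q : ℚ) ^ (M + 1 - 1 - i)) := by
    intro i hi
    rw [Finset.mem_range] at hi
    have : d + (M + 1) - (i + 1) = d + (M + 1 - 1 - i) := by omega
    rw [this]; ring
  rw [Finset.prod_congr rfl this, Finset.prod_mul_distrib]
  simp [pow_mul]
  ring

/-- The main enumeration, in dual form. -/
lemma main_count {D : V →ₗ[F] V} (hD : Irr D) (d μ : ℕ → ℕ) (k M : ℕ) (hM : μ 0 = M + 1)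
    (hn : finrank F V = d 0 + μ 0) (hd : ∀ j, d j = d (j + 1) + μ (j + 1)) (hk : d k = 0) :
    (Nat.card {Y : Submodule F V // ∀ j ≤ k, finrank F (ch D Y j) = d j} : ℚ) *
      (((Fintype.card F : ℚ) ^ μ 0 - 1) * (Fintype.card F : ℚ) ^ d 0) =
      ((Fintype.card F : ℚ) ^ finrank F V - 1) * ∏ j ∈ Finset.range k,
        (aeval (Fintype.card F : ℚ) (qbp (μ j) (μ (j + 1))) *
          (Fintype.card F : ℚ) ^ (μ (j + 1) ^ 2)) := by
  have hfE := finEnd (F := F) (V := V)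
  have hfV : Finite V := Module.finite_of_finite F
  have hne := card_End_ne (F := F) (V := V)
  have hq1 : (1 : ℚ) < Fintype.card F := by exact_mod_cast Fintype.one_lt_card
  have hq0 : (Fintype.card F : ℚ) ≠ 0 := by positivity
  have hfG : Finite (V ≃ₗ[F] V) := DFunLike.finite _
  set Pi := ∏ j ∈ Finset.range k,
        (aeval (Fintype.card F : ℚ) (qbp (μ j) (μ (j + 1))) *
          (Fintype.card F : ℚ) ^ (μ (j + 1) ^ 2)) with hPi
  have := Fintype.ofFinite {X : Submodule F V // finrank F X = d 0}
  have hft : ∀ X : Submodule F V, Fintype {T : V →ₗ[F] V // PF ⊤ X d k T} := fun X => Fintype.ofFinite _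
  have := Fintype.ofFinite ((V ≃ₗ[F] V) × {Y : Submodule F V // ∀ j ≤ k, finrank F (ch D Y j) = d j})
  -- first count
  have c1 : (Nat.card (Σ X : {X : Submodule F V // finrank F X = d 0},
      Σ T : {T : V →ₗ[F] V // PF ⊤ X.1 d k T},
        {φ : V ≃ₗ[F] V // ∀ x ∈ X.1, φ (T.1 x) = D (φ x)}) : ℚ) *
      (Fintype.card F : ℚ) ^ (finrank F V * d 0) =
      gq (Fintype.card F) (finrank F V) (d 0) * (Nat.card (V →ₗ[F] V) * Pi) *
        cConst (Fintype.card F) (finrank F V) M := by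
    have t1 : ∀ X : {X : Submodule F V // finrank F X = d 0},
        (Nat.card (Σ T : {T : V →ₗ[F] V // PF ⊤ X.1 d k T},
        {φ : V ≃ₗ[F] V // ∀ x ∈ X.1, φ (T.1 x) = D (φ x)}) : ℚ) =
        Nat.card (V →ₗ[F] V) * (gq (Fintype.card F) (d 0) (d 0) * Pi /
          (Fintype.card F : ℚ) ^ (finrank F V * d 0)) * cConst (Fintype.card F) (finrank F V) M := by
      rintro ⟨X, hX⟩
      have t2 : ∀ T : {T : V →ₗ[F] V // PF ⊤ X d k T},
          Nat.card {φ : V ≃ₗ[F] V // ∀ x ∈ X, φ (T.1 x) = D (φ x)} =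
            cConst (Fintype.card F) (finrank F V) M := by
        rintro ⟨T, hT⟩
        have hs : PSimple X T := PSimple_of_ch (k := k)
          (Submodule.finrank_eq_zero.1 ((hT.2 k le_rfl).trans hk))
        exact ECnt_eq hD M X T hs (by omega)
      have t3 := pr_PF k ⊤ X d μ le_top hX (by rw [finrank_top, hn]) hd hk
      rw [← hPi] at t3
      rw [Nat.card_sigma]
      simp only [t2]
      rw [Finset.sum_const, Finset.card_univ, ← Nat.card_eq_fintype_card, ← t3,
        mul_div_cancel_right₀ _ (by positivity), pr, mul_div_cancel₀ _ hne]
      simp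
    rw [Nat.card_sigma, Nat.cast_sum, Finset.sum_congr rfl fun X _ => t1 X, Finset.sum_const,
      nsmul_eq_mul, Finset.card_univ, ← Nat.card_eq_fintype_card, ← card_grass (by omega)]
    field_simp
  -- second count
  have c2 : (Nat.card (Σ p : (V ≃ₗ[F] V) × {Y : Submodule F V // ∀ j ≤ k, finrank F (ch D Y j) = d j},
      {T : V →ₗ[F] V // ∀ x ∈ p.2.1.map p.1.symm.toLinearMap,
        T x = (p.1.symm.toLinearMap ∘ₗ D ∘ₗ p.1.toLinearMap) x}) : ℚ) *
      (Fintype.card F : ℚ) ^ (finrank F V * d 0) =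
      Nat.card (V ≃ₗ[F] V) * Nat.card {Y : Submodule F V // ∀ j ≤ k, finrank F (ch D Y j) = d j} *
        Nat.card (V →ₗ[F] V) := by
    rw [Nat.card_sigma, Nat.cast_sum, Finset.sum_mul]
    have t1 : ∀ p : (V ≃ₗ[F] V) × {Y : Submodule F V // ∀ j ≤ k, finrank F (ch D Y j) = d j},
      (Nat.card {T : V →ₗ[F] V // ∀ x ∈ p.2.1.map p.1.symm.toLinearMap,
        T x = (p.1.symm.toLinearMap ∘ₗ D ∘ₗ p.1.toLinearMap) x} : ℚ) *
        (Fintype.card F : ℚ) ^ (finrank F V * d 0) = Nat.card (V →ₗ[F] V) := by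
      rintro ⟨φ, Y, hY⟩
      have h0 : finrank F (Y.map φ.symm.toLinearMap) = d 0 := by
        rw [LinearEquiv.finrank_map_eq]
        exact hY 0 (Nat.zero_le _)
      rw [← h0]
      exact card_agree _ _
    rw [Finset.sum_congr rfl fun p _ => t1 p, Finset.sum_const, nsmul_eq_mul, Finset.card_univ,
      ← Nat.card_eq_fintype_card, Nat.card_prod]
    push_cast
    rfl
  -- bijection
  have hPFiff : ∀ (X : Submodule F V) (T : V →ₗ[F] V) (φ : V ≃ₗ[F] V),
      (∀ x ∈ X, T x = (φ.symm.toLinearMap ∘ₗ D ∘ₗ φ.toLinearMap) x) →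
      (∀ j, finrank F (ch T X j) = finrank F (ch D (X.map φ.toLinearMap) j)) := by
    intro X T φ h j
    rw [ch_congr j X h, ch_conj]
  have hm1 : ∀ (X : Submodule F V) (φ : V ≃ₗ[F] V),
      (X.map φ.toLinearMap).map φ.symm.toLinearMap = X := by
    intro X φ
    rw [← Submodule.map_comp]; simp
  have hm2 : ∀ (X : Submodule F V) (φ : V ≃ₗ[F] V),
      (X.map φ.symm.toLinearMap).map φ.toLinearMap = X := by
    intro X φ
    rw [← Submodule.map_comp]; simp
  have c3 : Nat.card (Σ X : {X : Submodule F V // finrank F X = d 0},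
      Σ T : {T : V →ₗ[F] V // PF ⊤ X.1 d k T},
        {φ : V ≃ₗ[F] V // ∀ x ∈ X.1, φ (T.1 x) = D (φ x)}) =
      Nat.card (Σ p : (V ≃ₗ[F] V) × {Y : Submodule F V // ∀ j ≤ k, finrank F (ch D Y j) = d j},
      {T : V →ₗ[F] V // ∀ x ∈ p.2.1.map p.1.symm.toLinearMap,
        T x = (p.1.symm.toLinearMap ∘ₗ D ∘ₗ p.1.toLinearMap) x}) := by
    have ha : ∀ s : (Σ X : {X : Submodule F V // finrank F X = d 0},
      Σ T : {T : V →ₗ[F] V // PF ⊤ X.1 d k T},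
        {φ : V ≃ₗ[F] V // ∀ x ∈ X.1, φ (T.1 x) = D (φ x)}), ∀ x ∈ s.1.1,
        s.2.1.1 x = (s.2.2.1.symm.toLinearMap ∘ₗ D ∘ₗ s.2.2.1.toLinearMap) x := by
      rintro ⟨⟨X, hX⟩, ⟨T, hT⟩, ⟨φ, hφ⟩⟩ x hx
      have := hφ x hx
      simp only [LinearMap.comp_apply, LinearEquiv.coe_coe] at this ⊢
      rw [← this]; simp
    refine Nat.card_eq_of_bijective (fun s => ⟨(s.2.2.1, ⟨s.1.1.map s.2.2.1.toLinearMap, ?_⟩),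
      ⟨s.2.1.1, ?_⟩⟩) ⟨?_, ?_⟩
    · intro j hj
      rw [← hPFiff _ _ _ (ha s) j]
      exact s.2.1.2.2 j hj
    · simp only [hm1]
      exact ha s
    · rintro ⟨⟨X, hX⟩, ⟨T, hT⟩, ⟨φ, hφ⟩⟩ ⟨⟨X', hX'⟩, ⟨T', hT'⟩, ⟨φ', hφ'⟩⟩ h
      have h1 : φ = φ' := congrArg (fun s => s.1.1) h
      have h2 : X.map φ.toLinearMap = X'.map φ'.toLinearMap := congrArg (fun s => s.1.2.1) h
      have h3 : T = T' := congrArg (fun s => s.2.1) h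
      subst h1 h3
      have h4 : X = X' := by rw [← hm1 X φ, h2, hm1]
      subst h4
      rfl
    · rintro ⟨⟨φ, ⟨Y, hY⟩⟩, ⟨T, hT⟩⟩
      have hp := hPFiff _ _ _ hT
      have hX : ∀ j ≤ k, finrank F (ch T (Y.map φ.symm.toLinearMap) j) = d j := fun j hj =>
        (hp j).trans (by rw [hm2]; exact hY j hj)
      refine ⟨⟨⟨Y.map φ.symm.toLinearMap, hX 0 (Nat.zero_le _)⟩, ⟨T, fun _ _ => trivial, hX⟩,
        ⟨φ, fun x hx => ?_⟩⟩, ?_⟩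
      · have := hT x hx
        simp only at this ⊢
        rw [this]; simp
      · have hext : ∀ a b : (Σ p : (V ≃ₗ[F] V) × {Y : Submodule F V // ∀ j ≤ k, finrank F (ch D Y j) = d j},
            {T : V →ₗ[F] V // ∀ x ∈ p.2.1.map p.1.symm.toLinearMap,
            T x = (p.1.symm.toLinearMap ∘ₗ D ∘ₗ p.1.toLinearMap) x}), a.1.1 = b.1.1 →
            a.1.2.1 = b.1.2.1 → a.2.1 = b.2.1 → a = b := by
          rintro ⟨⟨φ, ⟨Y, hY⟩⟩, ⟨T, hT⟩⟩ ⟨⟨φ', ⟨Y', hY'⟩⟩, ⟨T', hT'⟩⟩ h1 h2 h3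
          simp only at h1 h2 h3
          subst h1 h2 h3
          rfl
        exact hext _ _ rfl (hm2 _ _) rfl
  rw [c3, c2, card_GLV] at c1
  have hg := gq_add (Fintype.card F : ℚ) (d 0) (μ 0) (μ 0)
  rw [← hn] at hg
  rw [hg] at c1
  have hgn : gq (Fintype.card F) (finrank F V) (d 0) ≠ 0 := gq_ne _ hq1 _ _ (by omega)
  have hgm : gq (Fintype.card F) (M + 1) (M + 1) ≠ 0 := gq_ne _ hq1 _ _ le_rfl
  have hc := cConst_gq (Fintype.card F) Fintype.card_pos (d 0) M
  rw [← hM, ← hn, hM] at hc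
  rw [hM] at c1 ⊢
  set σ := (Nat.card {Y : Submodule F V // ∀ j ≤ k, finrank F (ch D Y j) = d j} : ℚ)
  set Q := (Fintype.card F : ℚ)
  have c4 : Q ^ (d 0 * (M + 1)) * gq Q (M + 1) (M + 1) * σ =
      Pi * cConst (Fintype.card F) (finrank F V) M := by
    apply mul_left_cancel₀ (mul_ne_zero hgn hne)
    linear_combination c1
  have hQ : Q ^ (d 0 * M) ≠ 0 := by positivity
  apply mul_left_cancel₀ (mul_ne_zero hQ hgm)
  have : Q ^ (d 0 * (M + 1)) = Q ^ (d 0 * M) * Q ^ d 0 := by rw [← pow_add]; rfl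
  rw [this] at c4
  linear_combination (Q ^ (M + 1) - 1) * c4 + Pi * hc

end PartE
section PartF
variable {F : Type} [Field F] [Fintype F] {n : ℕ}

lemma irr_of_simple (Δ : Matrix (Fin n) (Fin n) F) (h : Irreducible Δ.charpoly) :
    Irr Δ.mulVecLin := by
  intro W hW
  by_cases hb : W = ⊥
  · exact Or.inl hb
  right
  have hnt : Nontrivial W := Submodule.nontrivial_iff_ne_bot.2 hb
  let R : W →ₗ[F] W := Δ.mulVecLin.restrict hW
  have hRp : ∀ i (w : W), (((R ^ i) w : W) : Fin n → F) = (Δ.mulVecLin ^ i) w := by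
    intro i w
    rw [Module.End.pow_restrict]
    rfl
  have hR : aeval R Δ.charpoly = 0 := by
    ext1 w
    apply Subtype.ext
    have h1 : (((aeval R Δ.charpoly) w : W) : Fin n → F) = aeval Δ.mulVecLin Δ.charpoly w := by
      rw [aeval_eq_sum_range, aeval_eq_sum_range, LinearMap.sum_apply, LinearMap.sum_apply,
        Submodule.coe_sum]
      refine Finset.sum_congr rfl fun i _ => ?_
      rw [LinearMap.smul_apply, LinearMap.smul_apply, Submodule.coe_smul, hRp]
    rw [h1, ← Matrix.charpoly_mulVecLin, LinearMap.aeval_self_charpoly]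
    rfl
  have hdvd := minpoly.dvd F R hR
  have hnu : ¬ IsUnit (minpoly F R) := minpoly.not_isUnit F R
  have hass : Associated (minpoly F R) Δ.charpoly :=
    ((h.dvd_iff).1 hdvd).resolve_left hnu |>.symm
  have hdeg : (minpoly F R).natDegree = n := by
    rw [natDegree_eq_of_degree_eq (degree_eq_degree_of_associated hass),
      Matrix.charpoly_natDegree_eq_dim, Fintype.card_fin]
  have hle := natDegree_le_of_dvd (LinearMap.minpoly_dvd_charpoly R) (LinearMap.charpoly_monic R).ne_zero
  rw [LinearMap.charpoly_natDegree, hdeg] at hle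
  apply Submodule.eq_top_of_finrank_eq
  have := Submodule.finrank_le W
  rw [finrank_fin_fun] at this ⊢
  omega

lemma irr_dual (Δ : Matrix (Fin n) (Fin n) F) (h : Irreducible Δ.charpoly) :
    Irr (Δ.mulVecLin.dualMap) := by
  intro Y hY
  have h1 : Y.dualCoannihilator ≤ Y.dualCoannihilator.comap Δ.mulVecLin := by
    intro x hx
    rw [Submodule.mem_comap, Submodule.mem_dualCoannihilator]
    intro φ hφ
    exact (Submodule.mem_dualCoannihilator x).1 hx _ (hY hφ)
  have h2 : Y.dualCoannihilator.dualAnnihilator = Y := Subspace.dualCoannihilator_dualAnnihilator_eq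
  rcases irr_of_simple Δ h _ h1 with h3 | h3
  · right; rw [← h2, h3, Submodule.dualAnnihilator_bot]
  · left; rw [← h2, h3, Submodule.dualAnnihilator_top]

lemma dual_pow (Δ : Matrix (Fin n) (Fin n) F) (i : ℕ) (f : Module.Dual F (Fin n → F)) (w : Fin n → F) :
    ((Δ.mulVecLin.dualMap ^ i) f) w = f ((Δ ^ i) *ᵥ w) := by
  induction i generalizing w with
  | zero => simp
  | succ i ih =>
    rw [pow_succ', Module.End.mul_apply, LinearMap.dualMap_apply, ih, pow_succ,
      Matrix.mulVecLin_apply, Matrix.mulVec_mulVec]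

lemma ann_iterSpan (Δ : Matrix (Fin n) (Fin n) F) (W : Submodule F (Fin n → F)) (j : ℕ) :
    (iterSpan Δ W (j + 1)).dualAnnihilator = ch Δ.mulVecLin.dualMap W.dualAnnihilator j := by
  ext f
  rw [mem_ch, iterSpan]
  simp only [Submodule.dualAnnihilator_iSup_eq, Submodule.mem_iInf, Submodule.mem_dualAnnihilator,
    Finset.mem_range]
  constructor
  · intro h i hi w hw
    rw [dual_pow]
    exact h i (by omega) _ (Submodule.mem_map_of_mem hw)
  · rintro h i hi _ ⟨w, hw, rfl⟩
    have := h i (by omega) w hw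
    rw [dual_pow] at this
    exact this

end PartF

/-- If `Δ` is simple (irreducible characteristic polynomial), then for every
partition `μ` of `n`,
`σ(μ,Δ) = ((qⁿ-1)/(q^{μ₁}-1)) ∏_{i≥2} q^{μ_i² - μ_i} [μ_{i-1} choose μ_i]_q`. -/
theorem statement8 (q : ℕ) (hq : IsPrimePow q) (n : ℕ) (hn : 0 < n)
    (F : Type) [Field F] [Fintype F] (hF : Fintype.card F = q)
    (Δ : Matrix (Fin n) (Fin n) F) (hsimple : Irreducible Δ.charpoly)
    (μ : ℕ →₀ ℕ) (hμ : IsPtn μ) (hsize : ptnSize μ = n) :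
    (sigmaProf μ Δ : ℚ) =
      ((q : ℚ) ^ n - 1) / ((q : ℚ) ^ (μ 0) - 1) *
        ∏ᶠ i : ℕ,
          (q : ℚ) ^ ((μ (i + 1)) ^ 2 - μ (i + 1)) *
            Polynomial.aeval (q : ℚ) (qbp (μ i) (μ (i + 1))) := by
  subst hF
  set Q : ℚ := (Fintype.card F : ℚ) with hQ
  have hq1 : (1 : ℚ) < Q := by rw [hQ]; exact_mod_cast Fintype.one_lt_card
  obtain ⟨K, hK⟩ : ∃ K, ∀ i, K ≤ i → μ i = 0 := by
    refine ⟨μ.support.sup id + 1, fun i hi => ?_⟩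
    by_contra hne
    have : i ≤ μ.support.sup id := Finset.le_sup (f := id) (Finsupp.mem_support_iff.2 hne)
    omega
  have hS : ∀ j, K ≤ j → ∑ i ∈ Finset.range j, μ i = n := by
    intro j hj
    rw [← hsize, ptnSize, Finsupp.sum]
    symm
    apply Finset.sum_subset
    · intro i hi
      rw [Finset.mem_range]
      by_contra hlt
      exact (Finsupp.mem_support_iff.1 hi) (hK i (by omega))
    · intro i _ hi
      simpa using hi
  have hSle : ∀ j, ∑ i ∈ Finset.range j, μ i ≤ n := by
    intro j
    rw [← hS (max j K) (le_max_right _ _)]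
    exact Finset.sum_le_sum_of_subset (Finset.range_mono (le_max_left _ _))
  let d : ℕ → ℕ := fun j => n - ∑ i ∈ Finset.range (j + 1), μ i
  have hdS : ∀ j, d j + ∑ i ∈ Finset.range (j + 1), μ i = n := fun j => Nat.sub_add_cancel (hSle _)
  have hd : ∀ j, d j = d (j + 1) + μ (j + 1) := by
    intro j
    have h1 := hdS j
    have h2 := hdS (j + 1)
    rw [Finset.sum_range_succ] at h2
    omega
  have hdK : ∀ j, K ≤ j → d j = 0 := by
    intro j hj
    have h1 := hdS j
    rw [hS (j + 1) (by omega)] at h1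
    omega
  have hd0 := hdS 0
  simp only [zero_add, Finset.sum_range_one] at hd0
  have hμ0 : 0 < μ 0 := by
    by_contra h0
    have hz : ∀ i, μ i = 0 := by
      intro i
      induction i with
      | zero => omega
      | succ i ih => have := hμ i; omega
    have h1 := hS K le_rfl
    simp [hz] at h1
    omega
  obtain ⟨M, hM⟩ : ∃ M, μ 0 = M + 1 := ⟨μ 0 - 1, by omega⟩
  have hfr : finrank F (Module.Dual F (Fin n → F)) = n := by
    rw [Subspace.dual_finrank_eq, finrank_fin_fun]
  have main := main_count (irr_dual Δ hsimple) d μ K M hM (by rw [hfr]; exact hd0.symm) hd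
    (hdK K le_rfl)
  rw [hfr, ← hQ] at main
  have hprof : ∀ W : Submodule F (Fin n → F), HasProfile Δ μ W ↔
      ∀ j ≤ K, finrank F (ch Δ.mulVecLin.dualMap W.dualAnnihilator j) = d j := by
    intro W
    have hj : ∀ j, finrank F (iterSpan Δ W (j + 1)) +
        finrank F (ch Δ.mulVecLin.dualMap W.dualAnnihilator j) = n := by
      intro j
      rw [← ann_iterSpan, Subspace.finrank_add_finrank_dualAnnihilator_eq, finrank_fin_fun]
    constructor
    · intro h j _
      have h1 := hj j
      have h2 := hdS j
      have h3 := h j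
      omega
    · intro h j
      have h1 := hj j
      have h2 := hdS j
      rcases Nat.lt_or_ge K j with h3 | h3
      · have h4 : ch Δ.mulVecLin.dualMap W.dualAnnihilator j ≤
            ch Δ.mulVecLin.dualMap W.dualAnnihilator K := by
          intro f hf
          rw [mem_ch] at hf ⊢
          exact fun i hi => hf i (by omega)
        have h5 := Submodule.finrank_mono h4
        rw [h K le_rfl, hdK K le_rfl] at h5
        have h6 := hdK j (by omega)
        omega
      · have h4 := h j h3
        omega
  have hcard : sigmaProf μ Δ = Nat.card {Y : Submodule F (Module.Dual F (Fin n → F)) //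
      ∀ j ≤ K, finrank F (ch Δ.mulVecLin.dualMap Y j) = d j} := by
    rw [sigmaProf]
    refine Nat.card_congr ⟨fun W => ⟨W.1.dualAnnihilator, (hprof _).1 W.2⟩,
      fun Y => ⟨Y.1.dualCoannihilator, (hprof _).2 ?_⟩, ?_, ?_⟩
    · rw [Subspace.dualCoannihilator_dualAnnihilator_eq]
      exact Y.2
    · intro W
      exact Subtype.ext Subspace.dualAnnihilator_dualCoannihilator_eq
    · intro Y
      exact Subtype.ext Subspace.dualCoannihilator_dualAnnihilator_eq
  rw [← hcard] at main
  have hfp : (∏ᶠ i : ℕ, Q ^ ((μ (i + 1)) ^ 2 - μ (i + 1)) * aeval Q (qbp (μ i) (μ (i + 1)))) =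
      ∏ i ∈ Finset.range K, (Q ^ ((μ (i + 1)) ^ 2 - μ (i + 1)) * aeval Q (qbp (μ i) (μ (i + 1)))) := by
    apply finprod_eq_prod_of_mulSupport_subset
    intro i hi
    rw [Finset.coe_range, Set.mem_Iio]
    by_contra hlt
    apply hi
    have : μ (i + 1) = 0 := hK _ (by omega)
    simp [this, qbp]
  rw [hfp]
  have hd0K : d 0 = ∑ j ∈ Finset.range K, μ (j + 1) := by
    have h1 := hS (K + 1) (by omega)
    rw [Finset.sum_range_succ'] at h1
    omega
  have hprod : ∏ j ∈ Finset.range K, (aeval Q (qbp (μ j) (μ (j + 1))) * Q ^ (μ (j + 1) ^ 2)) =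
      Q ^ d 0 * ∏ i ∈ Finset.range K,
        (Q ^ ((μ (i + 1)) ^ 2 - μ (i + 1)) * aeval Q (qbp (μ i) (μ (i + 1)))) := by
    rw [hd0K, ← Finset.prod_pow_eq_pow_sum, ← Finset.prod_mul_distrib]
    refine Finset.prod_congr rfl fun i _ => ?_
    have h1 : μ (i + 1) ^ 2 = μ (i + 1) + (μ (i + 1) ^ 2 - μ (i + 1)) := by
      have : μ (i + 1) ≤ μ (i + 1) ^ 2 := Nat.le_self_pow (by norm_num) _
      omega
    nth_rewrite 1 [h1]
    rw [pow_add]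
    ring
  rw [hprod] at main
  have hm1 : Q ^ μ 0 - 1 ≠ 0 := by
    have := one_lt_pow₀ hq1 (by omega : μ 0 ≠ 0)
    linarith
  have hQd : Q ^ d 0 ≠ 0 := by positivity
  rw [div_mul_eq_mul_div, eq_div_iff hm1]
  apply mul_left_cancel₀ hQd
  linear_combination main
end

section
/- Let q be a prime power and m, ℓ positive integers, and let α ∈ 𝔽_{q^{mℓ}} be an element such that 𝔽_{q^{mℓ}} = 𝔽_q(α). Then the number of m-dimensional 𝔽_q-subspaces W of 𝔽_{q^{mℓ}} such that 𝔽_{q^{mℓ}} = W ⊕ αW ⊕ α²W ⊕ ⋯ ⊕ α^{ℓ−1}W equals q^{(ℓ−1)m(m−1)} · (q^{mℓ} − 1)/(q^m − 1). -/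
open Matrix Module Polynomial

attribute [local instance] Classical.propDecidable

namespace SplitSub

/-- Polynomial with given coefficients. -/
noncomputable def toP {K : Type} [Field K] {ℓ : ℕ} (c : Fin ℓ → K) : K[X] :=
  ∑ i : Fin ℓ, C (c i) * X ^ (i : ℕ)

/-- Over a field, some minor of size the rank does not vanish. -/
lemma exists_minor {F ι κ : Type*} [Field F] [Fintype ι] [Fintype κ] (M : Matrix ι κ F) :
    ∃ (r : Fin M.rank → ι) (c : Fin M.rank → κ), (M.submatrix r c).det ≠ 0 := by
  have h1 := Submodule.exists_fun_fin_finrank_span_eq F (Set.range M.row)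
  rw [← Matrix.rank_eq_finrank_span_row] at h1
  obtain ⟨f, hf, -, hli⟩ := h1
  choose r hr using hf
  have hN : LinearIndependent F (M.submatrix r id).row := by
    have he : (M.submatrix r id).row = f := by
      ext i j
      rw [← hr i]; rfl
    rw [he]; exact hli
  have hrank := hN.rank_matrix
  rw [Fintype.card_fin, ← Matrix.rank_transpose] at hrank
  have h2 := Submodule.exists_fun_fin_finrank_span_eq F (Set.range (M.submatrix r id)ᵀ.row)
  rw [← Matrix.rank_eq_finrank_span_row, hrank] at h2
  obtain ⟨g, hg, -, hli2⟩ := h2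
  choose c hc using hg
  refine ⟨r, c, ?_⟩
  have hli3 : LinearIndependent F ((M.submatrix r c)ᵀ).row := by
    have he : ((M.submatrix r c)ᵀ).row = g := by
      ext i j
      rw [← hc i]; rfl
    rw [he]; exact hli2
  have := Matrix.linearIndependent_rows_iff_isUnit.1 hli3
  rw [Matrix.isUnit_iff_isUnit_det, Matrix.det_transpose] at this
  exact this.ne_zero

lemma le_rank_of_minor {F ι κ : Type*} [Field F] [Fintype ι] [Fintype κ] (M : Matrix ι κ F)
    {k : ℕ} (r : Fin k → ι) (c : Fin k → κ) (h : (M.submatrix r c).det ≠ 0) : k ≤ M.rank := by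
  have h1 := Matrix.rank_of_det_ne_zero h
  have h2 := Matrix.rank_submatrix_le M r c
  simp only [Fintype.card_fin] at h1
  omega

/-- Ranks of two specializations agree when the same minors vanish. -/
lemma rank_map_le {R F G ι κ : Type*} [CommRing R] [Field F] [Field G] [Fintype ι] [Fintype κ]
    (M : Matrix ι κ R) (φ : R →+* F) (ψ : R →+* G)
    (h : ∀ (k : ℕ), k ≤ Fintype.card κ → ∀ (r : Fin k → ι) (c : Fin k → κ),
      φ (M.submatrix r c).det ≠ 0 → ψ (M.submatrix r c).det ≠ 0) :
    (M.map φ).rank ≤ (M.map ψ).rank := by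
  obtain ⟨r, c, hrc⟩ := exists_minor (M.map φ)
  refine le_rank_of_minor _ r c ?_
  have := h _ (Matrix.rank_le_card_width _) r c
  rw [RingHom.map_det, RingHom.map_det] at this
  exact this hrc

lemma natDegree_toP {K : Type} [Field K] {ℓ : ℕ} (c : Fin ℓ → K) :
    (toP c).natDegree ≤ ℓ - 1 := by
  refine natDegree_sum_le_of_forall_le _ _ fun i _ => ?_
  refine (natDegree_C_mul_X_pow_le _ _).trans ?_
  have := i.2
  omega

lemma toP_eq_zero {K : Type} [Field K] {ℓ : ℕ} (c : Fin ℓ → K) (h : toP c = 0) : c = 0 := by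
  ext i
  have := congrArg (fun p => p.coeff i) h
  simpa [toP, finsetSum_coeff, coeff_C_mul, coeff_X_pow, Fin.val_inj] using this

lemma aeval_toP {K : Type} [Field K] {ℓ : ℕ} {E : Type} [Field E] [Algebra K E] (α : E)
    (c : Fin ℓ → K) : aeval α (toP c) = ∑ i, c i • α ^ (i : ℕ) := by
  simp [toP, Algebra.smul_def]

/-- The matrix of polynomials. -/
noncomputable def pm {K : Type} [Field K] {m ℓ : ℕ} (A : Finset (Fin m → Fin ℓ → K)) :
    Matrix A (Fin m) K[X] := fun a j => toP (a.1 j)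

/-- generic rank. -/
noncomputable def grk {K : Type} [Field K] {m ℓ : ℕ} (A : Finset (Fin m → Fin ℓ → K)) : ℕ :=
  ((pm A).map (algebraMap K[X] (RatFunc K))).rank

lemma natDegree_minor {K : Type} [Field K] {m ℓ : ℕ} (A : Finset (Fin m → Fin ℓ → K)) {k : ℕ}
    (hk : k ≤ m) (r : Fin k → A) (c : Fin k → Fin m) :
    ((pm A).submatrix r c).det.natDegree ≤ m * (ℓ - 1) := by
  rw [Matrix.det_apply]
  refine natDegree_sum_le_of_forall_le _ _ fun σ _ => ?_
  refine (natDegree_smul_le _ _).trans ?_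
  refine (natDegree_prod_le _ _).trans ?_
  refine (Finset.sum_le_card_nsmul _ _ (ℓ - 1) fun i _ => natDegree_toP _).trans ?_
  simp
  exact Nat.mul_le_mul_right _ hk

lemma rank_eq {K : Type} [Field K] {m ℓ : ℕ} {E : Type} [Field E] [Algebra K E]
    [FiniteDimensional K E] (α : E)
    (hα : m * (ℓ - 1) < (minpoly K α).natDegree) (A : Finset (Fin m → Fin ℓ → K)) :
    ((pm A).map (aeval α : K[X] →ₐ[K] E).toRingHom).rank = grk A := by
  apply le_antisymm
  · refine rank_map_le _ _ _ fun k hk r c h h0 => h ?_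
    have : ((pm A).submatrix r c).det = 0 :=
      (FaithfulSMul.algebraMap_injective K[X] (RatFunc K)) (by rw [h0, map_zero])
    rw [this, map_zero]
  · refine rank_map_le _ _ _ fun k hk r c h h0 => h ?_
    have hd := natDegree_minor A (by simpa using hk) r c
    have : ((pm A).submatrix r c).det = 0 := by
      by_contra hne
      have h3 := natDegree_le_natDegree (minpoly.degree_le_of_ne_zero K α hne h0)
      omega
    rw [this, map_zero]

lemma grk_le {K : Type} [Field K] {m ℓ : ℕ} (A : Finset (Fin m → Fin ℓ → K)) : grk A ≤ m := by
  simpa [grk] using Matrix.rank_le_card_width ((pm A).map (algebraMap K[X] (RatFunc K)))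

lemma grk_pos {K : Type} [Field K] {m ℓ : ℕ} (A : Finset (Fin m → Fin ℓ → K))
    (h0 : (0 : Fin m → Fin ℓ → K) ∉ A) (hA : A.Nonempty) : 0 < grk A := by
  obtain ⟨a, ha⟩ := hA
  have hne : a ≠ 0 := fun h => h0 (h ▸ ha)
  obtain ⟨j, hj⟩ := Function.ne_iff.1 hne
  refine le_rank_of_minor (k := 1) _ (fun _ => ⟨a, ha⟩) (fun _ => j) ?_
  rw [Matrix.det_fin_one]
  intro h
  apply hj
  apply toP_eq_zero
  apply FaithfulSMul.algebraMap_injective K[X] (RatFunc K)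
  rw [map_zero]; exact h

/-- the tuples admitting no relation. -/
def Good (K : Type) [Field K] (m ℓ : ℕ) {E : Type} [Field E] [Algebra K E] (α : E)
    (w : Fin m → E) : Prop :=
  ∀ v : Fin m → Fin ℓ → K, ∑ j, aeval α (toP (v j)) * w j = 0 → v = 0

/-- The counting polynomial. -/
noncomputable def cpoly (K : Type) [Field K] [Fintype K] (m ℓ : ℕ) : ℚ[X] :=
  ∑ A ∈ ((Finset.univ : Finset (Fin m → Fin ℓ → K)).erase 0).powerset,
    C ((-1) ^ A.card) * X ^ (m - grk A)

lemma card_ker {K : Type} [Field K] {m ℓ : ℕ} {E : Type} [Field E] [Fintype E] [Algebra K E]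
    [FiniteDimensional K E] (α : E)
    (hα : m * (ℓ - 1) < (minpoly K α).natDegree) (A : Finset (Fin m → Fin ℓ → K)) :
    Nat.card {w : Fin m → E // ∀ v ∈ A, ∑ j, aeval α (toP (v j)) * w j = 0}
      = Fintype.card E ^ (m - grk A) := by
  let L := ((pm A).map (aeval α : K[X] →ₐ[K] E).toRingHom).mulVecLin
  have h1 : Nat.card {w : Fin m → E // ∀ v ∈ A, ∑ j, aeval α (toP (v j)) * w j = 0}
      = Nat.card (LinearMap.ker L) := by
    refine Nat.card_congr (Equiv.subtypeEquivRight fun w => ?_)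
    rw [LinearMap.mem_ker, funext_iff]
    simp only [Subtype.forall]
    rfl
  rw [h1, Module.natCard_eq_pow_finrank (K := E), Nat.card_eq_fintype_card]
  congr 1
  have h2 := LinearMap.finrank_range_add_finrank_ker L
  have h3 : finrank E (LinearMap.range L) = grk A := rank_eq α hα A
  rw [h3] at h2
  simp at h2
  omega

lemma card_good {K : Type} [Field K] [Fintype K] {m ℓ : ℕ} {E : Type} [Field E] [Fintype E]
    [Algebra K E] (α : E)
    (hα : m * (ℓ - 1) < (minpoly K α).natDegree) :
    (Nat.card {w : Fin m → E // Good K m ℓ α w} : ℚ)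
      = (cpoly K m ℓ).eval (Fintype.card E : ℚ) := by
  have hind : ∀ w : Fin m → E, (if Good K m ℓ α w then (1 : ℚ) else 0) =
      ∑ A ∈ ((Finset.univ : Finset (Fin m → Fin ℓ → K)).erase 0).powerset,
        (-1) ^ A.card * (if ∀ v ∈ A, ∑ j, aeval α (toP (v j)) * w j = 0 then (1 : ℚ) else 0) := by
    intro w
    have h1 : (if Good K m ℓ α w then (1 : ℚ) else 0) =
        ∏ v ∈ (Finset.univ : Finset (Fin m → Fin ℓ → K)).erase 0,
          (1 + (-1) * (if ∑ j, aeval α (toP (v j)) * w j = 0 then (1 : ℚ) else 0)) := by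
      by_cases hg : Good K m ℓ α w
      · rw [if_pos hg, Finset.prod_eq_one]
        intro v hv
        rw [if_neg]
        · norm_num
        · intro h
          exact (Finset.mem_erase.1 hv).1 (hg v h)
      · rw [if_neg hg]
        unfold Good at hg
        push Not at hg
        obtain ⟨v, hv, hv0⟩ := hg
        rw [Finset.prod_eq_zero (i := v)]
        · simpa using hv0
        · rw [if_pos hv]; norm_num
    rw [h1, Finset.prod_one_add]
    refine Finset.sum_congr rfl fun A _ => ?_
    rw [Finset.prod_mul_distrib, Finset.prod_const, Finset.prod_ite_zero]
    simp
  have h2 : (Nat.card {w : Fin m → E // Good K m ℓ α w} : ℚ) =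
      ∑ w : Fin m → E, (if Good K m ℓ α w then (1 : ℚ) else 0) := by
    rw [Finset.sum_boole, Nat.card_eq_fintype_card, Fintype.card_subtype]
  rw [h2]
  simp_rw [hind]
  rw [Finset.sum_comm, cpoly, eval_finsetSum]
  refine Finset.sum_congr rfl fun A _ => ?_
  rw [← Finset.mul_sum, Finset.sum_boole, ← Fintype.card_subtype, ← Nat.card_eq_fintype_card,
    card_ker α hα]
  simp

lemma cpoly_monic (K : Type) [Field K] [Fintype K] (m ℓ : ℕ) (hm : 0 < m) :
    (cpoly K m ℓ).Monic ∧ (cpoly K m ℓ).natDegree = m := by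
  have hmem : (∅ : Finset (Fin m → Fin ℓ → K)) ∈
    ((Finset.univ : Finset (Fin m → Fin ℓ → K)).erase 0).powerset := by simp
  have h0 : grk (∅ : Finset (Fin m → Fin ℓ → K)) = 0 := by
    have := Matrix.rank_le_card_height ((pm (∅ : Finset (Fin m → Fin ℓ → K))).map
      (algebraMap K[X] (RatFunc K)))
    simpa [grk] using this
  have hsplit : ∃ p : ℚ[X], p.degree < (m : WithBot ℕ) ∧ cpoly K m ℓ = X ^ m + p := by
    refine ⟨∑ A ∈ (((Finset.univ : Finset (Fin m → Fin ℓ → K)).erase 0).powerset).erase ∅,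
      C ((-1) ^ A.card) * X ^ (m - grk A), ?_, ?_⟩
    rotate_left
    · rw [cpoly, ← Finset.add_sum_erase _ _ hmem, h0]
      simp only [Finset.card_empty, pow_zero, C_1, one_mul, Nat.sub_zero]
    · refine (degree_sum_le _ _).trans_lt ?_
      refine (Finset.sup_lt_iff (WithBot.bot_lt_coe m)).2 ?_
      intro A hA
      rw [Finset.mem_erase, Finset.mem_powerset] at hA
      refine (degree_C_mul_X_pow_le _ _).trans_lt ?_
      have hp := grk_pos A (fun h => by simpa using hA.2 h) (Finset.nonempty_iff_ne_empty.2 hA.1)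
      exact WithBot.coe_lt_coe.2 (by omega : m - grk A < m)
  obtain ⟨p, hp, he⟩ := hsplit
  rw [he]
  refine ⟨monic_X_pow_add hp, ?_⟩
  apply natDegree_eq_of_degree_eq_some
  rw [degree_add_eq_left_of_degree_lt] <;> rw [degree_X_pow]
  exact hp

lemma cpoly_one (K : Type) [Field K] [Fintype K] (m ℓ : ℕ) (hm : 0 < m) (hℓ : 0 < ℓ) :
    (cpoly K m ℓ).eval 1 = 0 := by
  have : ((Finset.univ : Finset (Fin m → Fin ℓ → K)).erase 0).Nonempty := by
    refine ⟨fun _ _ => 1, ?_⟩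
    rw [Finset.mem_erase]
    refine ⟨fun h => ?_, Finset.mem_univ _⟩
    have := congrFun (congrFun h ⟨0, hm⟩) ⟨0, hℓ⟩
    simp at this
  have h := Finset.sum_powerset_neg_one_pow_card_of_nonempty this
  rw [cpoly, eval_finsetSum]
  simp only [eval_mul, eval_C, eval_pow, eval_X, one_pow, mul_one]
  exact_mod_cast h

lemma good_iff_li {K : Type} [Field K] (m ℓ : ℕ) {E : Type} [Field E] [Algebra K E] (α : E)
    (w : Fin m → E) : Good K m ℓ α w ↔
      LinearIndependent K (fun p : Fin ℓ × Fin m => α ^ (p.1 : ℕ) * w p.2) := by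
  have key : ∀ v : Fin m → Fin ℓ → K, ∑ j, aeval α (toP (v j)) * w j =
      ∑ p : Fin ℓ × Fin m, v p.2 p.1 • (α ^ (p.1 : ℕ) * w p.2) := by
    intro v
    rw [Fintype.sum_prod_type_right]
    refine Finset.sum_congr rfl fun j _ => ?_
    rw [aeval_toP, Finset.sum_mul]
    simp
  rw [Fintype.linearIndependent_iff]
  constructor
  · intro h g hg p
    have := h (fun j i => g (i, j)) (by rw [key]; exact hg)
    exact congrFun (congrFun this p.2) p.1
  · intro h v hv
    rw [key] at hv
    ext j i
    exact h (fun p => v p.2 p.1) hv (i, j)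

lemma cpoly_root (K : Type) [Field K] [Fintype K] (m ℓ : ℕ) (i : ℕ)
    (hi : 0 < i) (him : i < m) (hℓ : 0 < ℓ) :
    (cpoly K m ℓ).eval ((Fintype.card K : ℚ) ^ (m * (ℓ - 1) + i)) = 0 := by
  obtain ⟨p, hp⟩ := CharP.exists K
  have : Fact p.Prime := ⟨CharP.char_is_prime K p⟩
  set n := m * (ℓ - 1) + i with hn
  have : NeZero n := ⟨by omega⟩
  let E := FiniteField.Extension K p n
  have : Fintype E := Fintype.ofFinite E
  have hfr : finrank K E = n := FiniteField.finrank_extension K p n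
  obtain ⟨α, hα⟩ := Field.exists_primitive_element K E
  have hdeg : (minpoly K α).natDegree = n := by
    refine Eq.trans ?_ hfr
    rw [← IntermediateField.adjoin.finrank (Algebra.IsIntegral.isIntegral α), hα,
      IntermediateField.finrank_top']
  have h := card_good (K := K) (m := m) (ℓ := ℓ) α (by rw [hdeg]; omega)
  have hcard : (Fintype.card E : ℚ) = (Fintype.card K : ℚ) ^ n := by
    rw [Module.card_eq_pow_finrank (K := K) (V := E), hfr]; push_cast; rfl
  rw [hcard] at h
  rw [← h]
  have : IsEmpty {w : Fin m → E // Good K m ℓ α w} := by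
    refine ⟨fun w => ?_⟩
    have h1 := ((good_iff_li m ℓ α w.1).1 w.2).fintype_card_le_finrank
    rw [hfr] at h1
    simp only [Fintype.card_prod, Fintype.card_fin] at h1
    obtain ⟨l, rfl⟩ : ∃ l, ℓ = l + 1 := ⟨ℓ - 1, by omega⟩
    simp only [Nat.add_sub_cancel] at hn
    have : (l + 1) * m = m * l + m := by ring
    omega
  simp

lemma cpoly_eq (K : Type) [Field K] [Fintype K] (m ℓ : ℕ) (hm : 0 < m) (hℓ : 0 < ℓ) :
    cpoly K m ℓ = ∏ i : Fin m, (X - C (if (i : ℕ) = 0 then (1 : ℚ) else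
      (Fintype.card K : ℚ) ^ (m * (ℓ - 1) + i))) := by
  set r : Fin m → ℚ := fun i => if (i : ℕ) = 0 then (1 : ℚ) else
      (Fintype.card K : ℚ) ^ (m * (ℓ - 1) + i) with hr
  have hq : (1 : ℚ) < Fintype.card K := by exact_mod_cast Fintype.one_lt_card
  have hinj : Function.Injective r := by
    intro i j hij
    simp only [hr] at hij
    ext
    split_ifs at hij with h1 h2 h2
    · omega
    · exact absurd hij (one_lt_pow₀ hq (by omega)).ne
    · exact absurd hij (one_lt_pow₀ hq (by omega)).ne'
    · have := pow_right_injective₀ (by linarith) hq.ne' hij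
      omega
  obtain ⟨hmon, hdeg⟩ := cpoly_monic K m ℓ hm
  have hmon2 : (∏ i : Fin m, (X - C (r i))).Monic := monic_prod_of_monic _ _ fun i _ => monic_X_sub_C _
  have hdeg2 : (∏ i : Fin m, (X - C (r i))).degree = (m : WithBot ℕ) := by
    simp [degree_prod]
  have hd1 : (cpoly K m ℓ).degree = (m : WithBot ℕ) := by
    rw [degree_eq_natDegree hmon.ne_zero, hdeg]
  refine Polynomial.eq_of_degree_sub_lt_of_eval_index_eq (v := r) Finset.univ hinj.injOn ?_ ?_
  · rw [Finset.card_univ, Fintype.card_fin, ← hd1]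
    refine degree_sub_lt_left (by rw [hd1, hdeg2]) hmon.ne_zero ?_
    rw [hmon.leadingCoeff, hmon2.leadingCoeff]
  · intro i _
    rw [eval_prod, Finset.prod_eq_zero (Finset.mem_univ i) (by simp [hr])]
    by_cases h : (i : ℕ) = 0
    · simp only [hr, h, if_true]; exact cpoly_one K m ℓ hm hℓ
    · simp only [hr, h, if_false]
      exact cpoly_root K m ℓ i (by omega) i.2 hℓ

/-- The splitting condition. -/
def Spl (K : Type) [Field K] (m ℓ : ℕ) {E : Type} [Field E] [Algebra K E] (α : E)
    (W : Submodule K E) : Prop :=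
  Module.finrank K W = m ∧
    iSupIndep (fun i : Fin ℓ => W.map (LinearMap.mulLeft K (α ^ (i : ℕ)))) ∧
    (⨆ i : Fin ℓ, W.map (LinearMap.mulLeft K (α ^ (i : ℕ)))) = ⊤

lemma map_span {K : Type} [Field K] {m ℓ : ℕ} {E : Type} [Field E] [Algebra K E] (α : E)
    (w : Fin m → E) (i : Fin ℓ) :
    (Submodule.span K (Set.range w)).map (LinearMap.mulLeft K (α ^ (i : ℕ))) =
      Submodule.span K ((fun p : Fin ℓ × Fin m => α ^ (p.1 : ℕ) * w p.2) '' {p | p.1 = i}) := by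
  rw [Submodule.map_span]
  congr 1
  ext x
  constructor
  · rintro ⟨_, ⟨j, rfl⟩, rfl⟩
    exact ⟨(i, j), rfl, rfl⟩
  · rintro ⟨⟨i', j⟩, h, rfl⟩
    cases h
    exact ⟨w j, ⟨j, rfl⟩, rfl⟩

lemma iSup_span {K : Type} [Field K] {m ℓ : ℕ} {E : Type} [Field E] [Algebra K E] (α : E)
    (w : Fin m → E) :
    (⨆ i : Fin ℓ, (Submodule.span K (Set.range w)).map (LinearMap.mulLeft K (α ^ (i : ℕ)))) =
      Submodule.span K (Set.range (fun p : Fin ℓ × Fin m => α ^ (p.1 : ℕ) * w p.2)) := by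
  simp_rw [map_span]
  rw [← Submodule.span_iUnion, ← Set.image_iUnion, ← Set.image_univ]
  congr 2
  ext p
  simp

lemma li_of_good {K : Type} [Field K] {m ℓ : ℕ} (hℓ : 0 < ℓ) {E : Type} [Field E] [Algebra K E]
    (α : E) (w : Fin m → E) (h : Good K m ℓ α w) : LinearIndependent K w := by
  have h1 := (good_iff_li m ℓ α w).1 h
  have h2 := h1.comp (fun j : Fin m => ((⟨0, hℓ⟩ : Fin ℓ), j)) (fun a b hab => by simpa using hab)
  convert h2 using 1
  ext j
  simp

lemma spl_of_good {K : Type} [Field K] {m ℓ : ℕ} (hℓ : 0 < ℓ) {E : Type} [Field E] [Algebra K E]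
    [FiniteDimensional K E] (hE : finrank K E = m * ℓ)
    (α : E) (w : Fin m → E) (h : Good K m ℓ α w) : Spl K m ℓ α (Submodule.span K (Set.range w)) := by
  have h1 := (good_iff_li m ℓ α w).1 h
  refine ⟨?_, ?_, ?_⟩
  · rw [finrank_span_eq_card (li_of_good hℓ α w h), Fintype.card_fin]
  · intro i
    simp_rw [map_span]
    rw [← Submodule.span_iUnion₂, ← Set.image_iUnion₂]
    apply h1.disjoint_span_image
    rw [Set.disjoint_left]
    intro p hp hp2
    simp only [Set.mem_iUnion, Set.mem_ofPred_eq] at hp hp2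
    obtain ⟨j, hj, hpj⟩ := hp2
    exact hj (hpj.symm.trans hp)
  · rw [iSup_span]
    apply h1.span_eq_top_of_card_eq_finrank'
    rw [hE]; simp [mul_comm]

lemma good_of_spl {K : Type} [Field K] {m ℓ : ℕ} {E : Type} [Field E] [Algebra K E]
    [FiniteDimensional K E] (hE : finrank K E = m * ℓ)
    (α : E) (w : Fin m → E) (h : Spl K m ℓ α (Submodule.span K (Set.range w))) :
    Good K m ℓ α w := by
  rw [good_iff_li]
  apply linearIndependent_of_top_le_span_of_card_eq_finrank
  · rw [← iSup_span, h.2.2]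
  · rw [hE]; simp [mul_comm]

lemma span_coe {K : Type} [Field K] {m : ℕ} {E : Type} [Field E] [Algebra K E]
    [FiniteDimensional K E] (W : Submodule K E) (hW : finrank K W = m) (s : Fin m → W)
    (hs : LinearIndependent K s) : Submodule.span K (Set.range fun i => (s i : E)) = W := by
  have h1 := hs.span_eq_top_of_card_eq_finrank' (by rw [hW]; simp)
  have h2 := congrArg (Submodule.map W.subtype) h1
  rw [Submodule.map_span, Submodule.map_subtype_top, ← Set.range_comp] at h2
  exact h2

lemma card_rel {K : Type} [Field K] [Fintype K] {m ℓ : ℕ} (hℓ : 0 < ℓ) {E : Type} [Field E]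
    [Fintype E] [Algebra K E] (hE : finrank K E = m * ℓ) (α : E) :
    Nat.card {w : Fin m → E // Good K m ℓ α w} = Nat.card {W : Submodule K E // Spl K m ℓ α W} *
      ∏ i : Fin m, (Fintype.card K ^ m - Fintype.card K ^ (i : ℕ)) := by
  let f : {w : Fin m → E // Good K m ℓ α w} → {W : Submodule K E // Spl K m ℓ α W} :=
    fun w => ⟨Submodule.span K (Set.range w.1), spl_of_good hℓ hE α w.1 w.2⟩
  have hfib : ∀ W : {W : Submodule K E // Spl K m ℓ α W},
      Nat.card {w // f w = W} = ∏ i : Fin m, (Fintype.card K ^ m - Fintype.card K ^ (i : ℕ)) := by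
    intro W
    have hc := card_linearIndependent (K := K) (V := W.1) (k := m) (by rw [W.2.1])
    rw [W.2.1] at hc
    rw [← hc]
    have hmem : ∀ w : {w // f w = W}, ∀ i, w.1.1 i ∈ W.1 := by
      intro w i
      have h1 := congrArg Subtype.val w.2
      rw [← h1]
      exact Submodule.subset_span ⟨i, rfl⟩
    refine Nat.card_congr
      { toFun := fun w => ⟨fun i => ⟨w.1.1 i, hmem w i⟩, ?_⟩
        invFun := fun s => ⟨⟨fun i => (s.1 i : E), ?_⟩, ?_⟩
        left_inv := fun w => rfl
        right_inv := fun s => rfl }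
    · exact LinearIndependent.of_comp W.1.subtype (li_of_good hℓ α w.1.1 w.1.2)
    · apply good_of_spl hE
      rw [span_coe W.1 W.2.1 s.1 s.2]
      exact W.2
    · exact Subtype.ext (span_coe W.1 W.2.1 s.1 s.2)
  rw [← Nat.card_congr (Equiv.sigmaFiberEquiv f), Nat.card_sigma]
  simp_rw [hfib]
  rw [Finset.sum_const, Finset.card_univ, Nat.card_eq_fintype_card, smul_eq_mul]

end SplitSub

/-- Niederreiter's problem. If `𝔽_{q^{mℓ}} = 𝔽_q(α)`, the number of
`m`-dimensional `𝔽_q`-subspaces `W` with `𝔽_{q^{mℓ}} = W ⊕ αW ⊕ ⋯ ⊕ α^{ℓ-1}W` is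
`q^{(ℓ-1)m(m-1)} (q^{mℓ}-1)/(q^m-1)`. -/
theorem statement9 (q m ℓ : ℕ) (hq : IsPrimePow q) (hm : 0 < m) (hℓ : 0 < ℓ)
    (K : Type) [Field K] [Fintype K] (hK : Fintype.card K = q)
    (E : Type) [Field E] [Fintype E] [Algebra K E] (hE : Fintype.card E = q ^ (m * ℓ))
    (α : E) (hα : Algebra.adjoin K ({α} : Set E) = ⊤) :
    (Nat.card {W : Submodule K E //
        Module.finrank K W = m ∧
        iSupIndep
          (fun i : Fin ℓ => W.map (LinearMap.mulLeft K (α ^ (i : ℕ)))) ∧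
        (⨆ i : Fin ℓ, W.map (LinearMap.mulLeft K (α ^ (i : ℕ)))) = ⊤} : ℚ) =
      (q : ℚ) ^ ((ℓ - 1) * m * (m - 1)) * ((q : ℚ) ^ (m * ℓ) - 1) / ((q : ℚ) ^ m - 1) := by
  classical
  have hfr : finrank K E = m * ℓ := by
    have h1 := Module.card_eq_pow_finrank (K := K) (V := E)
    rw [hE, hK] at h1
    exact (Nat.pow_right_injective hq.two_le h1).symm
  have hdeg : (minpoly K α).natDegree = m * ℓ := by
    rw [← hfr, ← IntermediateField.adjoin.finrank (Algebra.IsIntegral.isIntegral α)]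
    have : IntermediateField.adjoin K ({α} : Set E) = ⊤ := by
      rw [eq_top_iff, ← IntermediateField.toSubalgebra_le_toSubalgebra,
        IntermediateField.top_toSubalgebra, ← hα]
      exact IntermediateField.algebra_adjoin_le_adjoin K _
    rw [this, IntermediateField.finrank_top']
  obtain ⟨l, rfl⟩ : ∃ l, ℓ = l + 1 := ⟨ℓ - 1, by omega⟩
  obtain ⟨k, rfl⟩ : ∃ k, m = k + 1 := ⟨m - 1, by omega⟩
  have h1 := SplitSub.card_good (K := K) (m := k + 1) (ℓ := l + 1) α (by
    rw [hdeg]; exact Nat.mul_lt_mul_of_pos_left (by omega) hm)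
  rw [SplitSub.card_rel hℓ hfr α, SplitSub.cpoly_eq K (k + 1) (l + 1) hm hℓ, hE, hK] at h1
  have hq1 : (1 : ℚ) < q := by exact_mod_cast hq.one_lt
  change (Nat.card {W : Submodule K E // SplitSub.Spl K (k + 1) (l + 1) α W} : ℚ) = _
  generalize (Nat.card {W : Submodule K E // SplitSub.Spl K (k + 1) (l + 1) α W}) = N at h1 ⊢
  have hne : (q : ℚ) ^ (k + 1) - 1 ≠ 0 := by
    have := one_lt_pow₀ hq1 (n := k + 1) (by omega)
    linarith
  have hcast : ((∏ i : Fin (k + 1), (q ^ (k + 1) - q ^ (i : ℕ)) : ℕ) : ℚ) =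
      ∏ i : Fin (k + 1), ((q : ℚ) ^ (k + 1) - (q : ℚ) ^ (i : ℕ)) := by
    rw [Nat.cast_prod]
    refine Finset.prod_congr rfl fun i _ => ?_
    rw [Nat.cast_sub (Nat.pow_le_pow_right hq.pos i.2.le)]
    push_cast; rfl
  rw [Nat.cast_mul, hcast, eval_prod, Fin.prod_univ_succ, Fin.prod_univ_succ] at h1
  simp only [Fin.val_zero, Fin.val_succ, pow_zero, eval_sub, eval_X, eval_C, if_true,
    Nat.add_eq_zero_iff, one_ne_zero, and_false, if_false, Nat.add_sub_cancel, Nat.cast_pow] at h1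
  have hfac : ∀ i : Fin k, (q : ℚ) ^ ((k + 1) * (l + 1)) - (q : ℚ) ^ ((k + 1) * l + ((i : ℕ) + 1)) =
      (q : ℚ) ^ ((k + 1) * l) * ((q : ℚ) ^ (k + 1) - (q : ℚ) ^ ((i : ℕ) + 1)) := by
    intro i
    rw [mul_sub, ← pow_add, ← pow_add]
    ring_nf
  simp_rw [hfac] at h1
  rw [Finset.prod_mul_distrib, Finset.prod_const, Finset.card_univ, Fintype.card_fin,
    ← pow_mul] at h1
  have hP : ∏ i : Fin k, ((q : ℚ) ^ (k + 1) - (q : ℚ) ^ ((i : ℕ) + 1)) ≠ 0 := by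
    refine Finset.prod_ne_zero_iff.2 fun i _ => ?_
    have := pow_lt_pow_right₀ hq1 (show (i : ℕ) + 1 < k + 1 by omega)
    linarith
  rw [eq_div_iff hne]
  apply mul_right_cancel₀ hP
  simp only [Nat.add_sub_cancel]
  rw [mul_assoc, h1, mul_comm l (k + 1)]
  ring
end

section
/- Fix a positive integer n and partitions μ, ν of n. Then there exists a polynomial b_{μν}(t) ∈ ℤ[t] such that for every prime power q and every diagonalizable matrix Δ ∈ M_n(𝔽_q) of type ν, σ(μ,Δ) = (q−1)^{Σ_{j≥2} μ_j} · q^{Σ_{j≥2} C(μ_j,2)} · b_{μν}(q), where C(m,2) = m(m−1)/2. -/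
open Matrix Module Polynomial

attribute [local instance] Classical.propDecidable

/-- `Δ` is diagonalizable of type `ν`: there are distinct eigenvalues, indexed by the
support of `ν`, whose eigenspaces have dimension given by the parts of `ν` and whose sum
is the whole space. -/
def DiagOfType {F : Type} [Field F] {n : ℕ} (Δ : Matrix (Fin n) (Fin n) F)
    (ν : ℕ →₀ ℕ) : Prop :=
  ∃ a : ℕ → F, Set.InjOn a ν.support ∧
    (⨆ i ∈ ν.support, Module.End.eigenspace Δ.mulVecLin (a i)) = ⊤ ∧
    ∀ i ∈ ν.support,
      Module.finrank F (Module.End.eigenspace Δ.mulVecLin (a i)) = ν i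

namespace Prof

/-- weight polynomial: number of ways of extending a rank `r` tuple by `d` vectors of an
`M`-dimensional space so as to get rank `s`. -/
noncomputable def A (M r : ℕ) : ℕ → ℕ → ℤ[X]
  | 0, s => if s = r then 1 else 0
  | d + 1, 0 => A M r d 0
  | d + 1, s + 1 => X ^ (s + 1) * A M r d (s + 1) + X ^ s * (X ^ (M - s) - 1) * A M r d s

lemma A_zero_of_lt (M r : ℕ) : ∀ d s, s < r → A M r d s = 0
  | 0, s, h => by simp [A, h.ne]
  | d + 1, 0, h => by rw [A]; exact A_zero_of_lt M r d 0 h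
  | d + 1, s + 1, h => by
    rw [A, A_zero_of_lt M r d (s + 1) h, A_zero_of_lt M r d s (by omega)]; simp

lemma A_dvd (M r : ℕ) : ∀ d f,
    ((X - 1 : ℤ[X]) ^ f * X ^ (f.choose 2 + r * d)) ∣ A M r d (r + f)
  | 0, f => by
    rw [A]
    split_ifs with h
    · have : f = 0 := by omega
      subst this; simp
    · simp
  | d + 1, 0 => by
    rcases r with _ | r
    · simp
    · have h := A_dvd M (r + 1) d 0
      simp only [add_zero] at h ⊢
      rw [A, A_zero_of_lt M (r + 1) d r (by omega), mul_zero, add_zero]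
      have : (X - 1 : ℤ[X]) ^ 0 * X ^ (Nat.choose 0 2 + (r + 1) * (d + 1)) =
        X ^ (r + 1) * ((X - 1 : ℤ[X]) ^ 0 * X ^ (Nat.choose 0 2 + (r + 1) * d)) := by
        simp; ring
      rw [this]
      exact mul_dvd_mul_left _ h
  | d + 1, f + 1 => by
    have h1 := A_dvd M r d (f + 1)
    have h2 := A_dvd M r d f
    rw [← add_assoc] at h1 ⊢
    rw [A]
    apply dvd_add
    · refine dvd_trans ?_ (mul_dvd_mul_left _ h1)
      refine ⟨X ^ (f + 1), ?_⟩
      ring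
    · obtain ⟨c, hc⟩ : (X - 1 : ℤ[X]) ∣ X ^ (M - (r + f)) - 1 := sub_one_dvd_pow_sub_one _ _
      rw [hc]
      obtain ⟨e, he⟩ := h2
      rw [he]
      refine ⟨c * e, ?_⟩
      rw [Nat.choose_succ_succ' f 1, Nat.choose_one_right]
      ring

set_option linter.unusedSectionVars false
section tuples
variable {F : Type} [Field F] [Fintype F] {G : Type} [AddCommGroup G] [Module F G] [Fintype G]

lemma step_sum (S : Submodule F G) (s : ℕ) :
    (∑ x : G, if finrank F (S ⊔ Submodule.span F {x} : Submodule F G) = s then (1 : ℤ) else 0) =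
      (if finrank F S = s then (Fintype.card F : ℤ) ^ s else 0) +
      (if finrank F S + 1 = s then (Fintype.card F : ℤ) ^ finrank F S *
        ((Fintype.card F : ℤ) ^ (finrank F G - finrank F S) - 1) else 0) := by
  have key : ∀ x : G, finrank F (S ⊔ Submodule.span F {x} : Submodule F G) =
      if x ∈ S then finrank F S else finrank F S + 1 := by
    intro x
    split_ifs with hx
    · rw [sup_eq_left.2]
      simpa using hx
    · have h := Submodule.finrank_sup_add_finrank_inf_eq S (Submodule.span F {x})
      have h0 : x ≠ 0 := by rintro rfl; exact hx S.zero_mem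
      rw [finrank_span_singleton h0] at h
      have h2 : S ⊓ Submodule.span F {x} = ⊥ := by
        rw [← disjoint_iff]
        exact (Submodule.disjoint_span_singleton' h0).2 hx
      rw [h2, finrank_bot] at h
      omega
  have hS : (∑ x : G, if x ∈ S then (1 : ℤ) else 0) = (Fintype.card F : ℤ) ^ finrank F S := by
    rw [Finset.sum_boole, ← Fintype.card_subtype]
    have := Module.card_eq_pow_finrank (K := F) (V := S)
    rw [← Nat.cast_pow, ← this]
  have hG : (∑ x : G, if x ∈ S then (0 : ℤ) else 1) = (Fintype.card F : ℤ) ^ finrank F S *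
        ((Fintype.card F : ℤ) ^ (finrank F G - finrank F S) - 1) := by
    have : (∑ x : G, if x ∈ S then (0 : ℤ) else 1) = ∑ x : G, (1 - if x ∈ S then (1 : ℤ) else 0) :=
      Finset.sum_congr rfl fun x _ => by split_ifs <;> simp
    rw [this, Finset.sum_sub_distrib, hS, mul_sub, ← pow_add,
      Nat.add_sub_cancel' (Submodule.finrank_le S)]
    have := Module.card_eq_pow_finrank (K := F) (V := G)
    simp [this]
  simp_rw [key]
  by_cases h1 : finrank F S = s
  · have : finrank F S + 1 ≠ s := by omega
    rw [if_pos h1, if_neg this, add_zero, ← h1, ← hS]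
    refine Finset.sum_congr rfl fun x _ => ?_
    by_cases hx : x ∈ S <;> simp [hx]
  · by_cases h2 : finrank F S + 1 = s
    · rw [if_neg h1, if_pos h2, zero_add, ← hG, ← h2]
      refine Finset.sum_congr rfl fun x _ => ?_
      by_cases hx : x ∈ S <;> simp [hx]
    · rw [if_neg h1, if_neg h2, add_zero]
      refine Finset.sum_eq_zero fun x _ => ?_
      by_cases hx : x ∈ S <;> simp [hx, h1, h2]

variable (F) in
/-- rank of the first `k` vectors -/
noncomputable def rk {l : ℕ} (g : Fin l → G) (k : ℕ) : ℕ :=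
  finrank F (Submodule.span F (g '' {i | i.val < k}))

variable (F G) in
noncomputable def cnt (k r : ℕ → ℕ) (J l s : ℕ) : ℤ :=
  ∑ g : Fin l → G, if (∀ j ≤ J, rk F g (k j) = r j) ∧ rk F g l = s then 1 else 0

lemma rk_snoc {l : ℕ} (g : Fin l → G) (x : G) {k : ℕ} (hk : k ≤ l) :
    rk F (Fin.snoc (α := fun _ => G) g x) k = rk F g k := by
  unfold rk
  suffices h : Fin.snoc (α := fun _ => G) g x '' {i | i.val < k} = g '' {i | i.val < k} by rw [h]
  ext y
  constructor
  · rintro ⟨i, hi, rfl⟩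
    have hi' : i.val < k := hi
    refine ⟨⟨i, by omega⟩, hi, ?_⟩
    have : i = Fin.castSucc ⟨i, by omega⟩ := rfl
    conv_rhs => rw [this, Fin.snoc_castSucc (α := fun _ => G)]
  · rintro ⟨i, hi, rfl⟩
    exact ⟨i.castSucc, hi, by rw [Fin.snoc_castSucc (α := fun _ => G)]⟩

lemma rk_snoc_last {l : ℕ} (g : Fin l → G) (x : G) :
    rk F (Fin.snoc (α := fun _ => G) g x) (l + 1) =
     finrank F (Submodule.span F (g '' {i | i.val < l}) ⊔ Submodule.span F {x} :
      Submodule F G) := by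
  unfold rk
  rw [← Submodule.span_union]
  have h1 : {i : Fin (l+1) | i.val < l + 1} = Set.univ := by ext i; simp; omega
  have h2 : {i : Fin l | i.val < l} = Set.univ := by ext i; simp
  rw [h1, h2, Set.image_univ, Set.image_univ, Fin.range_snoc,
    Set.union_singleton]

lemma cnt_succ (k r : ℕ → ℕ) (J l : ℕ) (hk : ∀ j ≤ J, k j ≤ l) (s : ℕ) :
    cnt F G k r J (l + 1) s = (Fintype.card F : ℤ) ^ s * cnt F G k r J l s +
      (if s = 0 then 0 else (Fintype.card F : ℤ) ^ (s - 1) *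
        ((Fintype.card F : ℤ) ^ (finrank F G - (s - 1)) - 1) * cnt F G k r J l (s - 1)) := by
  unfold cnt
  rw [← (Fin.snocEquiv (fun _ => G)).sum_comp, Fintype.sum_prod_type_right]
  have h1 : ∀ g : Fin l → G, (∑ x : G, if (∀ j ≤ J, rk F (Fin.snocEquiv (fun _ => G) (x, g)) (k j) = r j) ∧
      rk F (Fin.snocEquiv (fun _ => G) (x, g)) (l + 1) = s then (1 : ℤ) else 0) =
      (Fintype.card F : ℤ) ^ s * (if (∀ j ≤ J, rk F g (k j) = r j) ∧ rk F g l = s then 1 else 0) +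
      (if s = 0 then 0 else (Fintype.card F : ℤ) ^ (s - 1) *
        ((Fintype.card F : ℤ) ^ (finrank F G - (s - 1)) - 1) *
        (if (∀ j ≤ J, rk F g (k j) = r j) ∧ rk F g l = s - 1 then 1 else 0)) := by
    intro g
    have h2 : ∀ x, (∀ j ≤ J, rk F (Fin.snocEquiv (fun _ => G) (x, g)) (k j) = r j) ↔
        (∀ j ≤ J, rk F g (k j) = r j) := by
      intro x
      refine forall₂_congr fun j hj => ?_
      rw [← rk_snoc g x (hk j hj)]; rfl
    have h3 : ∀ x, rk F (Fin.snocEquiv (fun _ => G) (x, g)) (l + 1) = _ := fun x => rk_snoc_last g x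
    simp_rw [h2, h3]
    by_cases hP : ∀ j ≤ J, rk F g (k j) = r j
    · simp only [eq_true hP, true_and]
      rw [step_sum]
      change (if rk F g l = s then _ else _) + (if rk F g l + 1 = s then _ else _) = _
      congr 1
      · simp
      · rcases s with _ | s
        · simp
        · simp only [add_left_inj, Nat.add_eq_zero_iff, one_ne_zero, and_false, if_false,
            Nat.add_sub_cancel, mul_ite, mul_one, mul_zero]
          split_ifs with h
          · rw [show finrank F (Submodule.span F (g '' {i | i.val < l})) = s from h]
          · rfl
    · simp [hP]
  rw [Finset.sum_congr rfl fun g _ => h1 g, Finset.sum_add_distrib, ← Finset.mul_sum]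
  congr 1
  split_ifs
  · simp
  · rw [← Finset.mul_sum]

lemma cnt_add (k r : ℕ → ℕ) (J : ℕ) (hk : ∀ j ≤ J, k j ≤ k J) (d : ℕ) : ∀ s : ℕ,
    cnt F G k r J (k J + d) s = cnt F G k r J (k J) (r J) *
      (A (finrank F G) (r J) d s).eval (Fintype.card F : ℤ) := by
  induction d with
  | zero =>
    intro s
    rw [A]
    split_ifs with h
    · subst h; simp
    · simp only [add_zero, eval_zero, mul_zero]
      refine Finset.sum_eq_zero fun g _ => ?_
      rw [if_neg]
      rintro ⟨h1, h2⟩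
      exact h (by rw [← h2, h1 J le_rfl])
  | succ d ih =>
    intro s
    rw [← add_assoc, cnt_succ k r J _ (fun j hj => (hk j hj).trans (by omega))]
    rcases s with _ | s
    · rw [A, ih]; simp
    · rw [A, ih]; simp [ih]; ring

lemma cnt_eq (k r : ℕ → ℕ) (hk : Monotone k) (hk0 : k 0 = 0) (hr0 : r 0 = 0) (J : ℕ) :
    cnt F G k r J (k J) (r J) = (∏ j ∈ Finset.range J,
      A (finrank F G) (r j) (k (j + 1) - k j) (r (j + 1))).eval (Fintype.card F : ℤ) := by
  induction J with
  | zero =>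
    simp [cnt, hk0, hr0, rk]
  | succ J ih =>
    have h1 : cnt F G k r (J + 1) (k (J + 1)) (r (J + 1)) = cnt F G k r J (k (J + 1)) (r (J + 1)) := by
      unfold cnt
      refine Finset.sum_congr rfl fun g _ => if_congr ?_ rfl rfl
      constructor
      · rintro ⟨a, b⟩
        exact ⟨fun j hj => a j (by omega), b⟩
      · rintro ⟨a, b⟩
        refine ⟨fun j hj => ?_, b⟩
        rcases Nat.lt_or_ge J j with h | h
        · have : j = J + 1 := by omega
          rw [this, b]
        · exact a j h
    have h2 : k (J + 1) = k J + (k (J + 1) - k J) := by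
      have := hk (Nat.le_succ J); simp only [Nat.succ_eq_add_one] at this; omega
    rw [h1, Finset.prod_range_succ, eval_mul, ← ih]
    conv_lhs => rw [h2]
    rw [cnt_add k r J (fun j hj => hk hj)]
end tuples

section homs
variable {F : Type} [Field F] [Fintype F] {G : Type} [AddCommGroup G] [Module F G] [Fintype G]
variable {U : Type} [AddCommGroup U] [Module F U] [Fintype U]

noncomputable instance instFintypeSubmod : Fintype (Submodule F U) := Fintype.ofFinite _
noncomputable instance instFintypeHom : Fintype (U →ₗ[F] G) :=
  @Fintype.ofFinite _ (DFunLike.finite _)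

lemma exists_adapted (K : ℕ → Submodule F U) (hK : Monotone K) (hK0 : K 0 = ⊥) (J : ℕ) :
    ∃ v : ℕ → U, ∀ j ≤ J, K j = Submodule.span F (v '' {i | i < finrank F (K j)}) := by
  induction J with
  | zero =>
    refine ⟨fun _ => 0, fun j hj => ?_⟩
    obtain rfl : j = 0 := by omega
    rw [hK0]
    simp
  | succ J ih =>
    obtain ⟨v, hv⟩ := ih
    have hle : K J ≤ K (J + 1) := hK (Nat.le_succ J)
    obtain ⟨C, hC⟩ := Submodule.exists_isCompl ((K J).comap (K (J+1)).subtype)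
    set C' := C.map (K (J+1)).subtype with hC'
    have hsup : K J ⊔ C' = K (J + 1) := by
      have h1 := congrArg (Submodule.map (K (J+1)).subtype) hC.sup_eq_top
      rw [Submodule.map_sup, Submodule.map_comap_subtype, Submodule.map_top,
        Submodule.range_subtype, inf_eq_right.2 hle] at h1
      exact h1
    have hinf : K J ⊓ C' = ⊥ := by
      rw [← disjoint_iff, Submodule.disjoint_def]
      rintro x hx ⟨y, hy, rfl⟩
      have := Submodule.disjoint_def.1 hC.disjoint y hx hy
      simp [this]
    have hdim : finrank F (K (J+1)) = finrank F (K J) + finrank F C' := by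
      have := Submodule.finrank_sup_add_finrank_inf_eq (K J) C'
      rw [hsup, hinf, finrank_bot] at this
      omega
    let b := Module.finBasis F C'
    let w : ℕ → U := fun i => if i < finrank F (K J) then v i else
      if h : i - finrank F (K J) < finrank F C' then (b ⟨i - finrank F (K J), h⟩ : U) else 0
    have hw : ∀ m ≤ finrank F (K J), w '' {i | i < m} = v '' {i | i < m} := by
      intro m hm
      refine Set.image_congr fun i hi => ?_
      have hi' : i < m := hi
      simp only [w]
      rw [if_pos (by omega)]
    refine ⟨w, fun j hj => ?_⟩
    rcases Nat.lt_or_ge J j with h | h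
    · obtain rfl : j = J + 1 := by omega
      have hb : Submodule.span F (Set.range fun i => (b i : U)) = C' := by
        have := congrArg (Submodule.map C'.subtype) b.span_eq
        rw [Submodule.map_span, Submodule.map_top, Submodule.range_subtype, ← Set.range_comp] at this
        exact this
      have himg : w '' {i | i < finrank F (K (J+1))} =
          v '' {i | i < finrank F (K J)} ∪ Set.range fun i => (b i : U) := by
        ext x
        constructor
        · rintro ⟨i, hi, rfl⟩
          have hi' : i < finrank F (K (J+1)) := hi
          by_cases h1 : i < finrank F (K J)
          · left; exact ⟨i, h1, by simp [w, h1]⟩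
          · right
            have h2 : i - finrank F (K J) < finrank F C' := by omega
            exact ⟨⟨_, h2⟩, by simp [w, h1, h2]⟩
        · rintro (⟨i, hi, rfl⟩ | ⟨i, rfl⟩)
          · have hi' : i < finrank F (K J) := hi
            refine ⟨i, ?_, by simp [w, hi']⟩
            change i < _
            omega
          · refine ⟨i + finrank F (K J), ?_, ?_⟩
            · change i.val + _ < _
              omega
            · simp [w]
      rw [himg, Submodule.span_union, hb, ← hv J le_rfl, hsup]
    · rw [hw _ (Submodule.finrank_mono (hK h))]
      exact hv j h

lemma hom_count (K : ℕ → Submodule F U) (hK : Monotone K) (hK0 : K 0 = ⊥) (N : ℕ) (hN : K N = ⊤)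
    (r : ℕ → ℕ) (hr0 : r 0 = 0) :
    (∑ φ : U →ₗ[F] G, if ∀ j ≤ N, finrank F ((K j).map φ) = r j then (1 : ℤ) else 0) =
    (∏ j ∈ Finset.range N,
      A (finrank F G) (r j) (finrank F (K (j + 1)) - finrank F (K j)) (r (j + 1))).eval
        (Fintype.card F : ℤ) := by
  set k : ℕ → ℕ := fun j => finrank F (K j) with hkdef
  have hk : Monotone k := fun i j h => Submodule.finrank_mono (hK h)
  have hk0 : k 0 = 0 := by simp [hkdef, hK0]
  rw [← cnt_eq (F := F) (G := G) k r hk hk0 hr0 N]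
  obtain ⟨v, hv⟩ := exists_adapted K hK hK0 N
  have hkN : k N = finrank F U := by
    change finrank F (K N) = _
    rw [hN, finrank_top]
  have hkle : ∀ j ≤ N, k j ≤ k N := fun j hj => hk hj
  let vv : Fin (k N) → U := fun i => v i
  have himg : ∀ m ≤ k N, vv '' {i | i.val < m} = v '' {i | i < m} := by
    intro m hm
    ext x
    constructor
    · rintro ⟨i, hi, rfl⟩
      exact ⟨i, hi, rfl⟩
    · rintro ⟨i, hi, rfl⟩
      have hi' : i < m := hi
      exact ⟨⟨i, by omega⟩, hi, rfl⟩
  have htop : ⊤ ≤ Submodule.span F (Set.range vv) := by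
    rw [← Set.image_univ, show (Set.univ : Set (Fin (k N))) = {i | i.val < k N} by ext; simp,
      himg _ le_rfl]
    exact (hN.symm.trans (hv N le_rfl)).le
  let b : Basis (Fin (k N)) F U := basisOfTopLeSpanOfCardEqFinrank vv htop (by simp; exact hkN)
  have hb : ⇑b = vv := by simp [b]
  unfold cnt
  rw [← (b.constr F).toEquiv.sum_comp]
  refine Finset.sum_congr rfl fun g _ => if_congr ?_ rfl rfl
  have hmap : ∀ j ≤ N, finrank F ((K j).map (b.constr F g)) = rk F g (k j) := by
    intro j hj
    have h1 : (K j).map (b.constr F g) = Submodule.span F (g '' {i | i.val < k j}) := by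
      rw [hv j hj, ← himg _ (hkle j hj), Submodule.map_span, ← Set.image_comp]
      congr 1
      refine Set.image_congr fun i _ => ?_
      rw [← hb]
      simp
    rw [h1, rk]
  constructor
  · intro h
    refine ⟨fun j hj => (hmap j hj).symm.trans (h j hj), (hmap N le_rfl).symm.trans (h N le_rfl)⟩
  · rintro ⟨h, _⟩ j hj
    exact (hmap j hj).trans (h j hj)
end homs

section param
variable {F : Type} [Field F] [Fintype F] {V : Type} [AddCommGroup V] [Module F V] [Fintype V]
variable {E : Type} [AddCommGroup E] [Module F E] [Fintype E]

lemma finrank_map_add_inf {A B : Type} [AddCommGroup A] [Module F A] [Fintype A]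
    [AddCommGroup B] [Module F B] (f : A →ₗ[F] B) (X : Submodule F A) :
    finrank F X = finrank F (X.map f) + finrank F (X ⊓ LinearMap.ker f : Submodule F A) := by
  have h := LinearMap.finrank_range_add_finrank_ker (f.comp X.subtype)
  rw [LinearMap.range_comp, Submodule.range_subtype, LinearMap.ker_comp] at h
  rw [← h, ← Submodule.map_comap_subtype, Submodule.finrank_map_subtype_eq]

lemma finrank_prod_decomp (X : Submodule F (V × E)) :
    finrank F X = finrank F (X.map (LinearMap.fst F V E)) +
      finrank F (X.comap (LinearMap.inr F V E)) := by
  rw [finrank_map_add_inf (LinearMap.fst F V E) X, ← LinearMap.range_inr F V E, inf_comm,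
    ← Submodule.map_comap_eq]
  congr 1
  exact (Submodule.equivMapOfInjective _ LinearMap.inr_injective _).finrank_eq.symm

lemma finrank_comap_mkQ (E1 : Submodule F E) (S : Submodule F (E ⧸ E1)) :
    finrank F (S.comap E1.mkQ) = finrank F E1 + finrank F S := by
  rw [finrank_map_add_inf E1.mkQ, Submodule.map_comap_eq_of_surjective E1.mkQ_surjective,
    Submodule.ker_mkQ, inf_eq_right.2, add_comm]
  intro x hx
  have : E1.mkQ x = 0 := by simpa using hx
  rw [Submodule.mem_comap, this]
  exact S.zero_mem

/-- the subspace of `V × E` built from its projection, its intersection with `E`, and a map -/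
def toW (U : Submodule F V) (E1 : Submodule F E) (φ : U →ₗ[F] (E ⧸ E1)) : Submodule F (V × E) where
  carrier := {p | ∃ h : p.1 ∈ U, φ ⟨p.1, h⟩ = E1.mkQ p.2}
  zero_mem' := ⟨U.zero_mem, by
    change φ (0 : U) = E1.mkQ 0
    simp⟩
  add_mem' := by
    rintro p p' ⟨h, e⟩ ⟨h', e'⟩
    refine ⟨U.add_mem h h', ?_⟩
    change φ (⟨p.1, h⟩ + ⟨p'.1, h'⟩) = E1.mkQ (p.2 + p'.2)
    rw [map_add, map_add, e, e']
  smul_mem' := by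
    rintro c p ⟨h, e⟩
    refine ⟨U.smul_mem c h, ?_⟩
    change φ (c • ⟨p.1, h⟩) = E1.mkQ (c • p.2)
    rw [map_smul, map_smul, e]

lemma mem_toW {U : Submodule F V} {E1 : Submodule F E} {φ : U →ₗ[F] (E ⧸ E1)} {p : V × E} :
    p ∈ toW U E1 φ ↔ ∃ h : p.1 ∈ U, φ ⟨p.1, h⟩ = E1.mkQ p.2 := Iff.rfl

lemma map_fst_toW (U : Submodule F V) (E1 : Submodule F E) (φ : U →ₗ[F] (E ⧸ E1)) :
    (toW U E1 φ).map (LinearMap.fst F V E) = U := by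
  ext u
  constructor
  · rintro ⟨p, ⟨h, _⟩, rfl⟩
    exact h
  · intro hu
    obtain ⟨e, he⟩ := E1.mkQ_surjective (φ ⟨u, hu⟩)
    exact ⟨(u, e), ⟨hu, he.symm⟩, rfl⟩

lemma comap_inr_toW_sup (U : Submodule F V) (E1 : Submodule F E) (φ : U →ₗ[F] (E ⧸ E1))
    (Y : Submodule F V) :
    (toW U E1 φ ⊔ Y.map (LinearMap.inl F V E)).comap (LinearMap.inr F V E) =
      ((Y.comap U.subtype).map φ).comap E1.mkQ := by
  ext e
  rw [Submodule.mem_comap, Submodule.mem_sup, Submodule.mem_comap]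
  constructor
  · rintro ⟨⟨u, e'⟩, ⟨hu, hφ⟩, _, ⟨y, hy, rfl⟩, h⟩
    simp only [LinearMap.inl_apply, LinearMap.inr_apply, Prod.mk_add_mk, add_zero,
      Prod.mk.injEq] at h
    obtain ⟨h1, rfl⟩ := h
    refine ⟨⟨u, hu⟩, ?_, hφ⟩
    change u ∈ Y
    rw [eq_neg_of_add_eq_zero_left h1]
    exact Y.neg_mem hy
  · rintro ⟨⟨u, hu⟩, hy, h⟩
    refine ⟨(u, e), ⟨hu, h⟩, _, ⟨-u, Y.neg_mem hy, rfl⟩, ?_⟩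
    simp

lemma comap_inr_toW (U : Submodule F V) (E1 : Submodule F E) (φ : U →ₗ[F] (E ⧸ E1)) :
    (toW U E1 φ).comap (LinearMap.inr F V E) = E1 := by
  have h := comap_inr_toW_sup U E1 φ ⊥
  rw [Submodule.map_bot, sup_bot_eq] at h
  rw [h, Submodule.comap_bot, Submodule.ker_subtype, Submodule.map_bot, Submodule.comap_bot,
    Submodule.ker_mkQ]

lemma toW_bij : Function.Bijective
    (fun x : (Σ U : Submodule F V, Σ E1 : Submodule F E, U →ₗ[F] (E ⧸ E1)) =>
      toW x.1 x.2.1 x.2.2) := by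
  constructor
  · rintro ⟨U, E1, φ⟩ ⟨U', E1', φ'⟩ h
    simp only at h
    obtain rfl : U = U' := by rw [← map_fst_toW U E1 φ, h, map_fst_toW]
    obtain rfl : E1 = E1' := by rw [← comap_inr_toW U E1 φ, h, comap_inr_toW]
    obtain rfl : φ = φ' := by
      ext ⟨u, hu⟩
      obtain ⟨e, he⟩ := E1.mkQ_surjective (φ ⟨u, hu⟩)
      have h1 : (u, e) ∈ toW U E1 φ := ⟨hu, he.symm⟩
      rw [h] at h1
      obtain ⟨_, h2⟩ := h1
      rw [← he, h2]
    rfl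
  · intro W
    let E1 := W.comap (LinearMap.inr F V E)
    let g : V × E →ₗ[F] V × (E ⧸ E1) := LinearMap.prodMap LinearMap.id E1.mkQ
    let W' := W.map g
    have hW' : ∀ x ∈ W', x.1 = 0 → x.2 = 0 := by
      rintro _ ⟨⟨v, e⟩, hp, rfl⟩ h0
      have h0' : v = 0 := h0
      subst h0'
      change E1.mkQ e = 0
      rw [← LinearMap.mem_ker, Submodule.ker_mkQ]
      exact hp
    let L := W'.toLinearPMap
    have hL : L.graph = W' := Submodule.toLinearPMap_graph_eq _ hW'
    have hg : W'.comap g = W := by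
      rw [Submodule.comap_map_eq, sup_eq_left]
      rintro ⟨v, e⟩ h
      have h' : (v, E1.mkQ e) = (0 : V × (E ⧸ E1)) := h
      simp only [Prod.mk_eq_zero] at h'
      obtain ⟨rfl, h2⟩ := h'
      rw [← LinearMap.mem_ker, Submodule.ker_mkQ] at h2
      exact h2
    refine ⟨⟨L.domain, E1, L.toFun⟩, ?_⟩
    rw [← hg, ← hL]
    ext ⟨v, e⟩
    rw [mem_toW, Submodule.mem_comap, LinearPMap.mem_graph_iff]
    constructor
    · rintro ⟨h, h2⟩
      exact ⟨⟨v, h⟩, rfl, h2⟩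
    · rintro ⟨⟨y, hy⟩, h1, h2⟩
      have h1' : y = v := h1
      subst h1'
      exact ⟨hy, h2⟩

noncomputable instance instFintypeQuot (E1 : Submodule F E) : Fintype (E ⧸ E1) := Fintype.ofFinite _

lemma sum_submodule_prod (f : Submodule F (V × E) → ℤ) :
    ∑ W, f W = ∑ U : Submodule F V, ∑ E1 : Submodule F E, ∑ φ : U →ₗ[F] (E ⧸ E1),
      f (toW U E1 φ) := by
  rw [← (Equiv.ofBijective _ (toW_bij (F := F) (V := V) (E := E))).sum_comp, Fintype.sum_sigma]
  refine Finset.sum_congr rfl fun U _ => ?_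
  rw [Fintype.sum_sigma]
  rfl

/-- `W + TW + ... + T^{j-1}W`. -/
def IS (T : V →ₗ[F] V) (W : Submodule F V) : ℕ → Submodule F V
  | 0 => ⊥
  | j + 1 => W ⊔ (IS T W j).map T

lemma IS_mono (T : V →ₗ[F] V) (W : Submodule F V) : Monotone (IS T W) := by
  refine monotone_nat_of_le_succ fun j => ?_
  induction j with
  | zero => exact bot_le
  | succ j ih => exact sup_le_sup_left (Submodule.map_mono ih) _

lemma map_fst_IS (T : V →ₗ[F] V) (W : Submodule F (V × E)) (j : ℕ) :
    (IS (T.prodMap (0 : E →ₗ[F] E)) W j).map (LinearMap.fst F V E) =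
      IS T (W.map (LinearMap.fst F V E)) j := by
  induction j with
  | zero => simp [IS]
  | succ j ih =>
    rw [IS, IS, Submodule.map_sup, ← ih, ← Submodule.map_comp, ← Submodule.map_comp]
    rfl

lemma finrank_IS_toW (T : V →ₗ[F] V) (U : Submodule F V) (E1 : Submodule F E)
    (φ : U →ₗ[F] (E ⧸ E1)) (j : ℕ) :
    finrank F (IS (T.prodMap (0 : E →ₗ[F] E)) (toW U E1 φ) (j + 1)) =
      finrank F (IS T U (j + 1)) + (finrank F E1 +
        finrank F ((((IS T U j).map T).comap U.subtype).map φ)) := by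
  rw [finrank_prod_decomp, map_fst_IS, map_fst_toW, ← finrank_comap_mkQ, ← comap_inr_toW_sup, IS]
  have h : (IS (T.prodMap (0 : E →ₗ[F] E)) (toW U E1 φ) j).map (T.prodMap (0 : E →ₗ[F] E)) =
      ((IS T U j).map T).map (LinearMap.inl F V E) := by
    conv_rhs => rw [← map_fst_toW U E1 φ]
    rw [← map_fst_IS, ← Submodule.map_comp, ← Submodule.map_comp]
    rfl
  rw [IS, h]
end param

section key
variable {F : Type} [Field F] [Fintype F] {V : Type} [AddCommGroup V] [Module F V] [Fintype V]
variable {E : Type} [AddCommGroup E] [Module F E] [Fintype E]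

lemma sum_equiv_submodule {V' : Type} [AddCommGroup V'] [Module F V'] [Fintype V']
    (e : V ≃ₗ[F] V') (f : Submodule F V' → ℤ) :
    ∑ W : Submodule F V, f (W.map e.toLinearMap) = ∑ W' : Submodule F V', f W' :=
  (Submodule.orderIsoMapComap e).toEquiv.sum_comp f

lemma sum_hom_one (U : Submodule F V) (E1 : Submodule F E) :
    (∑ _φ : U →ₗ[F] (E ⧸ E1), (1 : ℤ)) =
      (Fintype.card F : ℤ) ^ (finrank F U * (finrank F E - finrank F E1)) := by
  have h1 := Module.card_eq_pow_finrank (K := F) (V := U →ₗ[F] (E ⧸ E1))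
  rw [Module.finrank_linearMap] at h1
  have h2 := Submodule.finrank_quotient_add_finrank E1
  rw [Finset.sum_const, Finset.card_univ, h1, ← h2]
  simp

lemma finrank_toW (U : Submodule F V) (E1 : Submodule F E) (φ : U →ₗ[F] (E ⧸ E1)) :
    finrank F (toW U E1 φ) = finrank F U + finrank F E1 := by
  rw [finrank_prod_decomp, map_fst_toW, comap_inr_toW]

lemma grass (m : ℕ) : ∀ (E : Type) [AddCommGroup E] [Module F E] [Fintype E], finrank F E = m →
    ∀ e : ℕ, (∑ E1 : Submodule F E, if finrank F E1 = e then (1 : ℤ) else 0) =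
      (qbp m e).eval (Fintype.card F : ℤ) := by
  induction m with
  | zero =>
    intro E _ _ _ hE e
    have hsub : ∀ E1 : Submodule F E, E1 = ⊥ := fun E1 => by
      rw [← Submodule.finrank_eq_zero (R := F)]
      have := Submodule.finrank_le E1
      omega
    have huniv : (Finset.univ : Finset (Submodule F E)) = {⊥} := by
      ext E1; simp [hsub E1]
    rw [huniv, Finset.sum_singleton, finrank_bot]
    rcases e with _ | e <;> simp [qbp]
  | succ m ih =>
    intro E _ _ _ hE e
    have hfr : finrank F E = finrank F ((Fin m → F) × F) := by simp [hE]
    have eq := LinearEquiv.ofFinrankEq E ((Fin m → F) × F) hfr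
    have h1 := sum_equiv_submodule eq (fun W => if finrank F W = e then (1 : ℤ) else 0)
    have h2 : ∀ W : Submodule F E, finrank F (W.map eq.toLinearMap) = finrank F W :=
      fun W => (Submodule.equivMapOfInjective _ eq.injective W).finrank_eq.symm
    simp only [h2] at h1
    rw [h1, sum_submodule_prod]
    have huniv : (Finset.univ : Finset (Submodule F F)) = {⊥, ⊤} := by
      ext E1
      rw [Finset.mem_insert, Finset.mem_singleton]
      exact iff_of_true (Finset.mem_univ _) (Ideal.eq_bot_or_top E1)
    have h3 : ∀ U : Submodule F (Fin m → F),
      (∑ E1 : Submodule F F, ∑ φ : U →ₗ[F] (F ⧸ E1),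
        if finrank F (toW U E1 φ) = e then (1 : ℤ) else 0) =
        (Fintype.card F : ℤ) ^ e * (if finrank F U = e then (1 : ℤ) else 0) +
        (if finrank F U + 1 = e then (1 : ℤ) else 0) := by
      intro U
      have h4 : ∀ E1 : Submodule F F, (∑ φ : U →ₗ[F] (F ⧸ E1),
        if finrank F (toW U E1 φ) = e then (1 : ℤ) else 0) =
        if finrank F U + finrank F E1 = e then
          (Fintype.card F : ℤ) ^ (finrank F U * (finrank F F - finrank F E1)) else 0 := by
        intro E1
        simp_rw [finrank_toW]
        split_ifs
        · exact sum_hom_one U E1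
        · simp
      simp_rw [h4]
      rw [huniv, Finset.sum_pair bot_ne_top]
      simp only [finrank_bot, finrank_top, finrank_self, add_zero, Nat.sub_zero, mul_one,
        Nat.sub_self, mul_zero, pow_zero, mul_ite]
      congr 1
      split_ifs with h
      · rw [h]
      · rfl
    rw [Finset.sum_congr rfl fun U _ => h3 U, Finset.sum_add_distrib, ← Finset.mul_sum]
    rw [ih (Fin m → F) (by simp)]
    rcases e with _ | e
    · cases m <;> simp [qbp]
    · simp only [Nat.add_right_cancel_iff]
      rw [ih (Fin m → F) (by simp), qbp]
      simp only [eval_add, eval_mul, eval_pow, eval_X]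
      ring

/-- profile -/
def prof (T : V →ₗ[F] V) (μ : ℕ →₀ ℕ) (W : Submodule F V) : Prop :=
  ∀ j, finrank F (IS T W (j + 1)) = ∑ i ∈ Finset.range (j + 1), μ i

noncomputable def sig (μ : ℕ →₀ ℕ) (T : V →ₗ[F] V) : ℤ :=
  ∑ W : Submodule F V, if prof T μ W then 1 else 0

/-- partial sums of `f` omitting the first entry -/
def rr (f : ℕ →₀ ℕ) (j : ℕ) : ℕ := ∑ i ∈ Finset.range j, f (i + 1)

noncomputable def NN (m N : ℕ) (l f : ℕ →₀ ℕ) : ℤ[X] :=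
  qbp m (f 0) * ∏ j ∈ Finset.range N, A (m - f 0) (rr f j) (l j - l (j + 1)) (rr f (j + 1))

lemma prof_IS {T : V →ₗ[F] V} {μ : ℕ →₀ ℕ} {W : Submodule F V} (h : prof T μ W) (j : ℕ) :
    finrank F (IS T W j) = ∑ i ∈ Finset.range j, μ i := by
  rcases j with _ | j
  · rw [Finset.range_zero, Finset.sum_empty]
    exact finrank_bot F V
  · exact h j

lemma prof_unique {T : V →ₗ[F] V} {μ μ' : ℕ →₀ ℕ} {W : Submodule F V} (h : prof T μ W)
    (h' : prof T μ' W) : μ = μ' := by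
  ext j
  have h1 := prof_IS h j
  have h2 := prof_IS h (j + 1)
  have h3 := prof_IS h' j
  have h4 := prof_IS h' (j + 1)
  rw [Finset.sum_range_succ] at h2 h4
  omega

/-- the flag in `U` -/
def KK (T : V →ₗ[F] V) (U : Submodule F V) (j : ℕ) : Submodule F U :=
  ((IS T U j).map T).comap U.subtype

lemma KK_mono (T : V →ₗ[F] V) (U : Submodule F V) : Monotone (KK T U) :=
  fun _ _ h => Submodule.comap_mono (Submodule.map_mono (IS_mono T U h))

lemma KK_zero (T : V →ₗ[F] V) (U : Submodule F V) : KK T U 0 = ⊥ := by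
  simp [KK, IS]

lemma IS_one (T : V →ₗ[F] V) (U : Submodule F V) : IS T U 1 = U := by
  simp [IS]

lemma finrank_KK (T : V →ₗ[F] V) (hT : Function.Injective T) (U : Submodule F V) (l : ℕ →₀ ℕ)
    (h : prof T l U) (j : ℕ) : finrank F (KK T U j) + l j = l 0 := by
  have h1 := Submodule.finrank_sup_add_finrank_inf_eq U ((IS T U j).map T)
  have h2 : finrank F (KK T U j) = finrank F (U ⊓ (IS T U j).map T : Submodule F V) := by
    rw [KK, ← Submodule.finrank_map_subtype_eq, Submodule.map_comap_subtype]
  have h3 : finrank F ((IS T U j).map T) = finrank F (IS T U j) :=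
    (Submodule.equivMapOfInjective _ hT _).finrank_eq.symm
  have h4 := prof_IS h (j + 1)
  have h5 := prof_IS h j
  have h6 := prof_IS h 1
  rw [IS_one] at h6
  rw [IS, Finset.sum_range_succ] at h4
  simp only [Finset.range_one, Finset.sum_singleton] at h6
  omega

lemma rr_const (f : ℕ →₀ ℕ) (N : ℕ) (hf : ∀ j, N ≤ j → f j = 0) (j : ℕ) (hj : N ≤ j) :
    rr f j = rr f N := by
  induction j, hj using Nat.le_induction with
  | base => rfl
  | succ j hj ih =>
    rw [← ih, rr, rr, Finset.sum_range_succ, hf (j + 1) (by omega), add_zero]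

lemma prof_toW_iff (T : V →ₗ[F] V) (hT : Function.Injective T) (N : ℕ) (l f : ℕ →₀ ℕ)
    (hl : ∀ j, N ≤ j → l j = 0) (hf : ∀ j, N ≤ j → f j = 0)
    (U : Submodule F V) (hU : prof T l U) (E1 : Submodule F E) (φ : U →ₗ[F] (E ⧸ E1)) :
    prof (T.prodMap (0 : E →ₗ[F] E)) (l + f) (toW U E1 φ) ↔
      finrank F E1 = f 0 ∧ ∀ j ≤ N, finrank F ((KK T U j).map φ) = rr f j := by
  have key : ∀ j, (finrank F (IS (T.prodMap (0 : E →ₗ[F] E)) (toW U E1 φ) (j + 1)) =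
      ∑ i ∈ Finset.range (j + 1), (l + f) i) ↔
      finrank F E1 + finrank F ((KK T U j).map φ) = f 0 + rr f j := by
    intro j
    have h1 : ∑ i ∈ Finset.range (j + 1), (l + f) i =
        ∑ i ∈ Finset.range (j + 1), l i + (rr f j + f 0) := by
      simp only [Finsupp.add_apply, Finset.sum_add_distrib]
      rw [Finset.sum_range_succ' (fun i => f i)]
      rfl
    rw [finrank_IS_toW, hU j, h1, KK]
    omega
  have h0 : finrank F ((KK T U 0).map φ) = 0 := by
    rw [KK_zero, Submodule.map_bot, finrank_bot]
  have hr0 : rr f 0 = 0 := by simp [rr]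
  constructor
  · intro h
    have h1 := (key 0).1 (h 0)
    refine ⟨by omega, fun j _ => ?_⟩
    have h2 := (key j).1 (h j)
    omega
  · rintro ⟨h1, h2⟩ j
    rw [key, h1]
    congr 1
    rcases Nat.le_total j N with h | h
    · exact h2 j h
    · rw [rr_const f N hf j h, ← h2 N le_rfl]
      have : KK T U j = KK T U N := by
        refine (Submodule.eq_of_le_of_finrank_eq (KK_mono T U h) ?_).symm
        have h3 := finrank_KK T hT U l hU j
        have h4 := finrank_KK T hT U l hU N
        rw [hl j h] at h3
        rw [hl N le_rfl] at h4
        omega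
      rw [this]

lemma fiber_count (T : V →ₗ[F] V) (hT : Function.Injective T) (N : ℕ) (l f : ℕ →₀ ℕ)
    (hl : ∀ j, N ≤ j → l j = 0) (hf : ∀ j, N ≤ j → f j = 0)
    (U : Submodule F V) (hU : prof T l U) :
    (∑ E1 : Submodule F E, ∑ φ : U →ₗ[F] (E ⧸ E1),
      if prof (T.prodMap (0 : E →ₗ[F] E)) (l + f) (toW U E1 φ) then (1 : ℤ) else 0) =
    (NN (finrank F E) N l f).eval (Fintype.card F : ℤ) := by
  simp_rw [prof_toW_iff T hT N l f hl hf U hU]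
  have htop : KK T U N = ⊤ := by
    apply Submodule.eq_top_of_finrank_eq
    have h4 := finrank_KK T hT U l hU N
    have h6 := prof_IS hU 1
    rw [IS_one] at h6
    simp only [Finset.range_one, Finset.sum_singleton] at h6
    rw [hl N le_rfl] at h4
    omega
  have h1 : ∀ E1 : Submodule F E, (∑ φ : U →ₗ[F] (E ⧸ E1),
      if finrank F E1 = f 0 ∧ ∀ j ≤ N, finrank F ((KK T U j).map φ) = rr f j
        then (1 : ℤ) else 0) =
      (if finrank F E1 = f 0 then (1 : ℤ) else 0) * (∏ j ∈ Finset.range N,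
        A (finrank F E - f 0) (rr f j) (l j - l (j + 1)) (rr f (j + 1))).eval
          (Fintype.card F : ℤ) := by
    intro E1
    by_cases h : finrank F E1 = f 0
    · simp only [h, true_and, if_true, one_mul]
      rw [hom_count (KK T U) (KK_mono T U) (KK_zero T U) N htop (rr f) (by simp [rr])]
      congr 1
      refine Finset.prod_congr rfl fun j _ => ?_
      have h2 := Submodule.finrank_quotient_add_finrank E1
      have h3 := finrank_KK T hT U l hU j
      have h4 := finrank_KK T hT U l hU (j + 1)
      congr 1
      · omega
      · omega
    · simp [h]
  rw [Finset.sum_congr rfl fun E1 _ => h1 E1, ← Finset.sum_mul, grass _ E rfl, NN, eval_mul]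

lemma exists_prof (T : V →ₗ[F] V) (μ : ℕ →₀ ℕ)
    (U : Submodule F V) (E1 : Submodule F E) (φ : U →ₗ[F] (E ⧸ E1))
    (h : prof (T.prodMap (0 : E →ₗ[F] E)) μ (toW U E1 φ)) :
    ∃ l f : ℕ →₀ ℕ, l + f = μ ∧ prof T l U := by
  let d : ℕ → ℕ := fun j => finrank F (IS T U (j + 1)) - finrank F (IS T U j)
  have hIS : ∀ j, finrank F (IS T U j) ≤ finrank F (IS T U (j + 1)) :=
    fun j => Submodule.finrank_mono (IS_mono T U (Nat.le_succ j))
  have hsum : ∀ j, finrank F (IS T U j) = ∑ i ∈ Finset.range j, d i := by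
    intro j
    induction j with
    | zero =>
      rw [Finset.range_zero, Finset.sum_empty]
      exact finrank_bot F V
    | succ j ih =>
      rw [Finset.sum_range_succ, ← ih]
      have := hIS j
      simp only [d]
      omega
  have hd : ∀ j, d j ≤ μ j := by
    intro j
    have h1 := h j
    rw [finrank_IS_toW] at h1
    rcases j with _ | j
    · simp only [zero_add, Finset.range_one, Finset.sum_singleton] at h1
      simp only [d, zero_add]
      omega
    · have h2 := h j
      rw [finrank_IS_toW] at h2
      rw [Finset.sum_range_succ] at h1
      have h3 : finrank F ((KK T U j).map φ) ≤ finrank F ((KK T U (j + 1)).map φ) :=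
        Submodule.finrank_mono (Submodule.map_mono (KK_mono T U (Nat.le_succ j)))
      unfold KK at h3
      simp only [d]
      omega
  let l : ℕ →₀ ℕ := Finsupp.onFinset μ.support d (fun j hj => by
    have := hd j
    rw [Finsupp.mem_support_iff]
    omega)
  have hl : ∀ j, l j = d j := fun j => rfl
  refine ⟨l, μ - l, ?_, ?_⟩
  · ext j
    have := hd j
    simp only [Finsupp.add_apply, Finsupp.tsub_apply, hl]
    omega
  · intro j
    rw [hsum]
    rfl

lemma sig_rec (T : V →ₗ[F] V) (hT : Function.Injective T) (N : ℕ) (μ : ℕ →₀ ℕ)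
    (hμ : ∀ j, N ≤ j → μ j = 0) :
    sig μ (T.prodMap (0 : E →ₗ[F] E)) = ∑ p ∈ Finset.HasAntidiagonal.antidiagonal μ,
      sig p.1 T * (NN (finrank F E) N p.1 p.2).eval (Fintype.card F : ℤ) := by
  have hzero : ∀ p ∈ Finset.HasAntidiagonal.antidiagonal μ, ∀ j, N ≤ j → p.1 j = 0 ∧ p.2 j = 0 := by
    intro p hp j hj
    have h1 := hμ j hj
    rw [← Finset.HasAntidiagonal.mem_antidiagonal.1 hp, Finsupp.add_apply] at h1
    omega
  have hU : ∀ U : Submodule F V, (∑ E1 : Submodule F E, ∑ φ : U →ₗ[F] (E ⧸ E1),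
      if prof (T.prodMap (0 : E →ₗ[F] E)) μ (toW U E1 φ) then (1 : ℤ) else 0) =
      ∑ p ∈ Finset.HasAntidiagonal.antidiagonal μ, (if prof T p.1 U then (1 : ℤ) else 0) *
        (NN (finrank F E) N p.1 p.2).eval (Fintype.card F : ℤ) := by
    intro U
    by_cases h : ∃ p ∈ Finset.HasAntidiagonal.antidiagonal μ, prof T p.1 U
    · obtain ⟨p, hp, hpU⟩ := h
      rw [Finset.sum_eq_single p, if_pos hpU, one_mul,
        ← fiber_count T hT N p.1 p.2 (fun j hj => (hzero p hp j hj).1)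
          (fun j hj => (hzero p hp j hj).2) U hpU, Finset.HasAntidiagonal.mem_antidiagonal.1 hp]
      · intro p' hp' hne
        rw [if_neg, zero_mul]
        intro h'
        apply hne
        have e1 := prof_unique h' hpU
        have e2 := (Finset.HasAntidiagonal.mem_antidiagonal.1 hp').trans (Finset.HasAntidiagonal.mem_antidiagonal.1 hp).symm
        rw [e1] at e2
        exact Prod.ext e1 (add_left_cancel e2)
      · intro h; exact absurd hp h
    · rw [Finset.sum_eq_zero, Finset.sum_eq_zero]
      · intro p hp
        rw [if_neg (fun h' => h ⟨p, hp, h'⟩), zero_mul]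
      · intro E1 _
        refine Finset.sum_eq_zero fun φ _ => if_neg fun h' => h ?_
        obtain ⟨l, f, e, hl⟩ := exists_prof T μ U E1 φ h'
        exact ⟨(l, f), Finset.HasAntidiagonal.mem_antidiagonal.2 e, hl⟩
  rw [sig, sum_submodule_prod, Finset.sum_congr rfl fun U _ => hU U, Finset.sum_comm]
  refine Finset.sum_congr rfl fun p _ => ?_
  rw [sig, Finset.sum_mul]

end key

section divis

lemma abel_ineq (l f : ℕ →₀ ℕ) (N : ℕ) :
    ∑ j ∈ Finset.range N, l (j + 1) * f (j + 1) ≤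
      ∑ j ∈ Finset.range N, rr f j * (l j - l (j + 1)) + rr f N * l N := by
  induction N with
  | zero => simp
  | succ N ih =>
    rw [Finset.sum_range_succ, Finset.sum_range_succ]
    have h1 : rr f (N + 1) = rr f N + f (N + 1) := by rw [rr, Finset.sum_range_succ]; rfl
    have h2 : rr f N * l N ≤ rr f N * (l N - l (N + 1)) + rr f N * l (N + 1) := by
      rw [← mul_add]
      exact Nat.mul_le_mul_left _ (by omega)
    rw [h1, add_mul]
    have h3 := mul_comm (f (N + 1)) (l (N + 1))
    omega

/-- the required divisor -/
noncomputable def ww (N : ℕ) (μ : ℕ →₀ ℕ) : ℤ[X] :=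
  (X - 1) ^ (∑ j ∈ Finset.range N, μ (j + 1)) *
    X ^ (∑ j ∈ Finset.range N, (μ (j + 1)).choose 2)

lemma NN_dvd (m N : ℕ) (l f : ℕ →₀ ℕ) :
    ((X - 1 : ℤ[X]) ^ (∑ j ∈ Finset.range N, f (j + 1)) *
      X ^ (∑ j ∈ Finset.range N, ((f (j + 1)).choose 2 + rr f j * (l j - l (j + 1))))) ∣
      NN m N l f := by
  rw [NN, ← Finset.prod_pow_eq_pow_sum, ← Finset.prod_pow_eq_pow_sum, ← Finset.prod_mul_distrib]
  refine Dvd.dvd.mul_left (Finset.prod_dvd_prod_of_dvd _ _ fun j _ => ?_) _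
  have h1 : rr f (j + 1) = rr f j + f (j + 1) := by rw [rr, Finset.sum_range_succ]; rfl
  rw [h1]
  exact A_dvd _ _ _ _

lemma choose_add_two (a b : ℕ) : (a + b).choose 2 = a.choose 2 + b.choose 2 + a * b := by
  induction b with
  | zero => simp
  | succ b ih =>
    rw [← add_assoc, Nat.choose_succ_succ' (a + b) 1, Nat.choose_succ_succ' b 1, ih]
    simp only [Nat.choose_one_right]
    ring

lemma ww_dvd (m N : ℕ) (l f : ℕ →₀ ℕ) (hl : l N = 0) (P : ℤ[X]) (hP : ww N l ∣ P) :
    ww N (l + f) ∣ P * NN m N l f := by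
  refine dvd_trans ?_ (mul_dvd_mul hP (NN_dvd m N l f))
  have h1 := abel_ineq l f N
  rw [hl, mul_zero, add_zero] at h1
  have h2 : ∑ j ∈ Finset.range N, ((l + f) (j + 1)).choose 2 ≤
      ∑ j ∈ Finset.range N, (l (j + 1)).choose 2 +
      ∑ j ∈ Finset.range N, ((f (j + 1)).choose 2 + rr f j * (l j - l (j + 1))) := by
    simp only [Finsupp.add_apply, choose_add_two, Finset.sum_add_distrib]
    omega
  have h3 : ∑ j ∈ Finset.range N, (l + f) (j + 1) =
      ∑ j ∈ Finset.range N, l (j + 1) + ∑ j ∈ Finset.range N, f (j + 1) := by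
    simp only [Finsupp.add_apply, Finset.sum_add_distrib]
  rw [ww, ww, h3, mul_mul_mul_comm, ← pow_add, ← pow_add]
  exact mul_dvd_mul_left _ (pow_dvd_pow _ h2)
end divis

section induct
variable {F : Type} [Field F] [Fintype F] {V : Type} [AddCommGroup V] [Module F V] [Fintype V]

lemma sig_conj {V2 : Type} [AddCommGroup V2] [Module F V2] [Fintype V2] (e : V ≃ₗ[F] V2)
    (T : V →ₗ[F] V) (T2 : V2 →ₗ[F] V2) (h : ∀ x, e (T x) = T2 (e x)) (μ : ℕ →₀ ℕ) :
    sig μ T = sig μ T2 := by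
  rw [sig, sig, ← sum_equiv_submodule e]
  refine Finset.sum_congr rfl fun W _ => if_congr (forall_congr' fun j => ?_) rfl rfl
  have h1 : ∀ j, IS T2 (W.map e.toLinearMap) j = (IS T W j).map e.toLinearMap := by
    intro j
    induction j with
    | zero => simp [IS]
    | succ j ih =>
      rw [IS, IS, Submodule.map_sup, ih, ← Submodule.map_comp, ← Submodule.map_comp]
      congr 2
      ext x
      exact (h x).symm
  rw [h1, ← (Submodule.equivMapOfInjective e.toLinearMap e.injective (IS T W (j + 1))).finrank_eq]

lemma IS_shift_le (T : V →ₗ[F] V) (c : F) (W : Submodule F V) (j : ℕ) :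
    IS (T - c • LinearMap.id) W j ≤ IS T W j := by
  induction j with
  | zero => exact le_rfl
  | succ j ih =>
    rw [IS]
    refine sup_le (by rw [IS]; exact le_sup_left) ?_
    rintro _ ⟨x, hx, rfl⟩
    have hx' := ih hx
    have h1 : T x ∈ IS T W (j + 1) := by
      rw [IS]
      exact Submodule.mem_sup_right (Submodule.mem_map_of_mem hx')
    have h2 : x ∈ IS T W (j + 1) := IS_mono T W (Nat.le_succ j) hx'
    simpa using Submodule.sub_mem _ h1 (Submodule.smul_mem _ c h2)

lemma IS_shift (T : V →ₗ[F] V) (c : F) (W : Submodule F V) (j : ℕ) :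
    IS (T - c • LinearMap.id) W j = IS T W j := by
  refine le_antisymm (IS_shift_le T c W j) ?_
  have h := IS_shift_le (T - c • LinearMap.id) (-c) W j
  have e : T - c • LinearMap.id - (-c) • LinearMap.id = T := by
    rw [neg_smul]; abel
  rwa [e] at h

lemma sig_shift (T : V →ₗ[F] V) (c : F) (μ : ℕ →₀ ℕ) :
    sig μ (T - c • LinearMap.id) = sig μ T := by
  unfold sig
  refine Finset.sum_congr rfl fun W _ => if_congr (forall_congr' fun j => ?_) rfl rfl
  rw [IS_shift]

/-- diagonalizable of type given by `ν` on `s` -/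
def DT (s : Finset ℕ) (ν : ℕ →₀ ℕ) (T : V →ₗ[F] V) : Prop :=
  ∃ a : ℕ → F, Set.InjOn a s ∧
    (⨆ i ∈ s, Module.End.eigenspace T (a i)) = ⊤ ∧
    ∀ i ∈ s, finrank F (Module.End.eigenspace T (a i)) = ν i

lemma DT_insert (i0 : ℕ) (s : Finset ℕ) (hi0 : i0 ∉ s) (ν : ℕ →₀ ℕ) (T : V →ₗ[F] V)
    (h : DT (insert i0 s) ν T) : ∃ (V' E : Submodule F V) (T' S : V' →ₗ[F] V'), DT s ν T' ∧
      finrank F E = ν i0 ∧ Function.Injective S ∧ (∀ μ, sig μ S = sig μ T') ∧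
      ∀ μ, sig μ T = sig μ (S.prodMap (0 : E →ₗ[F] E)) := by
  obtain ⟨a, hinj, hsup, hdim⟩ := h
  set E := Module.End.eigenspace T (a i0) with hE
  set V' := ⨆ i ∈ s, Module.End.eigenspace T (a i) with hV'
  have hcompl : IsCompl V' E := by
    constructor
    · have h1 := (Module.End.eigenspaces_iSupIndep T).disjoint_biSup (x := a i0)
        (y := a '' (s : Set ℕ)) (by
          rintro ⟨i, hi, he⟩
          have := hinj (Finset.mem_coe.2 (Finset.mem_insert_of_mem hi))
            (Finset.mem_coe.2 (Finset.mem_insert_self i0 s)) he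
          subst this
          exact hi0 hi)
      rw [iSup_image] at h1
      exact h1.symm
    · rw [codisjoint_iff, sup_comm, ← hsup, Finset.iSup_insert]
  have hTV : ∀ x ∈ V', T x ∈ V' := by
    have : V' ≤ V'.comap T := by
      refine iSup₂_le fun i hi x hx => ?_
      rw [Submodule.mem_comap, Module.End.mem_eigenspace_iff.1 hx]
      have hle : Module.End.eigenspace T (a i) ≤ V' :=
        le_iSup₂_of_le (f := fun i (_ : i ∈ s) => Module.End.eigenspace T (a i)) i hi le_rfl
      exact V'.smul_mem _ (hle hx)
    exact this
  let T' : V' →ₗ[F] V' := T.restrict hTV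
  let S : V' →ₗ[F] V' := T' - a i0 • LinearMap.id
  have hmap : ∀ i ∈ s, (Module.End.eigenspace T' (a i)).map V'.subtype =
      Module.End.eigenspace T (a i) := by
    intro i hi
    have hle : Module.End.eigenspace T (a i) ≤ V' :=
        le_iSup₂_of_le (f := fun i (_ : i ∈ s) => Module.End.eigenspace T (a i)) i hi le_rfl
    ext x
    constructor
    · rintro ⟨y, hy, rfl⟩
      have hy' := congrArg Subtype.val (Module.End.mem_eigenspace_iff.1 hy)
      exact Module.End.mem_eigenspace_iff.2 hy'
    · intro hx
      refine ⟨⟨x, hle hx⟩, ?_, rfl⟩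
      refine Module.End.mem_eigenspace_iff.2 (Subtype.ext ?_)
      exact Module.End.mem_eigenspace_iff.1 hx
  have hSE : ∀ x : V', (S x : V) = T x - a i0 • (x : V) := fun x => rfl
  refine ⟨V', E, T', S, ⟨a, hinj.mono (by simp), ?_, ?_⟩, hdim i0 (Finset.mem_insert_self _ _),
    ?_, ?_, ?_⟩
  · apply Submodule.map_injective_of_injective V'.subtype_injective
    rw [Submodule.map_top, Submodule.range_subtype, Submodule.map_iSup]
    conv_rhs => rw [hV']
    refine iSup_congr fun i => ?_
    rw [Submodule.map_iSup]
    exact iSup_congr fun hi => hmap i hi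
  · intro i hi
    rw [← hdim i (Finset.mem_insert_of_mem hi), ← hmap i hi, Submodule.finrank_map_subtype_eq]
  · rw [← LinearMap.ker_eq_bot, LinearMap.ker_eq_bot']
    intro x hx
    have h1 : T x - a i0 • (x : V) = 0 := by rw [← hSE, hx]; rfl
    have h2 : (x : V) ∈ E := Module.End.mem_eigenspace_iff.2 (sub_eq_zero.1 h1)
    have h3 := Submodule.disjoint_def.1 hcompl.disjoint x x.2 h2
    exact Subtype.ext h3
  · intro μ
    exact sig_shift T' (a i0) μ
  · intro μ
    rw [← sig_shift T (a i0)]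
    refine (sig_conj (Submodule.prodEquivOfIsCompl V' E hcompl) _ _ ?_ μ).symm
    rintro ⟨x, y⟩
    have hy := Module.End.mem_eigenspace_iff.1 y.2
    simp only [LinearMap.prodMap_apply, LinearMap.zero_apply, Submodule.coe_prodEquivOfIsCompl',
      hSE, LinearMap.sub_apply, LinearMap.smul_apply, LinearMap.id_apply, map_add, hy, smul_add,
      Submodule.coe_zero]
    abel

end induct

theorem main (N : ℕ) (ν : ℕ →₀ ℕ) (s : Finset ℕ) : ∀ μ : ℕ →₀ ℕ, ∃ P : ℤ[X],
    (∀ j, N ≤ j → μ j = 0) → (ww N μ ∣ P ∧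
      ∀ (F : Type) [Field F] [Fintype F] (V : Type) [AddCommGroup V] [Module F V] [Fintype V]
        (T : V →ₗ[F] V), DT s ν T → sig μ T = P.eval (Fintype.card F : ℤ)) := by
  induction s using Finset.induction_on with
  | empty =>
    intro μ
    refine ⟨if μ = 0 then 1 else 0, fun hμ => ⟨?_, ?_⟩⟩
    · split_ifs with h
      · subst h; simp [ww]
      · simp
    · intro F _ _ V _ _ _ T ⟨a, _, htop, _⟩
      simp only [Finset.notMem_empty, iSup_false, iSup_bot] at htop
      have hsub : ∀ W : Submodule F V, W = ⊥ := fun W => by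
        rw [eq_bot_iff, htop]; exact le_top
      have huniv : (Finset.univ : Finset (Submodule F V)) = {⊥} := by
        ext E1; simp [hsub E1]
      rw [sig, huniv, Finset.sum_singleton]
      have hiff : prof T μ ⊥ ↔ μ = 0 := by
        have h0 : prof T 0 ⊥ := by
          intro j
          rw [hsub (IS T ⊥ (j + 1)), finrank_bot]
          simp
        constructor
        · intro h
          exact prof_unique h h0
        · rintro rfl
          exact h0
      rw [if_congr hiff rfl rfl]
      split_ifs <;> simp
  | insert i0 s hi0 ih =>
    choose P hP using ih
    intro μ
    refine ⟨∑ p ∈ Finset.HasAntidiagonal.antidiagonal μ, P p.1 * NN (ν i0) N p.1 p.2,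
      fun hμ => ?_⟩
    have hzero : ∀ p ∈ Finset.HasAntidiagonal.antidiagonal μ, ∀ j, N ≤ j → p.1 j = 0 := by
      intro p hp j hj
      have h1 := hμ j hj
      rw [← Finset.HasAntidiagonal.mem_antidiagonal.1 hp, Finsupp.add_apply] at h1
      omega
    constructor
    · refine Finset.dvd_sum fun p hp => ?_
      rw [← Finset.HasAntidiagonal.mem_antidiagonal.1 hp]
      exact ww_dvd _ _ _ _ (hzero p hp N le_rfl) _ (hP p.1 (hzero p hp)).1
    · intro F _ _ V _ _ _ T hT
      obtain ⟨V', E, T', S, hT', hE, hS, h1, h2⟩ := DT_insert i0 s hi0 ν T hT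
      rw [h2, sig_rec S hS N μ hμ, eval_finsetSum]
      refine Finset.sum_congr rfl fun p hp => ?_
      rw [eval_mul, h1, (hP p.1 (hzero p hp)).2 F V' T' hT', hE]

end Prof

/-- For fixed partitions `μ, ν` of `n` there is a polynomial
`b ∈ ℤ[t]` such that for every prime power `q` and every diagonalizable matrix
`Δ ∈ Mₙ(𝔽_q)` of type `ν`,
`σ(μ,Δ) = (q-1)^{∑_{j≥2} μ_j} q^{∑_{j≥2} C(μ_j,2)} b(q)`. -/
theorem statement11 (n : ℕ) (hn : 0 < n) (μ ν : ℕ →₀ ℕ) (hμ : IsPtn μ) (hν : IsPtn ν)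
    (hμn : ptnSize μ = n) (hνn : ptnSize ν = n) :
    ∃ b : Polynomial ℤ,
      ∀ (q : ℕ), IsPrimePow q →
        ∀ (F : Type) [Field F] [Fintype F], Fintype.card F = q →
          ∀ Δ : Matrix (Fin n) (Fin n) F, DiagOfType Δ ν →
            (sigmaProf μ Δ : ℤ) =
              ((q : ℤ) - 1) ^ (∑ᶠ j : ℕ, μ (j + 1)) *
                (q : ℤ) ^ (∑ᶠ j : ℕ, (μ (j + 1)).choose 2) * b.eval (q : ℤ) := by
  let N := μ.support.sup id + 1
  have hN : ∀ j, N ≤ j → μ j = 0 := by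
    intro j hj
    by_contra h
    have h1 : id j ≤ μ.support.sup id := Finset.le_sup (Finsupp.mem_support_iff.2 h)
    have h2 : j ≤ μ.support.sup id := h1
    have h3 : μ.support.sup id + 1 ≤ j := hj
    omega
  obtain ⟨P, hP⟩ := Prof.main N ν ν.support μ
  obtain ⟨⟨b, hb⟩, hsig⟩ := hP hN
  refine ⟨b, ?_⟩
  intro q _ F _ _ hq Δ hΔ
  have h1 := hsig F (Fin n → F) Δ.mulVecLin hΔ
  have hIS : ∀ (W : Submodule F (Fin n → F)) (j : ℕ),
      Prof.IS Δ.mulVecLin W j = iterSpan Δ W j := by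
    intro W j
    induction j with
    | zero => simp [Prof.IS, iterSpan]
    | succ j ih =>
      rw [Prof.IS, ih, iterSpan, iterSpan]
      apply le_antisymm
      · refine sup_le ?_ ?_
        · refine le_iSup₂_of_le 0 (by simp) ?_
          simp
        · rw [Submodule.map_iSup]
          refine iSup_le fun i => ?_
          rw [Submodule.map_iSup]
          refine iSup_le fun hi => ?_
          refine le_iSup₂_of_le (i + 1) (by simpa using hi) ?_
          rw [← Submodule.map_comp, ← Matrix.mulVecLin_mul, ← pow_succ']
      · refine iSup₂_le fun i hi => ?_
        rcases i with _ | i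
        · refine le_sup_of_le_left ?_
          simp
        · refine le_sup_of_le_right ?_
          rw [pow_succ', Matrix.mulVecLin_mul, Submodule.map_comp]
          refine Submodule.map_mono ?_
          exact le_iSup₂_of_le (f := fun i (_ : i ∈ Finset.range j) =>
            W.map (Δ ^ i).mulVecLin) i (by simpa using hi) le_rfl
  have h2 : (sigmaProf μ Δ : ℤ) = Prof.sig μ Δ.mulVecLin := by
    rw [sigmaProf, Prof.sig, Finset.sum_boole, Nat.card_eq_fintype_card, Fintype.card_subtype]
    congr 2
    ext W
    simp only [Finset.mem_filter, Finset.mem_univ, true_and]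
    refine forall_congr' fun j => ?_
    rw [hIS]
  have hfs : ∀ g : ℕ → ℕ, g 0 = 0 → (∑ᶠ j : ℕ, g (μ (j + 1))) =
      ∑ j ∈ Finset.range N, g (μ (j + 1)) := by
    intro g hg
    apply finsum_eq_sum_of_support_subset
    intro j hj
    by_contra h
    have h' : N ≤ j := by simpa using h
    exact hj (by simp [hN (j + 1) (by omega), hg])
  rw [h2, h1, hb, Prof.ww, hfs (fun x => x) rfl, hfs (fun x => x.choose 2) rfl, hq]
  simp only [eval_mul, eval_pow, eval_sub, eval_X, eval_one]
end
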